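/- Let 1 < p < ∞, d, n ∈ ℕ, and let W be a matrix A_p weight on ℝ^d with reducing operators V_I. Then there is a constant C depending only on p, n, d such that for every f⃗ ∈ L^p(W), ‖f⃗‖_{L^p(W)} ≤ C ‖W‖_{A_p}^{1/p + ⌈p⌉/p} ( ∫_{ℝ^d} ( ∑_{I ∈ 𝒟} ∑_{ε ∈ 𝒮} |V_I f⃗_I^ε|² |I|^{−1} χ_I(x) )^{p/2} dx )^{1/p}, where ⌈p⌉ is the smallest integer ≥ p. -/

import Mathlib

open MeasureTheory ENNReal
open scoped ComplexOrder

noncomputable section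

/-! ## Basic linear-algebra notation -/

/-- The operator norm of an `n × n` complex matrix, viewed as an operator on the
Euclidean space `ℂⁿ`. -/
def matNorm {n : ℕ} (M : Matrix (Fin n) (Fin n) ℂ) : ℝ :=
  ‖Matrix.toEuclideanCLM (𝕜 := ℂ) (n := Fin n) M‖

/-- A matrix applied to a vector of `ℂⁿ` (with its Euclidean norm). -/
def mApp {n : ℕ} (M : Matrix (Fin n) (Fin n) ℂ) (v : EuclideanSpace ℂ (Fin n)) :
    EuclideanSpace ℂ (Fin n) :=
  Matrix.toEuclideanCLM (𝕜 := ℂ) (n := Fin n) M v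


/-- Entrywise measurability of a matrix-valued function. -/
def MatMeasurable {d n : ℕ} (W : (Fin d → ℝ) → Matrix (Fin n) (Fin n) ℂ) : Prop :=
  ∀ i j, Measurable fun x => W x i j

/-! ## Dyadic cubes and Haar functions -/

/-- A dyadic cube in `ℝ^d`, with side length `2^k` and lower-left corner `(m i * 2^k)_i`. -/
structure DCube (d : ℕ) where
  k : ℤ
  m : Fin d → ℤ

namespace DCube

variable {d : ℕ}

/-- The (half-open) cube in `ℝ^d` determined by a dyadic cube. -/
def set (I : DCube d) : Set (Fin d → ℝ) :=
  {x | ∀ i, (I.m i : ℝ) * 2 ^ I.k ≤ x i ∧ x i < ((I.m i : ℝ) + 1) * 2 ^ I.k}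

/-- The volume `|I| = (2^k)^d` of a dyadic cube. -/
def vol (I : DCube d) : ℝ := ((2 : ℝ) ^ I.k) ^ d

/-- The lower-left corner of a dyadic cube. -/
def corner (I : DCube d) : Fin d → ℝ := fun i => (I.m i : ℝ) * 2 ^ I.k

/-- The side length of a dyadic cube. -/
def side (I : DCube d) : ℝ := (2 : ℝ) ^ I.k

end DCube

/-- One-dimensional Haar functions on the dyadic interval `[m·2^k, (m+1)·2^k)`:
`haar1D true` is the non-cancellative `|I|^{-1/2} χ_I`, while `haar1D false` is
`|I|^{-1/2} (χ_{I_ℓ} - χ_{I_r})`. -/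
def haar1D (ε : Bool) (k mm : ℤ) (t : ℝ) : ℝ :=
  if ε then
    Set.indicator {s : ℝ | (mm : ℝ) * 2 ^ k ≤ s ∧ s < ((mm : ℝ) + 1) * 2 ^ k}
      (fun _ => ((2 : ℝ) ^ k) ^ (-(1 / 2 : ℝ))) t
  else
    Set.indicator {s : ℝ | (mm : ℝ) * 2 ^ k ≤ s ∧ s < (mm : ℝ) * 2 ^ k + 2 ^ (k - 1)}
      (fun _ => ((2 : ℝ) ^ k) ^ (-(1 / 2 : ℝ))) t -
    Set.indicator {s : ℝ | (mm : ℝ) * 2 ^ k + 2 ^ (k - 1) ≤ s ∧ s < ((mm : ℝ) + 1) * 2 ^ k}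
      (fun _ => ((2 : ℝ) ^ k) ^ (-(1 / 2 : ℝ))) t

/-- The signature set `𝒮 = {0,1}^d \ {(1,…,1)}` indexing the cancellative Haar functions. -/
def Sfin (d : ℕ) : Finset (Fin d → Bool) := Finset.univ.erase (fun _ => true)

/-- The Haar function `h_I^ε = ∏ i, h_{I_i}^{ε_i}` associated to a dyadic cube `I ⊂ ℝ^d`
and a signature `ε ∈ {0,1}^d`. -/
def haarFn {d : ℕ} (I : DCube d) (ε : Fin d → Bool) (x : Fin d → ℝ) : ℝ :=
  ∏ i, haar1D (ε i) I.k (I.m i) (x i)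

/-- The (vector of) Haar coefficients `f_I^ε = ∫ f h_I^ε` of a `ℂⁿ`-valued function. -/
def haarCoef {d n : ℕ} (f : (Fin d → ℝ) → EuclideanSpace ℂ (Fin n)) (I : DCube d)
    (ε : Fin d → Bool) : EuclideanSpace ℂ (Fin n) :=
  ∫ x, haarFn I ε x • f x

/-! ## Matrix `A_p` weights and reducing operators -/

/-- The (closed, axis-parallel) cube with corner `c` and side length `r`. -/
def cubeSet {d : ℕ} (c : Fin d → ℝ) (r : ℝ) : Set (Fin d → ℝ) :=
  {x | ∀ i, c i ≤ x i ∧ x i ≤ c i + r}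

/-- The matrix `A_p` characteristic `‖W‖_{A_p}` of a matrix weight `W`, expressed in terms of
`W1p = W^{1/p}` (so that `W^{-1/p} = (W1p)⁻¹`):
`sup_I (1/|I|) ∫_I ((1/|I|) ∫_I ‖W^{1/p}(x) W^{-1/p}(t)‖^{p'} dt)^{p/p'} dx`,
the supremum being over all cubes `I ⊂ ℝ^d`.  Here `p' = p/(p-1)` and `p/p' = p - 1`. -/
def apNorm {d n : ℕ} (p : ℝ) (W1p : (Fin d → ℝ) → Matrix (Fin n) (Fin n) ℂ) : ℝ≥0∞ :=
  ⨆ (c : Fin d → ℝ) (r : ℝ) (_ : 0 < r),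
    (ENNReal.ofReal (r ^ d))⁻¹ *
      ∫⁻ x in cubeSet c r,
        ((ENNReal.ofReal (r ^ d))⁻¹ *
            ∫⁻ t in cubeSet c r,
              ENNReal.ofReal (matNorm (W1p x * (W1p t)⁻¹)) ^ (p / (p - 1))) ^ (p - 1)

/-- The `L^q` average `(|I|^{-1} ∫_I ‖A(x) e‖^q dx)^{1/q}` over a dyadic cube. -/
def redAvgD {d n : ℕ} (q : ℝ) (A : (Fin d → ℝ) → Matrix (Fin n) (Fin n) ℂ) (I : DCube d)
    (e : EuclideanSpace ℂ (Fin n)) : ℝ≥0∞ :=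
  ((ENNReal.ofReal I.vol)⁻¹ * ∫⁻ x in I.set, ENNReal.ofReal ‖mApp (A x) e‖ ^ q) ^ (1 / q)

/-- `V` is a family of reducing operators for the weight `W = (W1p)^p` (indexed by dyadic
cubes), with comparability constants `c₁, c₂`:  each `V I` is positive definite and
`|V_I e| ≈ (|I|^{-1} ∫_I |W^{1/p}(x) e|^p dx)^{1/p}`. -/
def IsReducing {d n : ℕ} (p c₁ c₂ : ℝ) (W1p : (Fin d → ℝ) → Matrix (Fin n) (Fin n) ℂ)
    (V : DCube d → Matrix (Fin n) (Fin n) ℂ) : Prop :=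
  ∀ I : DCube d, (V I).PosDef ∧ ∀ e : EuclideanSpace ℂ (Fin n),
    ENNReal.ofReal c₁ * redAvgD p W1p I e ≤ ENNReal.ofReal ‖mApp (V I) e‖ ∧
    ENNReal.ofReal ‖mApp (V I) e‖ ≤ ENNReal.ofReal c₂ * redAvgD p W1p I e

/-- `V'` is a family of dual reducing operators for the weight `W = (W1p)^p`:
`|V_I' e| ≈ (|I|^{-1} ∫_I |W^{-1/p}(x) e|^{p'} dx)^{1/p'}` with `p' = p/(p-1)`. -/
def IsDualReducing {d n : ℕ} (p c₁ c₂ : ℝ) (W1p : (Fin d → ℝ) → Matrix (Fin n) (Fin n) ℂ)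
    (V' : DCube d → Matrix (Fin n) (Fin n) ℂ) : Prop :=
  ∀ I : DCube d, (V' I).PosDef ∧ ∀ e : EuclideanSpace ℂ (Fin n),
    ENNReal.ofReal c₁ * redAvgD (p / (p - 1)) (fun x => (W1p x)⁻¹) I e ≤
        ENNReal.ofReal ‖mApp (V' I) e‖ ∧
    ENNReal.ofReal ‖mApp (V' I) e‖ ≤
        ENNReal.ofReal c₂ * redAvgD (p / (p - 1)) (fun x => (W1p x)⁻¹) I e

/-- The `L^p(W)` norm `(∫ |W^{1/p}(x) f(x)|^p dx)^{1/p}` (as a value in `[0,∞]`). -/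
def wNorm {d n : ℕ} (p : ℝ) (W1p : (Fin d → ℝ) → Matrix (Fin n) (Fin n) ℂ)
    (f : (Fin d → ℝ) → EuclideanSpace ℂ (Fin n)) : ℝ≥0∞ :=
  (∫⁻ x, ENNReal.ofReal ‖mApp (W1p x) (f x)‖ ^ p) ^ (1 / p)

/-- The square-function expression
`∑_{I ∈ 𝒟} ∑_{ε ∈ 𝒮} |A_I f_I^ε|² |I|^{-1} χ_I(x)` for a family of matrices `A_I`. -/
def sqFn {d n : ℕ} (A : DCube d → Matrix (Fin n) (Fin n) ℂ)
    (f : (Fin d → ℝ) → EuclideanSpace ℂ (Fin n)) (x : Fin d → ℝ) : ℝ≥0∞ :=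
  ∑' I : DCube d, ∑ ε ∈ Sfin d,
    Set.indicator I.set
      (fun _ => ENNReal.ofReal (‖mApp (A I) (haarCoef f I ε)‖ ^ 2) / ENNReal.ofReal I.vol) x

/-! ## Stopping times -/

/-- A stopping time assigns to each dyadic cube `I` a collection `𝒥 I` of pairwise disjoint
dyadic subcubes of `I`. -/
def IsStopping {d : ℕ} (𝒥 : DCube d → Set (DCube d)) : Prop :=
  ∀ I : DCube d, (∀ J ∈ 𝒥 I, J.set ⊆ I.set) ∧
    (𝒥 I).Pairwise fun J K => Disjoint J.set K.set

/-- `ℱ(I)`: the dyadic subcubes of `I` not contained in any stopping cube `J ∈ 𝒥(I)`. -/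
def Fcol {d : ℕ} (𝒥 : DCube d → Set (DCube d)) (I : DCube d) : Set (DCube d) :=
  {J | J.set ⊆ I.set ∧ ∀ K ∈ 𝒥 I, ¬J.set ⊆ K.set}

/-- A stopping time is admissible if `I ∈ ℱ(I)` for every `I`. -/
def Admissible {d : ℕ} (𝒥 : DCube d → Set (DCube d)) : Prop :=
  ∀ I : DCube d, I ∈ Fcol 𝒥 I

/-- The iterated stopping collections: `𝒥^0(I) = {I}` and
`𝒥^{j+1}(I) = ⋃_{J ∈ 𝒥^j(I)} 𝒥(J)`. -/
def JIter {d : ℕ} (𝒥 : DCube d → Set (DCube d)) : ℕ → DCube d → Set (DCube d)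
  | 0, I => {I}
  | j + 1, I => ⋃ J ∈ JIter 𝒥 j I, 𝒥 J

/-- A stopping time is decaying with constant `c` if
`∑_{J ∈ 𝒥(I)} |J| ≤ c |I|` for every `I`. -/
def Decaying {d : ℕ} (c : ℝ) (𝒥 : DCube d → Set (DCube d)) : Prop :=
  ∀ I : DCube d,
    ∑' J : 𝒥 I, ENNReal.ofReal (J : DCube d).vol ≤ ENNReal.ofReal c * ENNReal.ofReal I.vol

/-- `ℱ^j = ℱ^j(I₀) = ⋃_{J ∈ 𝒥^{j-1}(I₀)} ℱ(J)` (intended for `j ≥ 1`). -/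
def Fj {d : ℕ} (𝒥 : DCube d → Set (DCube d)) (I₀ : DCube d) (j : ℕ) : Set (DCube d) :=
  ⋃ J ∈ JIter 𝒥 (j - 1) I₀, Fcol 𝒥 J

/-- The Haar projection `Δ_j f = ∑_{I ∈ ℱ^j} ∑_{ε ∈ 𝒮} f_I^ε h_I^ε`. -/
def deltaHaar {d n : ℕ} (𝒥 : DCube d → Set (DCube d)) (I₀ : DCube d) (j : ℕ)
    (f : (Fin d → ℝ) → EuclideanSpace ℂ (Fin n)) (x : Fin d → ℝ) :
    EuclideanSpace ℂ (Fin n) :=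
  ∑' I : Fj 𝒥 I₀ j, ∑ ε ∈ Sfin d, haarFn (I : DCube d) ε x • haarCoef f (I : DCube d) ε

/-! ## Constant Haar multipliers -/

/-- `∑_{I ∈ S} ∑_{ε ∈ 𝒮} V_I^{-1} f_I^ε h_I^ε(x)`. -/
def projInv {d n : ℕ} (V : DCube d → Matrix (Fin n) (Fin n) ℂ) (S : Set (DCube d))
    (f : (Fin d → ℝ) → EuclideanSpace ℂ (Fin n)) (x : Fin d → ℝ) :
    EuclideanSpace ℂ (Fin n) :=
  ∑' I : S, ∑ ε ∈ Sfin d,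
    haarFn (I : DCube d) ε x • mApp ((V (I : DCube d))⁻¹) (haarCoef f (I : DCube d) ε)

/-- A function has finite Haar expansion if it is a finite sum of Haar functions. -/
def FiniteHaar {d n : ℕ} (f : (Fin d → ℝ) → EuclideanSpace ℂ (Fin n)) : Prop :=
  ∃ F : Finset (DCube d × (Fin d → Bool)),
    ∀ x, f x = ∑ q ∈ F, haarFn q.1 q.2 x • haarCoef f q.1 q.2

/-! ## The weighted stopping time -/

/-- The stopping condition `‖V_J V_I^{-1}‖^p > λ₁` or `‖V_J^{-1} V_I‖^{p'} > λ₂`. -/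
def stopBad {d n : ℕ} (p l₁ l₂ : ℝ) (V : DCube d → Matrix (Fin n) (Fin n) ℂ)
    (J I : DCube d) : Prop :=
  l₁ < matNorm (V J * (V I)⁻¹) ^ p ∨ l₂ < matNorm ((V J)⁻¹ * V I) ^ (p / (p - 1))

/-- The stopping time `𝒥(I)` = maximal dyadic subcubes `J ⊆ I` satisfying `stopBad`. -/
def stopST {d n : ℕ} (p l₁ l₂ : ℝ) (V : DCube d → Matrix (Fin n) (Fin n) ℂ)
    (I : DCube d) : Set (DCube d) :=
  {J | J.set ⊆ I.set ∧ stopBad p l₁ l₂ V J I ∧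
    ∀ K : DCube d, K.set ⊆ I.set → stopBad p l₁ l₂ V K I → J.set ⊆ K.set → K = J}

/-! ## Geometry of dyadic cubes -/

namespace DCube

variable {d : ℕ}

/-- The dyadic cube of side length `2^k` containing `x`. -/
def cubeAt (k : ℤ) (x : Fin d → ℝ) : DCube d := ⟨k, fun i => ⌊x i / 2 ^ k⌋⟩

/-- The dyadic children of a cube, indexed by `{0,1}^d`. -/
def child (I : DCube d) (c : Fin d → Bool) : DCube d :=
  ⟨I.k - 1, fun i => 2 * I.m i + if c i then 1 else 0⟩

@[simp] lemma child_k (I : DCube d) (c : Fin d → Bool) : (I.child c).k = I.k - 1 := rfl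

@[simp] lemma cubeAt_k (k : ℤ) (x : Fin d → ℝ) : (cubeAt k x).k = k := rfl

lemma ext' {I J : DCube d} (hk : I.k = J.k) (hm : ∀ i, I.m i = J.m i) : I = J := by
  cases I; cases J
  simp only [mk.injEq]
  exact ⟨hk, funext hm⟩

lemma mem_set_iff_floor {I : DCube d} {x : Fin d → ℝ} :
    x ∈ I.set ↔ ∀ i, ⌊x i / 2 ^ I.k⌋ = I.m i := by
  have h2 : (0 : ℝ) < 2 ^ I.k := by positivity
  simp only [DCube.set, Set.mem_ofPred_eq, Int.floor_eq_iff, le_div_iff₀ h2, div_lt_iff₀ h2]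

lemma mem_set_iff {I : DCube d} {x : Fin d → ℝ} : x ∈ I.set ↔ cubeAt I.k x = I := by
  rw [mem_set_iff_floor]
  constructor
  · intro h
    exact ext' rfl h
  · intro h i
    exact congrFun (congrArg DCube.m h) i

lemma mem_cubeAt (k : ℤ) (x : Fin d → ℝ) : x ∈ (cubeAt k x).set := mem_set_iff.2 rfl

lemma cubeAt_congr {k k' : ℤ} (hk : k ≤ k') {x y : Fin d → ℝ}
    (h : cubeAt k x = cubeAt k y) : cubeAt k' x = cubeAt k' y := by
  refine ext' rfl fun i => ?_
  have hi : ⌊x i / 2 ^ k⌋ = ⌊y i / 2 ^ k⌋ := congrFun (congrArg DCube.m h) i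
  obtain ⟨j, rfl⟩ := Int.le.dest hk
  have key : ∀ t : ℝ, ⌊t / 2 ^ (k + (j : ℤ))⌋ = ⌊t / 2 ^ k⌋ / ((2 ^ j : ℕ) : ℤ) := by
    intro t
    rw [← Int.floor_div_natCast, zpow_add₀ (by norm_num : (2 : ℝ) ≠ 0), div_mul_eq_div_div]
    simp
  simp only [cubeAt, key, hi]

lemma subset_of_mem {I J : DCube d} {x : Fin d → ℝ} (hI : x ∈ I.set) (hJ : x ∈ J.set)
    (hk : I.k ≤ J.k) : I.set ⊆ J.set := by
  intro y hy
  rw [mem_set_iff] at *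
  rw [← hJ]
  exact cubeAt_congr hk (hy.trans hI.symm)

lemma corner_mem (I : DCube d) : I.corner ∈ I.set := by
  intro i
  have h2 : (0 : ℝ) < 2 ^ I.k := by positivity
  constructor
  · exact le_rfl
  · simp only [corner]
    nlinarith

lemma vol_pos (I : DCube d) : 0 < I.vol := by unfold vol; positivity

lemma set_eq_pi (I : DCube d) :
    I.set = Set.univ.pi fun i =>
      Set.Ico ((I.m i : ℝ) * 2 ^ I.k) (((I.m i : ℝ) + 1) * 2 ^ I.k) := by
  ext x
  simp [DCube.set]

lemma measurableSet_set (I : DCube d) : MeasurableSet I.set := by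
  rw [set_eq_pi]
  exact MeasurableSet.univ_pi fun i => measurableSet_Ico

lemma volume_set (I : DCube d) : volume I.set = ENNReal.ofReal I.vol := by
  rw [set_eq_pi, Real.volume_pi_Ico]
  have : ∀ i, ((I.m i : ℝ) + 1) * 2 ^ I.k - (I.m i : ℝ) * 2 ^ I.k = 2 ^ I.k := by
    intro i; ring
  simp only [this, Finset.prod_const, Finset.card_univ, Fintype.card_fin, vol]
  rw [ENNReal.ofReal_pow (by positivity)]

lemma volume_set_pos (I : DCube d) : 0 < volume I.set := by
  rw [volume_set]; simpa using I.vol_pos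

lemma volume_set_ne_zero (I : DCube d) : volume I.set ≠ 0 := I.volume_set_pos.ne'

lemma volume_set_ne_top (I : DCube d) : volume I.set ≠ ⊤ := by
  rw [volume_set]; simp

lemma volume_real_set (I : DCube d) : volume.real I.set = I.vol := by
  rw [Measure.real, volume_set, ENNReal.toReal_ofReal I.vol_pos.le]

lemma cubeAt_child (I : DCube d) (c : Fin d → Bool) {x : Fin d → ℝ}
    (hx : x ∈ (I.child c).set) : x ∈ I.set := by
  rw [mem_set_iff_floor] at *
  intro i
  have hi := hx i
  have key : ⌊x i / 2 ^ I.k⌋ = ⌊x i / 2 ^ (I.k - 1)⌋ / ((2 : ℕ) : ℤ) := by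
    rw [← Int.floor_div_natCast, zpow_sub₀ (by norm_num : (2 : ℝ) ≠ 0)]
    congr 1
    field_simp
    simp
  simp only [child] at hi
  rw [key, hi]
  push_cast
  split_ifs <;> omega

lemma child_subset (I : DCube d) (c : Fin d → Bool) : (I.child c).set ⊆ I.set :=
  fun _ hx => cubeAt_child I c hx

lemma exists_mem_child (I : DCube d) {x : Fin d → ℝ} (hx : x ∈ I.set) :
    ∃ c, x ∈ (I.child c).set := by
  rw [mem_set_iff_floor] at hx
  refine ⟨fun i => decide (⌊x i / 2 ^ (I.k - 1)⌋ % 2 = 1), ?_⟩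
  rw [mem_set_iff_floor]
  intro i
  have hi := hx i
  have key : ⌊x i / 2 ^ I.k⌋ = ⌊x i / 2 ^ (I.k - 1)⌋ / ((2 : ℕ) : ℤ) := by
    rw [← Int.floor_div_natCast, zpow_sub₀ (by norm_num : (2 : ℝ) ≠ 0)]
    congr 1
    field_simp
    simp
  rw [key] at hi
  simp only [child, decide_eq_true_eq]
  push_cast at hi
  split_ifs <;> omega

lemma child_injective (I : DCube d) : Function.Injective I.child := by
  intro c c' h
  funext i
  have hi : 2 * I.m i + (if c i then 1 else 0) = 2 * I.m i + if c' i then 1 else 0 :=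
    congrFun (congrArg DCube.m h) i
  cases h1 : c i <;> cases h2 : c' i <;> simp [h1, h2] at hi ⊢

lemma disjoint_of_k_eq {I J : DCube d} (hk : I.k = J.k) (h : I ≠ J) : Disjoint I.set J.set := by
  rw [Set.disjoint_left]
  intro x hI hJ
  rw [mem_set_iff] at hI hJ
  exact h (hI.symm.trans (hk ▸ hJ))

lemma disjoint_child (I : DCube d) {c c' : Fin d → Bool} (h : c ≠ c') :
    Disjoint (I.child c).set (I.child c').set :=
  disjoint_of_k_eq rfl fun e => h (I.child_injective e)

lemma set_eq_iUnion_child (I : DCube d) : I.set = ⋃ c, (I.child c).set := by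
  ext x
  simp only [Set.mem_iUnion]
  exact ⟨I.exists_mem_child, fun ⟨c, hc⟩ => I.child_subset c hc⟩

lemma vol_child (I : DCube d) (c : Fin d → Bool) : 2 ^ d * (I.child c).vol = I.vol := by
  simp only [vol, child_k]
  rw [← mul_pow, zpow_sub₀ (by norm_num : (2 : ℝ) ≠ 0)]
  congr 1
  field_simp

lemma sum_vol_child (I : DCube d) : ∑ c, (I.child c).vol = I.vol := by
  have h : ∀ c, (I.child c).vol = I.vol / 2 ^ d := fun c => by
    rw [← vol_child I c]; field_simp
  simp only [h, Finset.sum_const, Finset.card_univ, Fintype.card_fun, Fintype.card_bool,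
    Fintype.card_fin, nsmul_eq_mul]
  push_cast
  field_simp

lemma set_eq_cubeSet_ae (I : DCube d) :
    I.set =ᵐ[volume] cubeSet I.corner I.side := by
  have h1 : cubeSet I.corner I.side = Set.Icc I.corner (fun i => I.corner i + I.side) := by
    ext x
    simp only [cubeSet, Set.mem_ofPred_eq, Set.mem_Icc, Pi.le_def]
    exact forall_and
  have h2 : I.set = Set.univ.pi fun i => Set.Ico (I.corner i) (I.corner i + I.side) := by
    rw [set_eq_pi]
    simp only [corner, side, add_mul, one_mul]
  rw [h1, h2]
  exact Measure.univ_pi_Ico_ae_eq_Icc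

lemma cubeSet_eq_closedBall (c : Fin d → ℝ) {r : ℝ} (hr : 0 ≤ r) :
    cubeSet c r = Metric.closedBall (fun i => c i + r / 2) (r / 2) := by
  ext x
  rw [Metric.mem_closedBall, dist_pi_le_iff (by positivity)]
  simp only [cubeSet, Set.mem_ofPred_eq, Real.dist_eq, abs_le]
  refine forall_congr' fun i => ?_
  constructor <;> rintro ⟨h1, h2⟩ <;> constructor <;> linarith

lemma side_pow (I : DCube d) : I.side ^ d = I.vol := rfl

lemma lintegral_eq_sum_child (I : DCube d) (φ : (Fin d → ℝ) → ℝ≥0∞) :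
    ∫⁻ x in I.set, φ x = ∑ c, ∫⁻ x in (I.child c).set, φ x := by
  conv_lhs => rw [set_eq_iUnion_child]
  rw [lintegral_iUnion (fun c => (I.child c).measurableSet_set)
    (fun c c' h => I.disjoint_child h), tsum_fintype]

lemma integral_eq_sum_child {E : Type*} [NormedAddCommGroup E] [NormedSpace ℝ E] (I : DCube d)
    {φ : (Fin d → ℝ) → E} (hφ : IntegrableOn φ I.set) :
    ∫ x in I.set, φ x = ∑ c, ∫ x in (I.child c).set, φ x := by
  conv_lhs => rw [set_eq_iUnion_child]
  refine integral_iUnion_fintype (fun c => (I.child c).measurableSet_set)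
    (fun c c' h => I.disjoint_child h) fun c => hφ.mono_set (I.child_subset c)

end DCube

section HaarAlgebra

/-! ## Haar coefficients and the telescoping identity -/

/-- The sign of `h_I^ε` on the child of `I` with index `c`. -/
def haarSign {d : ℕ} (ε c : Fin d → Bool) : ℝ := ∏ i, if ε i then 1 else if c i then -1 else 1

lemma sum_haarSign_mul {d : ℕ} (c c' : Fin d → Bool) :
    ∑ ε, haarSign ε c * haarSign ε c' = if c = c' then 2 ^ d else 0 := by
  have h1 : ∑ ε : Fin d → Bool, haarSign ε c * haarSign ε c' =
      ∏ i : Fin d, ∑ b : Bool, (if b then (1 : ℝ) else if c i then -1 else 1) *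
        (if b then (1 : ℝ) else if c' i then -1 else 1) := by
    rw [Finset.prod_univ_sum, Fintype.piFinset_univ]
    simp only [haarSign, Finset.prod_mul_distrib]
  rw [h1]
  split_ifs with h
  · subst h
    have : ∀ i, ∑ b : Bool, (if b then (1 : ℝ) else if c i then -1 else 1) *
        (if b then (1 : ℝ) else if c i then -1 else 1) = 2 := by
      intro i; cases c i <;> norm_num
    simp only [this, Finset.prod_const, Finset.card_univ, Fintype.card_fin]
  · obtain ⟨i, hi⟩ := Function.ne_iff.1 h
    refine Finset.prod_eq_zero (Finset.mem_univ i) ?_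
    cases h1 : c i <;> cases h2 : c' i <;> simp_all

lemma haar1D_child (ε b : Bool) (k m : ℤ) {t : ℝ}
    (h1 : ((2 * m + if b then 1 else 0 : ℤ) : ℝ) * 2 ^ (k - 1) ≤ t)
    (h2 : t < (((2 * m + if b then 1 else 0 : ℤ) : ℝ) + 1) * 2 ^ (k - 1)) :
    haar1D ε k m t =
      ((2 : ℝ) ^ k) ^ (-(1 / 2 : ℝ)) * if ε then 1 else if b then -1 else 1 := by
  have hk : (2 : ℝ) ^ k = 2 * 2 ^ (k - 1) := by
    rw [zpow_sub₀ (by norm_num : (2 : ℝ) ≠ 0)]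
    field_simp
  have hpos : (0 : ℝ) < 2 ^ (k - 1) := by positivity
  unfold haar1D
  simp only [Set.indicator_apply, Set.mem_ofPred_eq]
  generalize ((2 : ℝ) ^ k) ^ (-(1 / 2 : ℝ)) = κ
  rw [hk]
  generalize (2 : ℝ) ^ (k - 1) = s at *
  push_cast at h1 h2
  cases ε <;> cases b <;>
    simp only [if_true, Bool.false_eq_true, if_false, Int.cast_one, Int.cast_zero] at *
  · rw [if_pos ⟨by linarith, by linarith⟩, if_neg (by rintro ⟨h, -⟩; linarith)]; ring
  · rw [if_neg (by rintro ⟨-, h⟩; linarith), if_pos ⟨by linarith, by linarith⟩]; ring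
  · rw [if_pos ⟨by linarith, by linarith⟩]; ring
  · rw [if_pos ⟨by linarith, by linarith⟩]; ring

lemma haar1D_eq_zero (ε : Bool) (k m : ℤ) {t : ℝ}
    (h : ¬ ((m : ℝ) * 2 ^ k ≤ t ∧ t < ((m : ℝ) + 1) * 2 ^ k)) : haar1D ε k m t = 0 := by
  have hk : (2 : ℝ) ^ k = 2 * 2 ^ (k - 1) := by
    rw [zpow_sub₀ (by norm_num : (2 : ℝ) ≠ 0)]
    field_simp
  have hpos : (0 : ℝ) < 2 ^ (k - 1) := by positivity
  unfold haar1D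
  simp only [Set.indicator_apply, Set.mem_ofPred_eq]
  generalize ((2 : ℝ) ^ k) ^ (-(1 / 2 : ℝ)) = κ
  rw [hk] at h ⊢
  generalize (2 : ℝ) ^ (k - 1) = s at *
  cases ε
  · rw [if_neg (by simp), if_neg, if_neg]
    · ring
    · rintro ⟨h1, h2⟩; exact h ⟨by linarith, h2⟩
    · rintro ⟨h1, h2⟩; exact h ⟨h1, by linarith⟩
  · rw [if_pos rfl, if_neg h]

variable {d : ℕ}

lemma haarFn_child (I : DCube d) (ε c : Fin d → Bool) {x : Fin d → ℝ}
    (hx : x ∈ (I.child c).set) :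
    haarFn I ε x = (((2 : ℝ) ^ I.k) ^ (-(1 / 2 : ℝ))) ^ d * haarSign ε c := by
  unfold haarFn haarSign
  have : ∀ i, haar1D (ε i) I.k (I.m i) (x i) = ((2 : ℝ) ^ I.k) ^ (-(1 / 2 : ℝ)) *
      if ε i then 1 else if c i then -1 else 1 := fun i =>
    haar1D_child _ _ _ _ (hx i).1 (hx i).2
  simp only [this, Finset.prod_mul_distrib, Finset.prod_const, Finset.card_univ, Fintype.card_fin]

lemma haarFn_eq_zero (I : DCube d) (ε : Fin d → Bool) {x : Fin d → ℝ}
    (hx : x ∉ I.set) : haarFn I ε x = 0 := by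
  simp only [DCube.set, Set.mem_ofPred_eq, not_forall] at hx
  obtain ⟨i, hi⟩ := hx
  exact Finset.prod_eq_zero (Finset.mem_univ i) (haar1D_eq_zero _ _ _ hi)

lemma haarConst_sq (I : DCube d) :
    ((((2 : ℝ) ^ I.k) ^ (-(1 / 2 : ℝ))) ^ d) * ((((2 : ℝ) ^ I.k) ^ (-(1 / 2 : ℝ))) ^ d)
      = I.vol⁻¹ := by
  have h2 : (0 : ℝ) < 2 ^ I.k := by positivity
  rw [← mul_pow, ← Real.rpow_add h2, DCube.vol, ← inv_pow]
  norm_num [Real.rpow_neg_one]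

variable {n : ℕ}

lemma haarCoef_eq_sum (f : (Fin d → ℝ) → EuclideanSpace ℂ (Fin n)) (I : DCube d)
    (hf : IntegrableOn f I.set) (ε : Fin d → Bool) :
    haarCoef f I ε = (((2 : ℝ) ^ I.k) ^ (-(1 / 2 : ℝ))) ^ d •
      ∑ c, haarSign ε c • ∫ x in (I.child c).set, f x := by
  have h1 : haarCoef f I ε = ∫ x in I.set, haarFn I ε x • f x := by
    unfold haarCoef
    rw [setIntegral_eq_integral_of_forall_compl_eq_zero]
    intro x hx
    rw [haarFn_eq_zero I ε hx, zero_smul]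
  have hc : ∀ c, Set.EqOn (fun x => haarFn I ε x • f x)
      (fun x => ((((2 : ℝ) ^ I.k) ^ (-(1 / 2 : ℝ))) ^ d * haarSign ε c) • f x)
      (I.child c).set := fun c x hx => by simp only [haarFn_child I ε c hx]
  have h2 : IntegrableOn (fun x => haarFn I ε x • f x) I.set := by
    rw [I.set_eq_iUnion_child, integrableOn_finite_iUnion]
    intro c
    refine IntegrableOn.congr_fun ?_ (hc c).symm (I.child c).measurableSet_set
    exact (hf.mono_set (I.child_subset c)).smul (_ : ℝ)
  rw [h1, DCube.integral_eq_sum_child I h2, Finset.smul_sum]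
  refine Finset.sum_congr rfl fun c _ => ?_
  rw [setIntegral_congr_fun (I.child c).measurableSet_set (hc c), integral_smul, mul_smul]

/-- `|I|⁻¹ ⟪∫_I f, ∫_I g⟫`. -/
def avgForm (f g : (Fin d → ℝ) → EuclideanSpace ℂ (Fin n)) (I : DCube d) : ℂ :=
  (I.vol : ℂ)⁻¹ * inner ℂ (∫ x in I.set, f x) (∫ x in I.set, g x)

lemma inner_haarCoef (f g : (Fin d → ℝ) → EuclideanSpace ℂ (Fin n)) (I : DCube d)
    (hf : IntegrableOn f I.set) (hg : IntegrableOn g I.set) (ε : Fin d → Bool) :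
    inner ℂ (haarCoef f I ε) (haarCoef g I ε) = (I.vol : ℂ)⁻¹ *
      ∑ c, ∑ c', ((haarSign ε c * haarSign ε c' : ℝ) : ℂ) *
        inner ℂ (∫ x in (I.child c).set, f x) (∫ x in (I.child c').set, g x) := by
  rw [haarCoef_eq_sum f I hf, haarCoef_eq_sum g I hg, ← Complex.coe_smul, ← Complex.coe_smul,
    inner_smul_left, inner_smul_right, Complex.conj_ofReal, ← mul_assoc, ← Complex.ofReal_mul,
    haarConst_sq, sum_inner, Complex.ofReal_inv]
  congr 1
  refine Finset.sum_congr rfl fun c _ => ?_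
  rw [inner_sum]
  refine Finset.sum_congr rfl fun c' _ => ?_
  rw [← Complex.coe_smul, ← Complex.coe_smul, inner_smul_left, inner_smul_right,
    Complex.conj_ofReal, ← mul_assoc, ← Complex.ofReal_mul]

lemma haarSign_true (c : Fin d → Bool) : haarSign (fun _ => true) c = 1 := by
  simp [haarSign]

/-- The martingale-difference identity on one cube. -/
lemma sum_inner_haarCoef (f g : (Fin d → ℝ) → EuclideanSpace ℂ (Fin n)) (I : DCube d)
    (hf : IntegrableOn f I.set) (hg : IntegrableOn g I.set) :
    ∑ ε ∈ Sfin d, inner ℂ (haarCoef f I ε) (haarCoef g I ε) =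
      ∑ c, avgForm f g (I.child c) - avgForm f g I := by
  have h1 : ∑ ε, inner ℂ (haarCoef f I ε) (haarCoef g I ε) =
      ∑ c, avgForm f g (I.child c) := by
    simp only [inner_haarCoef f g I hf hg, ← Finset.mul_sum]
    rw [Finset.sum_comm, Finset.mul_sum]
    refine Finset.sum_congr rfl fun c _ => ?_
    rw [Finset.sum_comm]
    simp only [← Finset.sum_mul, ← Complex.ofReal_sum, sum_haarSign_mul]
    rw [Finset.sum_eq_single c (fun c' _ h => by simp [h.symm]) (by simp)]
    rw [if_pos rfl, avgForm, ← mul_assoc]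
    congr 1
    have h0 : ((I.child c).vol : ℂ) ≠ 0 := by exact_mod_cast (I.child c).vol_pos.ne'
    rw [← I.vol_child c]
    push_cast
    field_simp
  have h2 : inner ℂ (haarCoef f I fun _ => true) (haarCoef g I fun _ => true) =
      avgForm f g I := by
    rw [inner_haarCoef f g I hf hg, avgForm, DCube.integral_eq_sum_child I hf,
      DCube.integral_eq_sum_child I hg, sum_inner]
    simp only [haarSign_true, inner_sum]
    simp
  rw [← h1, ← h2, Sfin, eq_sub_iff_add_eq, Finset.sum_erase_add _ _ (Finset.mem_univ _)]

end HaarAlgebra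

/-! ## Sums over dyadic trees and iterated stopping cubes -/

namespace DCube

variable {d : ℕ}

/-- Strict containment of dyadic cubes. -/
def Lt (L K : DCube d) : Prop := L.k < K.k ∧ L.set ⊆ K.set

lemma Lt.irrefl (K : DCube d) : ¬ K.Lt K := fun h => lt_irrefl _ h.1

lemma Lt.trans {J K L : DCube d} (h : J.Lt K) (h' : K.Lt L) : J.Lt L :=
  ⟨h.1.trans h'.1, h.2.trans h'.2⟩

lemma child_lt (I : DCube d) (c : Fin d → Bool) : (I.child c).Lt I :=
  ⟨by simp, I.child_subset c⟩

lemma lt_or_eq_or_lt_of_mem {K L : DCube d} {x : Fin d → ℝ} (hK : x ∈ K.set) (hL : x ∈ L.set) :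
    K.Lt L ∨ K = L ∨ L.Lt K := by
  rcases lt_trichotomy K.k L.k with h | h | h
  · exact Or.inl ⟨h, subset_of_mem hK hL h.le⟩
  · refine Or.inr (Or.inl ?_)
    by_contra hne
    exact Set.disjoint_left.1 (disjoint_of_k_eq h hne) hK hL
  · exact Or.inr (Or.inr ⟨h, subset_of_mem hL hK h.le⟩)

/-- The sum of `φ` over the descendants of `I` exactly `N` generations below. -/
def leafSum (φ : DCube d → ℂ) : ℕ → DCube d → ℂ
  | 0, I => φ I
  | N + 1, I => ∑ c, leafSum φ N (I.child c)

/-- The sum of `φ` over the descendants of `I` less than `N` generations below. -/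
def allSum (φ : DCube d → ℝ) : ℕ → DCube d → ℝ
  | 0, _ => 0
  | N + 1, I => φ I + ∑ c, allSum φ N (I.child c)

open Classical in
/-- The sum of `φ` over the descendants of `I` less than `N` generations below, discarding every
proper descendant contained in a bad one. -/
def treeSum (bad : DCube d → Prop) (φ : DCube d → ℝ) : ℕ → DCube d → ℝ
  | 0, _ => 0
  | N + 1, I => φ I + ∑ c, if bad (I.child c) then 0 else treeSum bad φ N (I.child c)

open Classical in
/-- The iterated stopping cubes inside `I`, at most `N` generations below, where `K` is the
current stopping cube. -/
def stops (bad : DCube d → DCube d → Prop) : ℕ → DCube d → DCube d → Finset (DCube d)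
  | 0, _, _ => ∅
  | N + 1, K, I => Finset.univ.biUnion fun c =>
      if bad K (I.child c) then insert (I.child c) (stops bad N (I.child c) (I.child c))
      else stops bad N K (I.child c)

lemma norm_leafSum_sub_le (φ : DCube d → ℂ) (P : DCube d → ℝ)
    (h : ∀ I, ‖∑ c, φ (I.child c) - φ I‖ ≤ P I) (N : ℕ) (I : DCube d) :
    ‖leafSum φ N I - φ I‖ ≤ allSum P N I := by
  induction N generalizing I with
  | zero => simp [leafSum, allSum]
  | succ N ih =>
    have : leafSum φ (N + 1) I - φ I =
        (∑ c, φ (I.child c) - φ I) + ∑ c, (leafSum φ N (I.child c) - φ (I.child c)) := by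
      rw [leafSum, Finset.sum_sub_distrib]; ring
    rw [this, allSum]
    refine (norm_add_le _ _).trans (add_le_add (h I) ?_)
    exact (norm_sum_le _ _).trans (Finset.sum_le_sum fun c _ => ih _)

open Classical in
lemma treeSum_le (bad : DCube d → Prop) (φ Ψ : DCube d → ℝ) (h0 : ∀ I, ¬ bad I → 0 ≤ Ψ I)
    (h : ∀ I, ¬ bad I → φ I + ∑ c, (if bad (I.child c) then 0 else Ψ (I.child c)) ≤ Ψ I)
    (N : ℕ) (I : DCube d) (hI : ¬ bad I) : treeSum bad φ N I ≤ Ψ I := by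
  induction N generalizing I with
  | zero => exact h0 I hI
  | succ N ih =>
    rw [treeSum]
    refine le_trans (add_le_add le_rfl (Finset.sum_le_sum fun c _ => ?_)) (h I hI)
    split_ifs with hc
    · exact le_rfl
    · exact ih _ hc

lemma treeSum_mono (bad : DCube d → Prop) {φ ψ : DCube d → ℝ} (h : ∀ I, ¬ bad I → φ I ≤ ψ I)
    (N : ℕ) (I : DCube d) (hI : ¬ bad I) : treeSum bad φ N I ≤ treeSum bad ψ N I := by
  induction N generalizing I with
  | zero => exact le_rfl
  | succ N ih =>
    rw [treeSum, treeSum]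
    refine add_le_add (h I hI) (Finset.sum_le_sum fun c _ => ?_)
    split_ifs with hc
    · exact le_rfl
    · exact ih _ hc

lemma treeSum_linear (bad : DCube d → Prop) (φ ψ : DCube d → ℝ) (a b : ℝ) (N : ℕ)
    (I : DCube d) : treeSum bad (fun I => a * φ I + b * ψ I) N I =
      a * treeSum bad φ N I + b * treeSum bad ψ N I := by
  induction N generalizing I with
  | zero => simp [treeSum]
  | succ N ih =>
    simp only [treeSum, ih, mul_add, Finset.mul_sum]
    rw [add_add_add_comm, ← Finset.sum_add_distrib]
    congr 1
    refine Finset.sum_congr rfl fun c _ => ?_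
    split_ifs <;> simp

lemma lt_of_mem_stops (bad : DCube d → DCube d → Prop) (N : ℕ) (K I : DCube d) {L : DCube d}
    (hL : L ∈ stops bad N K I) : L.Lt I := by
  classical
  induction N generalizing K I with
  | zero => simp [stops] at hL
  | succ N ih =>
    simp only [stops, Finset.mem_biUnion, Finset.mem_univ, true_and] at hL
    obtain ⟨c, hc⟩ := hL
    split_ifs at hc with hb
    · rcases Finset.mem_insert.1 hc with rfl | hc
      · exact child_lt I c
      · exact (ih _ _ hc).trans (child_lt I c)
    · exact (ih _ _ hc).trans (child_lt I c)

open Classical in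
/-- The part of `stops bad (N + 1) K I` inside the child `c`. -/
def stopsPiece (bad : DCube d → DCube d → Prop) (N : ℕ) (K I : DCube d) (c : Fin d → Bool) :
    Finset (DCube d) :=
  if bad K (I.child c) then insert (I.child c) (stops bad N (I.child c) (I.child c))
  else stops bad N K (I.child c)

open Classical in
lemma stops_succ (bad : DCube d → DCube d → Prop) (N : ℕ) (K I : DCube d) :
    stops bad (N + 1) K I = Finset.univ.biUnion (stopsPiece bad N K I) := by
  simp only [stops]
  rfl

lemma subset_of_mem_stopsPiece (bad : DCube d → DCube d → Prop) (N : ℕ) (K I : DCube d)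
    (c : Fin d → Bool) {L : DCube d} (hL : L ∈ stopsPiece bad N K I c) :
    L.set ⊆ (I.child c).set := by
  classical
  unfold stopsPiece at hL
  split_ifs at hL with hb
  · rcases Finset.mem_insert.1 hL with rfl | hL
    · exact subset_rfl
    · exact (lt_of_mem_stops _ _ _ _ hL).2
  · exact (lt_of_mem_stops _ _ _ _ hL).2

lemma eq_of_mem_stopsPiece (bad : DCube d → DCube d → Prop) (N : ℕ) (K I : DCube d)
    {c c' : Fin d → Bool} {L M : DCube d} (hM : M ∈ stopsPiece bad N K I c)
    (hL : L ∈ stopsPiece bad N K I c') (h : L.set ⊆ M.set) : c = c' := by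
  by_contra hne
  exact Set.disjoint_left.1 (I.disjoint_child hne)
    (subset_of_mem_stopsPiece _ _ _ _ _ hM (h L.corner_mem))
    (subset_of_mem_stopsPiece _ _ _ _ _ hL L.corner_mem)

lemma allSum_le (bad : DCube d → DCube d → Prop) (P cost : DCube d → ℝ)
    (h : ∀ N L, treeSum (bad L) P N L ≤ cost L) (N : ℕ) (K I : DCube d) :
    allSum P N I ≤ treeSum (bad K) P N I + ∑ L ∈ stops bad N K I, cost L := by
  classical
  induction N generalizing K I with
  | zero => simp [allSum, treeSum, stops]
  | succ N ih =>
    rw [stops_succ, Finset.sum_biUnion, allSum, treeSum, add_assoc, ← Finset.sum_add_distrib]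
    · refine add_le_add le_rfl (Finset.sum_le_sum fun c _ => ?_)
      unfold stopsPiece
      split_ifs with hb
      · rw [Finset.sum_insert fun hm => Lt.irrefl _ (lt_of_mem_stops _ _ _ _ hm), zero_add]
        exact (ih _ _).trans (add_le_add (h _ _) le_rfl)
      · exact ih _ _
    · intro c _ c' _ hne
      rw [Function.onFun, Finset.disjoint_left]
      intro L hL hL'
      exact hne (eq_of_mem_stopsPiece bad N K I hL hL' subset_rfl)

lemma volume_stops_le (bad : DCube d → DCube d → Prop) (K : DCube d) (ψ : DCube d → ℝ≥0∞)
    (hψ : ∀ I, ∑ c, ψ (I.child c) ≤ ψ I) (hb : ∀ I, bad K I → volume I.set ≤ ψ I) (N : ℕ)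
    (I : DCube d) : volume (⋃ L ∈ stops bad N K I, L.set) ≤ ψ I := by
  classical
  induction N generalizing I with
  | zero => simp [stops]
  | succ N ih =>
    refine le_trans ?_ (hψ I)
    rw [stops_succ]
    have : (⋃ L ∈ Finset.univ.biUnion (stopsPiece bad N K I), L.set) =
        ⋃ c ∈ (Finset.univ : Finset (Fin d → Bool)), ⋃ L ∈ stopsPiece bad N K I c, L.set := by
      exact Finset.set_biUnion_biUnion _ _ _
    rw [this]
    refine (measure_biUnion_finset_le _ _).trans (Finset.sum_le_sum fun c _ => ?_)
    by_cases hc : bad K (I.child c)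
    · refine (measure_mono ?_).trans (hb _ hc)
      exact Set.iUnion₂_subset fun L hL => subset_of_mem_stopsPiece _ _ _ _ _ hL
    · have : stopsPiece bad N K I c = stops bad N K (I.child c) := by
        rw [stopsPiece, if_neg hc]
      rw [this]
      exact ih _

lemma volume_below_stops_le (bad : DCube d → DCube d → Prop) (ρ : ℝ≥0∞)
    (H : ∀ N K, volume (⋃ L ∈ stops bad N K K, L.set) ≤ ρ * volume K.set) (N : ℕ)
    (K I M : DCube d) (hM : M ∈ stops bad N K I) :
    volume (⋃ L ∈ {L | L ∈ stops bad N K I ∧ L.Lt M}, L.set) ≤ ρ * volume M.set := by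
  classical
  induction N generalizing K I with
  | zero => simp [stops] at hM
  | succ N ih =>
    rw [stops_succ] at hM ⊢
    obtain ⟨c, -, hc⟩ := Finset.mem_biUnion.1 hM
    have key : ∀ L ∈ Finset.univ.biUnion (stopsPiece bad N K I), L.Lt M →
        L ∈ stopsPiece bad N K I c := by
      intro L hL hLM
      obtain ⟨c', -, hc'⟩ := Finset.mem_biUnion.1 hL
      exact eq_of_mem_stopsPiece bad N K I hc hc' hLM.2 ▸ hc'
    by_cases hb : bad K (I.child c)
    · rw [stopsPiece, if_pos hb] at hc
      rw [stopsPiece, if_pos hb] at key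
      rcases Finset.mem_insert.1 hc with rfl | hc
      · refine (measure_mono ?_).trans (H N (I.child c))
        refine Set.iUnion₂_subset fun L hL => ?_
        rcases Finset.mem_insert.1 (key L hL.1 hL.2) with rfl | h
        · exact absurd hL.2 (Lt.irrefl _)
        · exact Set.subset_biUnion_of_mem (u := DCube.set) h
      · refine (measure_mono ?_).trans (ih _ _ hc)
        refine Set.iUnion₂_subset fun L hL => ?_
        rcases Finset.mem_insert.1 (key L hL.1 hL.2) with rfl | h
        · exact absurd (hL.2.trans (lt_of_mem_stops _ _ _ _ hc)) (Lt.irrefl _)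
        · exact Set.subset_biUnion_of_mem
            (s := {L | L ∈ stops bad N (I.child c) (I.child c) ∧ L.Lt M})
            (u := DCube.set) ⟨h, hL.2⟩
    · rw [stopsPiece, if_neg hb] at hc
      rw [stopsPiece, if_neg hb] at key
      refine (measure_mono ?_).trans (ih _ _ hc)
      refine Set.iUnion₂_subset fun L hL => ?_
      exact Set.subset_biUnion_of_mem (s := {L | L ∈ stops bad N K (I.child c) ∧ L.Lt M})
        (u := DCube.set) ⟨key L hL.1 hL.2, hL.2⟩

open Classical in
/-- The stopping family generated by `K`, including `K` itself. -/
def stopFam (bad : DCube d → DCube d → Prop) (N : ℕ) (K : DCube d) : Finset (DCube d) :=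
  insert K (stops bad N K K)

lemma volume_below_stopFam_le (bad : DCube d → DCube d → Prop) (ρ : ℝ≥0∞)
    (H : ∀ N K, volume (⋃ L ∈ stops bad N K K, L.set) ≤ ρ * volume K.set) (N : ℕ)
    (K M : DCube d) (hM : M ∈ stopFam bad N K) :
    volume (⋃ L ∈ {L | L ∈ stopFam bad N K ∧ L.Lt M}, L.set) ≤ ρ * volume M.set := by
  classical
  rcases Finset.mem_insert.1 hM with rfl | hM
  · refine (measure_mono ?_).trans (H N M)
    refine Set.iUnion₂_subset fun L hL => ?_
    rcases Finset.mem_insert.1 hL.1 with rfl | h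
    · exact absurd hL.2 (Lt.irrefl _)
    · exact Set.subset_biUnion_of_mem (u := DCube.set) h
  · refine (measure_mono ?_).trans (volume_below_stops_le bad ρ H N K K M hM)
    refine Set.iUnion₂_subset fun L hL => ?_
    rcases Finset.mem_insert.1 hL.1 with rfl | h
    · exact absurd (hL.2.trans (lt_of_mem_stops _ _ _ _ hM)) (Lt.irrefl _)
    · exact Set.subset_biUnion_of_mem (s := {L | L ∈ stops bad N K K ∧ L.Lt M})
        (u := DCube.set) ⟨h, hL.2⟩

lemma allSum_le_stopFam (bad : DCube d → DCube d → Prop) (P cost : DCube d → ℝ)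
    (h : ∀ N L, treeSum (bad L) P N L ≤ cost L) (N : ℕ) (K : DCube d) :
    allSum P N K ≤ ∑ L ∈ stopFam bad N K, cost L := by
  classical
  rw [stopFam, Finset.sum_insert fun hm => Lt.irrefl _ (lt_of_mem_stops _ _ _ _ hm)]
  exact (allSum_le bad P cost h N K K).trans (add_le_add (h _ _) le_rfl)

end DCube

/-! ## A Carleson-type embedding for sparse families -/

namespace DCube

variable {d : ℕ}

open Classical in
/-- The number of cubes of `S` strictly inside `K` that contain `x`. -/
def depth (S : Finset (DCube d)) (K : DCube d) (x : Fin d → ℝ) : ℕ :=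
  (S.filter fun L => L.Lt K ∧ x ∈ L.set).card

lemma measurable_depth (S : Finset (DCube d)) (K : DCube d) : Measurable (depth S K) := by
  classical
  have : depth S K = fun x => ∑ L ∈ S.filter fun L => L.Lt K,
      L.set.indicator (fun _ => 1) x := by
    funext x
    simp only [depth, Set.indicator_apply, ← Finset.filter_filter, Finset.card_filter]
  rw [this]
  exact Finset.measurable_sum _ fun L _ => measurable_const.indicator L.measurableSet_set

lemma measurable_pow_depth (u : ℝ≥0∞) (S : Finset (DCube d)) (K : DCube d) :
    Measurable fun x => u ^ depth S K x :=
  (measurable_from_nat (f := fun k : ℕ => u ^ k)).comp (measurable_depth S K)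

open Classical in
/-- The maximal cubes of `S` strictly inside `K`. -/
def maxBelow (S : Finset (DCube d)) (K : DCube d) : Finset (DCube d) :=
  S.filter fun L => L.Lt K ∧ ∀ M ∈ S, M.Lt K → ¬ L.Lt M

lemma pairwiseDisjoint_maxBelow (S : Finset (DCube d)) (K : DCube d) :
    (maxBelow S K : Set (DCube d)).PairwiseDisjoint DCube.set := by
  intro L hL M hM hne
  rw [Function.onFun, Set.disjoint_left]
  intro x hxL hxM
  simp only [maxBelow, Finset.coe_filter, Set.mem_ofPred_eq] at hL hM
  rcases lt_or_eq_or_lt_of_mem hxL hxM with h | h | h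
  · exact hL.2.2 M hM.1 hM.2.1 h
  · exact hne h
  · exact hM.2.2 L hL.1 hL.2.1 h

lemma exists_maxBelow (S : Finset (DCube d)) (K : DCube d) {x : Fin d → ℝ} {L : DCube d}
    (hL : L ∈ S) (hLK : L.Lt K) (hx : x ∈ L.set) : ∃ M ∈ maxBelow S K, x ∈ M.set := by
  classical
  obtain ⟨M, hM, hmax⟩ := Finset.exists_max_image
    (S.filter fun L => L.Lt K ∧ x ∈ L.set) DCube.k ⟨L, by simp [hL, hLK, hx]⟩
  simp only [Finset.mem_filter] at hM hmax
  refine ⟨M, ?_, hM.2.2⟩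
  simp only [maxBelow, Finset.mem_filter]
  refine ⟨hM.1, hM.2.1, fun M' hM' hK hlt => ?_⟩
  exact absurd hlt.1 (not_lt.2 (hmax M' ⟨hM', hK, hlt.2 hM.2.2⟩))

lemma depth_le_of_maxBelow (S : Finset (DCube d)) (K M : DCube d) (hM : M ∈ maxBelow S K)
    {x : Fin d → ℝ} (hx : x ∈ M.set) : depth S K x ≤ depth S M x + 1 := by
  classical
  simp only [maxBelow, Finset.mem_filter] at hM
  refine (Finset.card_le_card (t := insert M (S.filter fun L => L.Lt M ∧ x ∈ L.set)) ?_).trans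
    (Finset.card_insert_le _ _)
  intro L hL
  simp only [Finset.mem_filter, Finset.mem_insert] at hL ⊢
  rcases lt_or_eq_or_lt_of_mem hL.2.2 hx with h | h | h
  · exact Or.inr ⟨hL.1, h, hL.2.2⟩
  · exact Or.inl h
  · exact absurd h (hM.2.2 L hL.1 hL.2.1)

lemma pow_depth_le (u : ℝ≥0∞) (hu : 1 ≤ u) (S : Finset (DCube d)) (K : DCube d)
    (x : Fin d → ℝ) : u ^ depth S K x ≤
      1 + ∑ M ∈ maxBelow S K, M.set.indicator (fun x => u * u ^ depth S M x) x := by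
  classical
  by_cases h : ∃ M ∈ maxBelow S K, x ∈ M.set
  · obtain ⟨M, hM, hx⟩ := h
    refine le_trans ?_ (le_add_left (Finset.single_le_sum (fun _ _ => zero_le) hM))
    rw [Set.indicator_of_mem hx, mul_comm, ← pow_succ]
    exact pow_le_pow_right₀ hu (depth_le_of_maxBelow S K M hM hx)
  · have : depth S K x = 0 := by
      rw [depth, Finset.card_eq_zero, Finset.filter_eq_empty_iff]
      rintro L hL ⟨h1, h2⟩
      exact h (exists_maxBelow S K hL h1 h2)
    rw [this, pow_zero]
    exact le_self_add

/-- Exponential integrability of the counting function of a sparse family. -/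
lemma lintegral_pow_depth_le (μ : Measure (Fin d → ℝ)) (S : Finset (DCube d)) (ρ u D : ℝ≥0∞)
    (hu : 1 ≤ u) (hD : 1 + u * ρ * D ≤ D)
    (hμ : ∀ K ∈ S, μ (⋃ L ∈ {L | L ∈ S ∧ L.Lt K}, L.set) ≤ ρ * μ K.set) (K : DCube d)
    (hK : K ∈ S) : ∫⁻ x in K.set, u ^ depth S K x ∂μ ≤ D * μ K.set := by
  classical
  obtain ⟨N, hN⟩ : ∃ N, (S.filter fun L => L.Lt K).card ≤ N := ⟨_, le_rfl⟩
  induction N using Nat.strong_induction_on generalizing K with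
  | _ N ih =>
  have hmax : ∀ M ∈ maxBelow S K, M ∈ S ∧ M.Lt K := fun M hM => by
    simp only [maxBelow, Finset.mem_filter] at hM; exact ⟨hM.1, hM.2.1⟩
  have hM : ∀ M ∈ maxBelow S K, ∫⁻ x in M.set, u ^ depth S M x ∂μ ≤ D * μ M.set := by
    intro M hM
    obtain ⟨hMS, hMK⟩ := hmax M hM
    refine ih _ ?_ M hMS le_rfl
    refine lt_of_lt_of_le (Finset.card_lt_card ?_) hN
    rw [Finset.ssubset_iff_of_subset]
    · exact ⟨M, by simp [hMS, hMK], by simp [Lt.irrefl]⟩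
    · intro L hL
      simp only [Finset.mem_filter] at hL ⊢
      exact ⟨hL.1, hL.2.trans hMK⟩
  have hsum : ∑ M ∈ maxBelow S K, μ M.set ≤ ρ * μ K.set := by
    rw [← measure_biUnion_finset (pairwiseDisjoint_maxBelow S K)
      fun M _ => M.measurableSet_set]
    refine (measure_mono ?_).trans (hμ K hK)
    exact Set.iUnion₂_subset fun M hM => Set.subset_biUnion_of_mem
      (s := {L | L ∈ S ∧ L.Lt K}) (u := DCube.set) (hmax M hM)
  calc ∫⁻ x in K.set, u ^ depth S K x ∂μ
      ≤ ∫⁻ x in K.set, (1 + ∑ M ∈ maxBelow S K,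
          M.set.indicator (fun x => u * u ^ depth S M x) x) ∂μ :=
        lintegral_mono fun x => pow_depth_le u hu S K x
    _ = μ K.set + ∑ M ∈ maxBelow S K, ∫⁻ x in K.set,
          M.set.indicator (fun x => u * u ^ depth S M x) x ∂μ := by
        rw [lintegral_add_left measurable_const, lintegral_finsetSum]
        · simp
        · exact fun M _ => ((measurable_pow_depth u S M).const_mul u).indicator
            M.measurableSet_set
    _ ≤ μ K.set + ∑ M ∈ maxBelow S K, u * (D * μ M.set) := by
        gcongr with M hM'
        refine (setLIntegral_le_lintegral _ _).trans ?_
        rw [lintegral_indicator M.measurableSet_set,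
          lintegral_const_mul _ (measurable_pow_depth u S M)]
        gcongr
        exact hM M hM'
    _ ≤ μ K.set + u * D * (ρ * μ K.set) := by
        simp only [← mul_assoc u D, ← Finset.mul_sum]
        gcongr
    _ = (1 + u * ρ * D) * μ K.set := by ring
    _ ≤ D * μ K.set := by gcongr

lemma sum_pow_depth_le (t : ℝ≥0∞) (S : Finset (DCube d)) (x : Fin d → ℝ) :
    ∑ K ∈ S, K.set.indicator (fun x => t ^ depth S K x) x ≤ (1 - t)⁻¹ := by
  classical
  have h1 : ∑ K ∈ S, K.set.indicator (fun x => t ^ depth S K x) x =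
      ∑ K ∈ S.filter fun K => x ∈ K.set, t ^ depth S K x := by
    simp only [Set.indicator_apply, Finset.sum_filter]
  have hinj : Set.InjOn (fun K => depth S K x)
      (S.filter fun K => x ∈ K.set : Finset (DCube d)) := by
    have hlt : ∀ K L : DCube d, K ∈ S → x ∈ K.set → K.Lt L → depth S K x < depth S L x := by
      intro K L hK hx hKL
      refine Finset.card_lt_card ?_
      rw [Finset.ssubset_iff_of_subset]
      · exact ⟨K, by simp [hK, hKL, hx], by simp [Lt.irrefl]⟩
      · intro M hM
        simp only [Finset.mem_filter] at hM ⊢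
        exact ⟨hM.1, hM.2.1.trans hKL, hM.2.2⟩
    intro K hK L hL h
    simp only [Finset.coe_filter, Set.mem_ofPred_eq] at hK hL
    rcases lt_or_eq_or_lt_of_mem hK.2 hL.2 with h' | h' | h'
    · exact absurd h (hlt K L hK.1 hK.2 h').ne
    · exact h'
    · exact absurd h (hlt L K hL.1 hL.2 h').ne'
  rw [h1, ← ENNReal.tsum_geometric, ← Finset.sum_image (f := fun j => t ^ j) hinj]
  exact ENNReal.sum_le_tsum _

/-- A weighted Carleson embedding for a sparse family `S` of dyadic cubes. -/
lemma carleson_embedding {p q : ℝ} (hpq : p.HolderConjugate q) (S : Finset (DCube d))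
    (ρ u D c : ℝ≥0∞) (hu : 1 ≤ u) (hu' : u ≠ ⊤) (hD : 1 + u * ρ * D ≤ D)
    (b : DCube d → (Fin d → ℝ) → ℝ≥0∞) (hb : ∀ K, Measurable (b K))
    (hsparse : ∀ K ∈ S, ∀ M ∈ S,
      ∫⁻ x in ⋃ L ∈ {L | L ∈ S ∧ L.Lt M}, L.set, b K x ^ p ≤ ρ * ∫⁻ x in M.set, b K x ^ p)
    (hc : ∀ K ∈ S, ∫⁻ x in K.set, b K x ^ p ≤ c * volume K.set)
    (H : (Fin d → ℝ) → ℝ≥0∞) (hH : Measurable H) :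
    ∑ K ∈ S, volume K.set * ((volume K.set)⁻¹ * ∫⁻ x in K.set, b K x * H x) ^ q ≤
      (D * c) ^ (q / p) * (1 - u ^ (-(q / p)))⁻¹ * ∫⁻ x, H x ^ q := by
  have hp0 := hpq.pos
  have hq0 := hpq.symm.pos
  have hu0 : u ≠ 0 := (zero_lt_one.trans_le hu).ne'
  set t : ℝ≥0∞ := u ^ (-(q / p)) with ht
  have hU : ∀ M ∈ S, MeasurableSet (⋃ L ∈ {L | L ∈ S ∧ L.Lt M}, L.set) := fun M _ =>
    MeasurableSet.biUnion ((S.finite_toSet.subset fun L hL => hL.1).countable)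
      fun L _ => L.measurableSet_set
  have key : ∀ K ∈ S, volume K.set * ((volume K.set)⁻¹ * ∫⁻ x in K.set, b K x * H x) ^ q ≤
      (D * c) ^ (q / p) * ∫⁻ x in K.set, t ^ depth S K x * H x ^ q := by
    intro K hK
    set U : (Fin d → ℝ) → ℝ≥0∞ := fun x => u ^ depth S K x with hUdef
    have hUm : Measurable U := measurable_pow_depth u S K
    have hU0 : ∀ x, U x ≠ 0 := fun x => pow_ne_zero _ hu0
    have hUt : ∀ x, U x ≠ ⊤ := fun x => ENNReal.pow_ne_top hu'
    have h1 : ∫⁻ x in K.set, b K x * H x ≤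
        (∫⁻ x in K.set, b K x ^ p * U x) ^ (1 / p) *
          (∫⁻ x in K.set, t ^ depth S K x * H x ^ q) ^ (1 / q) := by
      have e : ∀ x, b K x * H x =
          ((fun x => b K x * U x ^ (1 / p)) * fun x => U x ^ (-(1 / p)) * H x) x := by
        intro x
        simp only [Pi.mul_apply]
        rw [mul_assoc (b K x), ← mul_assoc (U x ^ _),
          ← ENNReal.rpow_add _ _ (hU0 x) (hUt x)]
        simp
      simp only [e]
      refine (ENNReal.lintegral_mul_le_Lp_mul_Lq _ hpq
        ((hb K).mul (hUm.pow_const _)).aemeasurable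
        ((hUm.pow_const _).mul hH).aemeasurable).trans (le_of_eq ?_)
      congr 3
      · funext x
        rw [Pi.mul_apply, ENNReal.mul_rpow_of_nonneg _ _ hp0.le, ← ENNReal.rpow_mul, one_div_mul_cancel hp0.ne',
          ENNReal.rpow_one]
      · funext x
        rw [Pi.mul_apply, ENNReal.mul_rpow_of_nonneg _ _ hq0.le, ← ENNReal.rpow_mul]
        congr 1
        simp only [ht, hUdef]
        rw [← ENNReal.rpow_natCast, ← ENNReal.rpow_natCast, ← ENNReal.rpow_mul,
          ← ENNReal.rpow_mul]
        congr 1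
        ring
    have h2 : ∫⁻ x in K.set, b K x ^ p * U x ≤ D * (c * volume K.set) := by
      have hw : ∀ s : Set (Fin d → ℝ), MeasurableSet s →
          (volume.withDensity fun x => b K x ^ p) s = ∫⁻ x in s, b K x ^ p :=
        fun s hs => withDensity_apply _ hs
      have := lintegral_pow_depth_le (volume.withDensity fun x => b K x ^ p) S ρ u D hu hD
        (fun M hM => by
          rw [hw _ (hU M hM), hw _ M.measurableSet_set]; exact hsparse K hK M hM) K hK
      rw [setLIntegral_withDensity_eq_setLIntegral_mul _ ((hb K).pow_const _) hUm
        K.measurableSet_set, hw _ K.measurableSet_set] at this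
      exact this.trans (mul_le_mul_right (hc K hK) D)
    have hv0 := K.volume_set_ne_zero
    have hvt := K.volume_set_ne_top
    calc volume K.set * ((volume K.set)⁻¹ * ∫⁻ x in K.set, b K x * H x) ^ q
        ≤ volume K.set * ((volume K.set)⁻¹ * ((D * (c * volume K.set)) ^ (1 / p) *
          (∫⁻ x in K.set, t ^ depth S K x * H x ^ q) ^ (1 / q))) ^ q := by
          gcongr
          refine h1.trans ?_
          gcongr
      _ = (D * c) ^ (q / p) * ∫⁻ x in K.set, t ^ depth S K x * H x ^ q := by
          rw [ENNReal.mul_rpow_of_nonneg _ _ hq0.le, ENNReal.mul_rpow_of_nonneg _ _ hq0.le,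
            ← ENNReal.rpow_mul, ← ENNReal.rpow_mul, one_div_mul_cancel hq0.ne', ENNReal.rpow_one,
            ← mul_assoc D, one_div_mul_eq_div,
            ENNReal.mul_rpow_of_nonneg _ _ (div_pos hq0 hp0).le]
          have hvv : volume K.set * ((volume K.set)⁻¹ ^ q * volume K.set ^ (q / p)) = 1 := by
            rw [← ENNReal.rpow_neg_one, ← ENNReal.rpow_mul, ← ENNReal.rpow_add _ _ hv0 hvt]
            nth_rewrite 1 [← ENNReal.rpow_one (volume K.set)]
            rw [← ENNReal.rpow_add _ _ hv0 hvt]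
            have : 1 + (-1 * q + q / p) = 0 := by
              have := hpq.inv_add_inv_eq_one
              field_simp at this ⊢
              nlinarith
            rw [this, ENNReal.rpow_zero]
          calc _ = (volume K.set * ((volume K.set)⁻¹ ^ q * volume K.set ^ (q / p))) *
                ((D * c) ^ (q / p) * ∫⁻ x in K.set, t ^ depth S K x * H x ^ q) := by ring
            _ = _ := by rw [hvv, one_mul]
  refine (Finset.sum_le_sum key).trans ?_
  rw [← Finset.mul_sum, mul_assoc]
  gcongr
  calc ∑ K ∈ S, ∫⁻ x in K.set, t ^ depth S K x * H x ^ q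
      = ∑ K ∈ S, ∫⁻ x, K.set.indicator (fun x => t ^ depth S K x) x * H x ^ q := by
        refine Finset.sum_congr rfl fun K _ => ?_
        rw [← lintegral_indicator K.measurableSet_set]
        congr 1
        funext x
        by_cases hx : x ∈ K.set <;> simp [hx]
    _ = ∫⁻ x, (∑ K ∈ S, K.set.indicator (fun x => t ^ depth S K x) x) * H x ^ q := by
        rw [← lintegral_finsetSum]
        · simp only [Finset.sum_mul]
        · exact fun K _ => ((measurable_pow_depth t S K).indicator K.measurableSet_set).mul
            (hH.pow_const _)
    _ ≤ ∫⁻ x, (1 - t)⁻¹ * H x ^ q :=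
        lintegral_mono fun x => mul_le_mul_left (sum_pow_depth_le t S x) _
    _ = (1 - t)⁻¹ * ∫⁻ x, H x ^ q := lintegral_const_mul _ (hH.pow_const _)

end DCube

/-! ## Linear algebra and measurability of matrix functions -/

section LinearAlgebra

variable {n : ℕ}

lemma matNorm_nonneg (M : Matrix (Fin n) (Fin n) ℂ) : 0 ≤ matNorm M := norm_nonneg _

lemma norm_mApp_le (M : Matrix (Fin n) (Fin n) ℂ) (v : EuclideanSpace ℂ (Fin n)) :
    ‖mApp M v‖ ≤ matNorm M * ‖v‖ := ContinuousLinearMap.le_opNorm _ _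

lemma matNorm_mul_le (M N : Matrix (Fin n) (Fin n) ℂ) :
    matNorm (M * N) ≤ matNorm M * matNorm N := by
  unfold matNorm
  rw [map_mul]
  exact norm_mul_le _ _

lemma mApp_mul (M N : Matrix (Fin n) (Fin n) ℂ) (v : EuclideanSpace ℂ (Fin n)) :
    mApp (M * N) v = mApp M (mApp N v) := by
  unfold mApp
  rw [map_mul]
  rfl

lemma mApp_one (v : EuclideanSpace ℂ (Fin n)) : mApp 1 v = v := by
  unfold mApp
  rw [map_one]
  rfl

lemma matNorm_conjTranspose (M : Matrix (Fin n) (Fin n) ℂ) :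
    matNorm M.conjTranspose = matNorm M := by
  unfold matNorm
  rw [← Matrix.star_eq_conjTranspose, map_star, ContinuousLinearMap.star_eq_adjoint,
    LinearIsometryEquiv.norm_map]

lemma inner_mApp_left (M : Matrix (Fin n) (Fin n) ℂ) (u v : EuclideanSpace ℂ (Fin n)) :
    inner ℂ (mApp M u) v = inner ℂ u (mApp M.conjTranspose v) := by
  unfold mApp
  rw [← Matrix.star_eq_conjTranspose, map_star, ContinuousLinearMap.star_eq_adjoint,
    ContinuousLinearMap.adjoint_inner_right]

lemma mApp_eq_sum (M : Matrix (Fin n) (Fin n) ℂ) (v : EuclideanSpace ℂ (Fin n)) :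
    mApp M v = ∑ i, (∑ j, M i j * v j) • EuclideanSpace.single i (1 : ℂ) := by
  ext k
  simp only [mApp, Matrix.ofLp_toEuclideanCLM, Matrix.mulVec, dotProduct, WithLp.ofLp_sum,
    Finset.sum_apply, PiLp.smul_apply, PiLp.single_apply]
  simp

lemma matNorm_le_sum (M : Matrix (Fin n) (Fin n) ℂ) :
    matNorm M ≤ ∑ i, ‖mApp M (EuclideanSpace.single i 1)‖ := by
  refine ContinuousLinearMap.opNorm_le_bound _
    (Finset.sum_nonneg fun _ _ => norm_nonneg _) fun v => ?_
  have hv : v = ∑ i, v i • EuclideanSpace.single i (1 : ℂ) := by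
    ext k
    simp [Pi.single_apply]
  conv_lhs => rw [hv]
  rw [map_sum, Finset.sum_mul]
  refine (norm_sum_le _ _).trans (Finset.sum_le_sum fun i _ => ?_)
  rw [map_smul, norm_smul, mul_comm]
  exact mul_le_mul_of_nonneg_left (PiLp.norm_apply_le v i) (norm_nonneg _)

lemma matNorm_le_of_forall (M : Matrix (Fin n) (Fin n) ℂ) {C : ℝ} (hC : 0 ≤ C)
    (h : ∀ v, ‖mApp M v‖ ≤ C * ‖v‖) : matNorm M ≤ C :=
  ContinuousLinearMap.opNorm_le_bound _ hC h

lemma matNorm_one_pos (hn : 0 < n) {M : Matrix (Fin n) (Fin n) ℂ} (hM : IsUnit M.det) :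
    0 < matNorm M := by
  have : Nonempty (Fin n) := ⟨⟨0, hn⟩⟩
  refine lt_of_le_of_ne (matNorm_nonneg _) fun h => ?_
  have h0 : M = 0 := by
    have := norm_eq_zero.1 h.symm
    exact (map_eq_zero_iff _ (Matrix.toEuclideanCLM (𝕜 := ℂ) (n := Fin n)).injective).1 this
  rw [h0, Matrix.det_zero] at hM
  exact not_isUnit_zero hM

namespace Matrix.PosDef

lemma isUnit_det' {M : Matrix (Fin n) (Fin n) ℂ} (hM : M.PosDef) : IsUnit M.det :=
  hM.det_pos.ne'.isUnit

lemma mul_inv' {M : Matrix (Fin n) (Fin n) ℂ} (hM : M.PosDef) : M * M⁻¹ = 1 :=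
  Matrix.mul_nonsing_inv _ hM.isUnit_det'

lemma inv_mul' {M : Matrix (Fin n) (Fin n) ℂ} (hM : M.PosDef) : M⁻¹ * M = 1 :=
  Matrix.nonsing_inv_mul _ hM.isUnit_det'

lemma mApp_inv_mApp {M : Matrix (Fin n) (Fin n) ℂ} (hM : M.PosDef)
    (v : EuclideanSpace ℂ (Fin n)) : mApp M⁻¹ (mApp M v) = v := by
  rw [← mApp_mul, hM.inv_mul', mApp_one]

lemma mApp_mApp_inv {M : Matrix (Fin n) (Fin n) ℂ} (hM : M.PosDef)
    (v : EuclideanSpace ℂ (Fin n)) : mApp M (mApp M⁻¹ v) = v := by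
  rw [← mApp_mul, hM.mul_inv', mApp_one]

lemma inner_mApp {M : Matrix (Fin n) (Fin n) ℂ} (hM : M.PosDef)
    (u v : EuclideanSpace ℂ (Fin n)) : inner ℂ (mApp M u) v = inner ℂ u (mApp M v) := by
  rw [inner_mApp_left, hM.isHermitian.eq]

lemma inner_eq {M : Matrix (Fin n) (Fin n) ℂ} (hM : M.PosDef)
    (u v : EuclideanSpace ℂ (Fin n)) : inner ℂ u v = inner ℂ (mApp M u) (mApp M⁻¹ v) := by
  rw [hM.inner_mApp, hM.mApp_mApp_inv]

lemma matNorm_mul_comm {M N : Matrix (Fin n) (Fin n) ℂ} (hM : M.PosDef) (hN : N.PosDef) :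
    matNorm (M * N) = matNorm (N * M) := by
  rw [← matNorm_conjTranspose, Matrix.conjTranspose_mul, hM.isHermitian.eq,
    hN.isHermitian.eq]

end Matrix.PosDef

lemma mApp_sum {ι : Type*} (M : Matrix (Fin n) (Fin n) ℂ) (s : Finset ι)
    (f : ι → EuclideanSpace ℂ (Fin n)) : mApp M (∑ i ∈ s, f i) = ∑ i ∈ s, mApp M (f i) :=
  map_sum _ _ _

lemma mApp_smul (M : Matrix (Fin n) (Fin n) ℂ) (c : ℂ) (v : EuclideanSpace ℂ (Fin n)) :
    mApp M (c • v) = c • mApp M v := map_smul _ _ _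

lemma mApp_real_smul (M : Matrix (Fin n) (Fin n) ℂ) (c : ℝ) (v : EuclideanSpace ℂ (Fin n)) :
    mApp M (c • v) = c • mApp M v := by
  rw [← Complex.coe_smul, mApp_smul, Complex.coe_smul]

end LinearAlgebra

section Measurability

variable {d n : ℕ}

lemma MatMeasurable.matNorm {W : (Fin d → ℝ) → Matrix (Fin n) (Fin n) ℂ}
    (hW : MatMeasurable W) : Measurable fun x => matNorm (W x) := by
  have hcont : Continuous fun m : Fin n → Fin n → ℂ => _root_.matNorm (Matrix.of m) := by
    let φ : (Fin n → Fin n → ℂ) →ₗ[ℂ]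
        (EuclideanSpace ℂ (Fin n) →L[ℂ] EuclideanSpace ℂ (Fin n)) :=
      { toFun := fun m => Matrix.toEuclideanCLM (𝕜 := ℂ) (n := Fin n) (Matrix.of m)
        map_add' := fun a b => by rw [← map_add]; rfl
        map_smul' := fun a b => by rw [RingHom.id_apply, ← map_smul]; rfl }
    exact (LinearMap.continuous_of_finiteDimensional φ).norm
  exact hcont.measurable.comp
    (measurable_pi_iff.2 fun i => measurable_pi_iff.2 fun j => hW i j)

lemma MatMeasurable.mApp {W : (Fin d → ℝ) → Matrix (Fin n) (Fin n) ℂ}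
    (hW : MatMeasurable W) {f : (Fin d → ℝ) → EuclideanSpace ℂ (Fin n)} (hf : Measurable f) :
    Measurable fun x => mApp (W x) (f x) := by
  simp only [mApp_eq_sum]
  refine Finset.measurable_fun_sum _ fun i _ => Measurable.smul_const ?_ _
  refine Finset.measurable_fun_sum _ fun j _ => (hW i j).mul ?_
  exact (PiLp.continuous_apply 2 (fun _ : Fin n => ℂ) j).measurable.comp hf

lemma MatMeasurable.const_mul {W : (Fin d → ℝ) → Matrix (Fin n) (Fin n) ℂ}
    (hW : MatMeasurable W) (B : Matrix (Fin n) (Fin n) ℂ) : MatMeasurable fun x => B * W x :=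
  fun i j => by
    simp only [Matrix.mul_apply]
    exact Finset.measurable_fun_sum _ fun k _ => (hW k j).const_mul _

lemma MatMeasurable.mul_const {W : (Fin d → ℝ) → Matrix (Fin n) (Fin n) ℂ}
    (hW : MatMeasurable W) (B : Matrix (Fin n) (Fin n) ℂ) : MatMeasurable fun x => W x * B :=
  fun i j => by
    simp only [Matrix.mul_apply]
    exact Finset.measurable_fun_sum _ fun k _ => (hW i k).mul_const _

lemma MatMeasurable.det {W : (Fin d → ℝ) → Matrix (Fin n) (Fin n) ℂ}
    (hW : MatMeasurable W) : Measurable fun x => (W x).det := by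
  simp only [Matrix.det_apply]
  exact Finset.measurable_fun_sum _ fun σ _ =>
    (Finset.measurable_fun_prod _ fun i _ => hW _ _).const_smul _

lemma MatMeasurable.inv {W : (Fin d → ℝ) → Matrix (Fin n) (Fin n) ℂ}
    (hW : MatMeasurable W) : MatMeasurable fun x => (W x)⁻¹ := by
  intro i j
  simp only [Matrix.inv_def, Matrix.smul_apply, smul_eq_mul, Ring.inverse_eq_inv',
    Matrix.adjugate_apply]
  refine hW.det.inv.mul (MatMeasurable.det fun a b => ?_)
  simp only [Matrix.updateRow_apply]
  split_ifs
  · exact measurable_const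
  · exact hW a b

end Measurability

/-! ## Basic estimates for matrix `A_p` weights -/

/-- The operator norm of a matrix as an extended nonnegative real. -/
def enm {n : ℕ} (T : Matrix (Fin n) (Fin n) ℂ) : ℝ≥0∞ := ENNReal.ofReal (matNorm T)

section

variable {n : ℕ}

lemma enm_mul_le (S T : Matrix (Fin n) (Fin n) ℂ) : enm (S * T) ≤ enm S * enm T := by
  rw [enm, enm, enm, ← ENNReal.ofReal_mul (matNorm_nonneg _)]
  exact ENNReal.ofReal_le_ofReal (matNorm_mul_le S T)

lemma enm_ne_top (T : Matrix (Fin n) (Fin n) ℂ) : enm T ≠ ⊤ := ENNReal.ofReal_ne_top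

lemma enorm_mApp_le (T : Matrix (Fin n) (Fin n) ℂ) (v : EuclideanSpace ℂ (Fin n)) :
    ‖mApp T v‖ₑ ≤ enm T * ‖v‖ₑ := by
  rw [← ofReal_norm, ← ofReal_norm, enm,
    ← ENNReal.ofReal_mul (matNorm_nonneg _)]
  exact ENNReal.ofReal_le_ofReal (norm_mApp_le T v)

lemma enm_pos (hn : 0 < n) {T : Matrix (Fin n) (Fin n) ℂ} (hT : IsUnit T.det) : enm T ≠ 0 := by
  simpa [enm] using matNorm_one_pos hn hT

lemma enm_rpow_le_sum (T : Matrix (Fin n) (Fin n) ℂ) {r : ℝ} (hr : 1 ≤ r) :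
    enm T ^ r ≤ (n : ℝ≥0∞) ^ (r - 1) * ∑ i, ‖mApp T (EuclideanSpace.single i 1)‖ₑ ^ r := by
  have h1 : enm T ≤ ∑ i, ‖mApp T (EuclideanSpace.single i 1)‖ₑ := by
    simp only [← ofReal_norm]
    rw [enm, ← ENNReal.ofReal_sum_of_nonneg fun _ _ => norm_nonneg _]
    exact ENNReal.ofReal_le_ofReal (matNorm_le_sum T)
  refine (ENNReal.rpow_le_rpow h1 (zero_le_one.trans hr)).trans ?_
  simpa using ENNReal.rpow_sum_le_const_mul_sum_rpow Finset.univ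
    (fun i => ‖mApp T (EuclideanSpace.single i 1)‖ₑ) hr

lemma Matrix.PosDef.enm_mul_comm {S T : Matrix (Fin n) (Fin n) ℂ} (hS : S.PosDef)
    (hT : T.PosDef) : enm (S * T) = enm (T * S) := by
  rw [enm, enm, hS.matNorm_mul_comm hT]

end

/-- Standing assumptions: `M = W^{1/p}` for a matrix `A_p` weight `W` (positive definite
everywhere) with reducing operators `V`. -/
structure IsApWeight {d n : ℕ} (p q c₁ c₂ : ℝ) (M : (Fin d → ℝ) → Matrix (Fin n) (Fin n) ℂ)
    (V : DCube d → Matrix (Fin n) (Fin n) ℂ) : Prop where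
  hn : 0 < n
  hpq : p.HolderConjugate q
  hc₁ : 0 < c₁
  hc₂ : 0 < c₂
  meas : MatMeasurable M
  pd : ∀ x, (M x).PosDef
  ap : apNorm p M < ⊤
  red : IsReducing p c₁ c₂ M V

namespace IsApWeight

variable {d n : ℕ} {p q c₁ c₂ : ℝ} {M : (Fin d → ℝ) → Matrix (Fin n) (Fin n) ℂ}
  {V : DCube d → Matrix (Fin n) (Fin n) ℂ}

lemma measurable_enm {W : (Fin d → ℝ) → Matrix (Fin n) (Fin n) ℂ} (hW : MatMeasurable W) :
    Measurable fun x => enm (W x) := hW.matNorm.ennreal_ofReal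

variable (h : IsApWeight p q c₁ c₂ M V)
include h

lemma posDef (K : DCube d) : (V K).PosDef := (h.red K).1

lemma measurable_enm_inv : Measurable fun x => enm (M x)⁻¹ := measurable_enm h.meas.inv

lemma lintegral_lintegral_le (K : DCube d) :
    ∫⁻ x in K.set, (∫⁻ t in K.set, enm (M x * (M t)⁻¹) ^ q) ^ (p / q) ≤
      volume K.set ^ p * apNorm p M := by
  have hv0 := K.volume_set_ne_zero
  have hvt := K.volume_set_ne_top
  have hp1 := h.hpq.sub_one_pos
  have hle : (volume K.set)⁻¹ * ∫⁻ x in K.set, ((volume K.set)⁻¹ *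
      ∫⁻ t in K.set, enm (M x * (M t)⁻¹) ^ q) ^ (p / q) ≤ apNorm p M := by
    have := le_iSup₂_of_le (f := fun (c : Fin d → ℝ) (r : ℝ) => ⨆ (_ : 0 < r),
      (ENNReal.ofReal (r ^ d))⁻¹ *
      ∫⁻ x in cubeSet c r,
        ((ENNReal.ofReal (r ^ d))⁻¹ *
            ∫⁻ t in cubeSet c r,
              ENNReal.ofReal (matNorm (M x * (M t)⁻¹)) ^ (p / (p - 1))) ^ (p - 1))
      K.corner K.side (le_iSup_of_le (by unfold DCube.side; positivity) le_rfl)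
    rw [DCube.side_pow, ← DCube.volume_set,
      ← Measure.restrict_congr_set K.set_eq_cubeSet_ae, ← h.hpq.conjugate_eq,
      ← h.hpq.div_conj_eq_sub_one] at this
    rw [apNorm, ← h.hpq.conjugate_eq, ← h.hpq.div_conj_eq_sub_one]
    exact this
  have hpq' : 0 ≤ p / q := by rw [h.hpq.div_conj_eq_sub_one]; exact hp1.le
  simp only [ENNReal.mul_rpow_of_nonneg _ _ hpq'] at hle
  rw [lintegral_const_mul' _ _ (ENNReal.rpow_ne_top_of_nonneg hpq' (ENNReal.inv_ne_top.2 hv0)),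
    ← mul_assoc] at hle
  have hcancel : volume K.set ^ p * ((volume K.set)⁻¹ * (volume K.set)⁻¹ ^ (p / q)) = 1 := by
    rw [← ENNReal.rpow_neg_one, ← ENNReal.rpow_mul, ← ENNReal.rpow_add _ _ hv0 hvt,
      ← ENNReal.rpow_add _ _ hv0 hvt, h.hpq.div_conj_eq_sub_one]
    ring_nf
    simp
  calc _ = volume K.set ^ p * ((volume K.set)⁻¹ * (volume K.set)⁻¹ ^ (p / q) *
        ∫⁻ x in K.set, (∫⁻ t in K.set, enm (M x * (M t)⁻¹) ^ q) ^ (p / q)) := by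
        rw [← mul_assoc, hcancel, one_mul]
    _ ≤ _ := by gcongr

lemma lintegral_mApp_le (K : DCube d) (e : EuclideanSpace ℂ (Fin n)) :
    ∫⁻ x in K.set, ‖mApp (M x) e‖ₑ ^ p ≤
      ENNReal.ofReal c₁⁻¹ ^ p * ‖mApp (V K) e‖ₑ ^ p * volume K.set := by
  have hv0 := K.volume_set_ne_zero
  have hvt := K.volume_set_ne_top
  have hp0 := h.hpq.pos
  have h1 := ((h.red K).2 e).1
  rw [redAvgD, ← DCube.volume_set] at h1
  simp only [ofReal_norm] at h1
  have hc : ENNReal.ofReal c₁⁻¹ * ENNReal.ofReal c₁ = 1 := by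
    rw [← ENNReal.ofReal_mul (by have := h.hc₁; positivity), inv_mul_cancel₀ h.hc₁.ne',
      ENNReal.ofReal_one]
  have h2 : ((volume K.set)⁻¹ * ∫⁻ x in K.set, ‖mApp (M x) e‖ₑ ^ p) ^ (1 / p) ≤
      ENNReal.ofReal c₁⁻¹ * ‖mApp (V K) e‖ₑ := by
    calc _ = ENNReal.ofReal c₁⁻¹ * (ENNReal.ofReal c₁ *
          ((volume K.set)⁻¹ * ∫⁻ x in K.set, ‖mApp (M x) e‖ₑ ^ p) ^ (1 / p)) := by
          rw [← mul_assoc, hc, one_mul]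
      _ ≤ _ := by gcongr
  have h3 := ENNReal.rpow_le_rpow h2 hp0.le
  rw [← ENNReal.rpow_mul, one_div_mul_cancel hp0.ne', ENNReal.rpow_one,
    ENNReal.mul_rpow_of_nonneg _ _ hp0.le] at h3
  calc _ = (volume K.set)⁻¹ * (∫⁻ x in K.set, ‖mApp (M x) e‖ₑ ^ p) * volume K.set := by
        rw [mul_comm (volume K.set)⁻¹, mul_assoc, ENNReal.inv_mul_cancel hv0 hvt, mul_one]
    _ ≤ _ := by gcongr

lemma enorm_mApp_V_le (K : DCube d) (e : EuclideanSpace ℂ (Fin n)) :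
    ‖mApp (V K) e‖ₑ ≤ ENNReal.ofReal c₂ *
      ((volume K.set)⁻¹ * ∫⁻ x in K.set, ‖mApp (M x) e‖ₑ ^ p) ^ (1 / p) := by
  have h1 := ((h.red K).2 e).2
  rw [redAvgD, ← DCube.volume_set] at h1
  simpa only [ofReal_norm] using h1

lemma lintegral_enm_mul_le (K : DCube d) (B : Matrix (Fin n) (Fin n) ℂ) :
    ∫⁻ x in K.set, enm (M x * B) ^ p ≤
      (n : ℝ≥0∞) ^ (p - 1) * ∑ i : Fin n, ENNReal.ofReal c₁⁻¹ ^ p *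
        ‖mApp (V K) (mApp B (EuclideanSpace.single i 1))‖ₑ ^ p * volume K.set := by
  have hB : MatMeasurable fun x => M x * B := h.meas.mul_const B
  calc _ ≤ ∫⁻ x in K.set, (n : ℝ≥0∞) ^ (p - 1) *
        ∑ i, ‖mApp (M x * B) (EuclideanSpace.single i 1)‖ₑ ^ p :=
        lintegral_mono fun x => enm_rpow_le_sum _ h.hpq.lt.le
    _ = (n : ℝ≥0∞) ^ (p - 1) *
        ∑ i, ∫⁻ x in K.set, ‖mApp (M x * B) (EuclideanSpace.single i 1)‖ₑ ^ p := by
        have hm : ∀ i : Fin n, Measurable fun x =>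
            ‖mApp (M x * B) (EuclideanSpace.single i 1)‖ₑ ^ p := fun i =>
          (hB.mApp measurable_const).enorm.pow_const _
        rw [lintegral_const_mul _ (Finset.measurable_fun_sum _ fun i _ => hm i),
          lintegral_finsetSum _ fun i _ => hm i]
    _ ≤ _ := by
        gcongr with i
        simp only [mApp_mul]
        exact h.lintegral_mApp_le K _

lemma lintegral_enm_mul_ne_top (K : DCube d) (B : Matrix (Fin n) (Fin n) ℂ) :
    ∫⁻ x in K.set, enm (M x * B) ^ p ≠ ⊤ := by
  have hp0 := h.hpq.pos
  refine ne_top_of_le_ne_top ?_ (h.lintegral_enm_mul_le K B)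
  refine ENNReal.mul_ne_top (ENNReal.rpow_ne_top_of_nonneg h.hpq.sub_one_pos.le (by simp)) ?_
  refine ENNReal.sum_ne_top.2 fun i _ => ENNReal.mul_ne_top (ENNReal.mul_ne_top ?_ ?_)
    K.volume_set_ne_top
  · exact ENNReal.rpow_ne_top_of_nonneg hp0.le ENNReal.ofReal_ne_top
  · exact ENNReal.rpow_ne_top_of_nonneg hp0.le enorm_ne_top

lemma lintegral_enm_mul_inv_le (K : DCube d) :
    ∫⁻ x in K.set, enm (M x * (V K)⁻¹) ^ p ≤
      (n : ℝ≥0∞) ^ p * ENNReal.ofReal c₁⁻¹ ^ p * volume K.set := by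
  refine (h.lintegral_enm_mul_le K _).trans (le_of_eq ?_)
  have hn0 : (n : ℝ≥0∞) ≠ 0 := by exact_mod_cast h.hn.ne'
  have hs : ∀ i : Fin n, ‖(EuclideanSpace.single i (1 : ℂ) : EuclideanSpace ℂ (Fin n))‖ₑ = 1 := by
    intro i
    rw [← ofReal_norm]; simp
  simp only [(h.posDef K).mApp_mApp_inv, hs, ENNReal.one_rpow, mul_one, Finset.sum_const,
    Finset.card_univ, Fintype.card_fin, nsmul_eq_mul]
  rw [← mul_assoc, ← mul_assoc]
  congr 2
  nth_rewrite 2 [← ENNReal.rpow_one (n : ℝ≥0∞)]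
  rw [← ENNReal.rpow_add _ _ hn0 (by simp)]
  ring_nf

/-- The scalar `A_∞`-type property of `x ↦ ‖W^{1/p}(x) B‖^p`. -/
lemma rpow_mul_lintegral_le (L : DCube d) (B : Matrix (Fin n) (Fin n) ℂ) {E : Set (Fin d → ℝ)}
    (hE : E ⊆ L.set) :
    volume E ^ p * ∫⁻ x in L.set, enm (M x * B) ^ p ≤
      volume L.set ^ p * apNorm p M * ∫⁻ x in E, enm (M x * B) ^ p := by
  have hp0 := h.hpq.pos
  have hm : Measurable fun x => enm (M x * B) := measurable_enm (h.meas.mul_const B)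
  have hEt : ∫⁻ x in E, enm (M x * B) ^ p ≠ ⊤ :=
    ne_top_of_le_ne_top (h.lintegral_enm_mul_ne_top L B) (lintegral_mono_set hE)
  have hEv : volume E ≠ ⊤ := ne_top_of_le_ne_top L.volume_set_ne_top (measure_mono hE)
  have key : ∀ x, volume E ^ p * enm (M x * B) ^ p ≤
      (∫⁻ t in L.set, enm (M x * (M t)⁻¹) ^ q) ^ (p / q) * ∫⁻ t in E, enm (M t * B) ^ p := by
    intro x
    have h1 : volume E * enm (M x * B) ≤
        (∫⁻ t in L.set, enm (M x * (M t)⁻¹) ^ q) ^ (1 / q) *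
          (∫⁻ t in E, enm (M t * B) ^ p) ^ (1 / p) := by
      calc volume E * enm (M x * B) = ∫⁻ t in E, enm (M x * B) := by
            rw [setLIntegral_const, mul_comm]
        _ ≤ ∫⁻ t in E, ((fun t => enm (M x * (M t)⁻¹)) * fun t => enm (M t * B)) t := by
            refine lintegral_mono fun t => ?_
            have : M x * B = M x * (M t)⁻¹ * (M t * B) := by
              rw [Matrix.mul_assoc, ← Matrix.mul_assoc _ (M t), (h.pd t).inv_mul',
                Matrix.one_mul]
            simp only [Pi.mul_apply]
            rw [this]
            exact enm_mul_le _ _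
        _ ≤ (∫⁻ t in E, enm (M x * (M t)⁻¹) ^ q) ^ (1 / q) *
              (∫⁻ t in E, enm (M t * B) ^ p) ^ (1 / p) :=
            ENNReal.lintegral_mul_le_Lp_mul_Lq _ h.hpq.symm
              (measurable_enm (h.meas.inv.const_mul _)).aemeasurable hm.aemeasurable
        _ ≤ _ := by
            gcongr
            exact h.hpq.symm.one_div_nonneg
    have h2 := ENNReal.rpow_le_rpow h1 hp0.le
    rw [ENNReal.mul_rpow_of_nonneg _ _ hp0.le, ENNReal.mul_rpow_of_nonneg _ _ hp0.le,
      ← ENNReal.rpow_mul, ← ENNReal.rpow_mul, one_div_mul_cancel hp0.ne', ENNReal.rpow_one,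
      one_div_mul_eq_div] at h2
    exact h2
  calc volume E ^ p * ∫⁻ x in L.set, enm (M x * B) ^ p
      = ∫⁻ x in L.set, volume E ^ p * enm (M x * B) ^ p :=
        (lintegral_const_mul _ (hm.pow_const _)).symm
    _ ≤ ∫⁻ x in L.set, (∫⁻ t in L.set, enm (M x * (M t)⁻¹) ^ q) ^ (p / q) *
          ∫⁻ t in E, enm (M t * B) ^ p := lintegral_mono key
    _ = (∫⁻ x in L.set, (∫⁻ t in L.set, enm (M x * (M t)⁻¹) ^ q) ^ (p / q)) *
          ∫⁻ t in E, enm (M t * B) ^ p := lintegral_mul_const' _ _ hEt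
    _ ≤ _ := by
        gcongr
        exact h.lintegral_lintegral_le L

lemma lintegral_enm_pos (L : DCube d) : ∫⁻ x in L.set, enm (M x * 1) ^ p ≠ 0 := by
  have hm : Measurable fun x => enm (M x * 1) ^ p :=
    (measurable_enm (h.meas.mul_const 1)).pow_const _
  have : 0 < ∫⁻ x in L.set, enm (M x * 1) ^ p := by
    rw [setLIntegral_pos_iff hm]
    refine L.volume_set_pos.trans_le (measure_mono fun x hx => ⟨?_, hx⟩)
    rw [Function.mem_support, Matrix.mul_one]
    have := enm_pos h.hn (h.pd x).isUnit_det'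
    simp [ENNReal.rpow_eq_zero_iff, this, enm_ne_top]
  exact this.ne'

lemma one_le_apNorm (L : DCube d) : 1 ≤ apNorm p M := by
  have h1 := h.rpow_mul_lintegral_le L 1 subset_rfl
  have hv0 : volume L.set ^ p ≠ 0 := by
    simp [ENNReal.rpow_eq_zero_iff, L.volume_set_ne_zero, L.volume_set_ne_top]
  have hvt : volume L.set ^ p ≠ ⊤ :=
    ENNReal.rpow_ne_top_of_nonneg h.hpq.nonneg L.volume_set_ne_top
  rw [mul_assoc, ENNReal.mul_le_mul_iff_right hv0 hvt] at h1
  nth_rewrite 1 [← one_mul (∫⁻ x in L.set, enm (M x * 1) ^ p)] at h1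
  rwa [ENNReal.mul_le_mul_iff_left (h.lintegral_enm_pos L)
    (h.lintegral_enm_mul_ne_top L 1)] at h1

lemma lintegral_le_of_half (L : DCube d) (B : Matrix (Fin n) (Fin n) ℂ) {U : Set (Fin d → ℝ)}
    (hUm : MeasurableSet U) (hU : U ⊆ L.set) (hv : volume U ≤ 2⁻¹ * volume L.set) :
    ∫⁻ x in U, enm (M x * B) ^ p ≤
      (1 - 2⁻¹ ^ p * (apNorm p M)⁻¹) * ∫⁻ x in L.set, enm (M x * B) ^ p := by
  have hp0 := h.hpq.pos
  have hA1 := h.one_le_apNorm L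
  have hA0 : apNorm p M ≠ 0 := (zero_lt_one.trans_le hA1).ne'
  set T := ∫⁻ x in L.set, enm (M x * B) ^ p with hT
  have hTt : T ≠ ⊤ := h.lintegral_enm_mul_ne_top L B
  set E := L.set \ U
  have hadd : (∫⁻ x in U, enm (M x * B) ^ p) + ∫⁻ x in E, enm (M x * B) ^ p = T := by
    rw [hT, ← lintegral_inter_add_sdiff _ L.set hUm, Set.inter_eq_right.2 hU]
  have hEv : 2⁻¹ * volume L.set ≤ volume E := by
    rw [measure_sdiff hU hUm.nullMeasurableSet
      (ne_top_of_le_ne_top L.volume_set_ne_top (measure_mono hU))]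
    refine ENNReal.le_sub_of_add_le_left
      (ne_top_of_le_ne_top L.volume_set_ne_top (measure_mono hU)) ?_
    calc _ ≤ 2⁻¹ * volume L.set + 2⁻¹ * volume L.set := by gcongr
      _ = volume L.set := by rw [← add_mul, ENNReal.inv_two_add_inv_two, one_mul]
  have h1 := h.rpow_mul_lintegral_le L B (E := E) Set.sdiff_subset
  have hv0 : volume L.set ^ p ≠ 0 := by
    simp [ENNReal.rpow_eq_zero_iff, L.volume_set_ne_zero, L.volume_set_ne_top]
  have hvt : volume L.set ^ p ≠ ⊤ :=
    ENNReal.rpow_ne_top_of_nonneg h.hpq.nonneg L.volume_set_ne_top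
  have h2 : 2⁻¹ ^ p * (apNorm p M)⁻¹ * T ≤ ∫⁻ x in E, enm (M x * B) ^ p := by
    have h3 : volume L.set ^ p * (2⁻¹ ^ p * T) ≤
        volume L.set ^ p * (apNorm p M * ∫⁻ x in E, enm (M x * B) ^ p) := by
      calc _ = (2⁻¹ * volume L.set) ^ p * T := by
            rw [ENNReal.mul_rpow_of_nonneg _ _ hp0.le]; ring
        _ ≤ volume E ^ p * T := by gcongr
        _ ≤ _ := by rw [← mul_assoc]; exact h1
    rw [ENNReal.mul_le_mul_iff_right hv0 hvt] at h3
    calc _ = (apNorm p M)⁻¹ * (2⁻¹ ^ p * T) := by ring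
      _ ≤ (apNorm p M)⁻¹ * (apNorm p M * ∫⁻ x in E, enm (M x * B) ^ p) := by gcongr
      _ = _ := by rw [← mul_assoc, ENNReal.inv_mul_cancel hA0 h.ap.ne, one_mul]
  rw [ENNReal.sub_mul (fun _ _ => hTt), one_mul]
  refine ENNReal.le_sub_of_add_le_right ?_ ?_
  · exact ne_top_of_le_ne_top hTt (h2.trans (lintegral_mono_set Set.sdiff_subset))
  · exact (add_le_add le_rfl h2).trans hadd.le

end IsApWeight

/-! ## Integrability and dual estimates for matrix `A_p` weights -/

lemma ENNReal.le_rpow_of_le_mul_rpow {p q : ℝ} (hpq : p.HolderConjugate q) {Q R : ℝ≥0∞}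
    (hQ : Q ≠ ⊤) (h : Q ≤ R * Q ^ (1 / p)) : Q ≤ R ^ q := by
  rcases eq_or_ne Q 0 with h0 | h0
  · simp [h0]
  have hq := hpq.symm.pos
  have h1 : Q = Q ^ (1 / q) * Q ^ (1 / p) := by
    rw [← ENNReal.rpow_add _ _ h0 hQ]
    have := hpq.inv_add_inv_eq_one
    rw [one_div, one_div, add_comm, this, ENNReal.rpow_one]
  have hz : Q ^ (1 / p) ≠ 0 := by simp [ENNReal.rpow_eq_zero_iff, h0, hQ]
  have ht : Q ^ (1 / p) ≠ ⊤ := ENNReal.rpow_ne_top_of_nonneg hpq.one_div_nonneg hQ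
  have h2 : Q ^ (1 / q) ≤ R := by
    rw [← ENNReal.mul_le_mul_iff_left hz ht]
    rwa [← h1]
  have h3 := ENNReal.rpow_le_rpow h2 hq.le
  rwa [← ENNReal.rpow_mul, one_div_mul_cancel hq.ne', ENNReal.rpow_one] at h3

lemma enm_le_of_forall {n : ℕ} {T : Matrix (Fin n) (Fin n) ℂ} {C : ℝ≥0∞}
    (h : ∀ v, ‖mApp T v‖ₑ ≤ C * ‖v‖ₑ) : enm T ≤ C := by
  rcases eq_or_ne C ⊤ with rfl | hC
  · exact le_top
  rw [enm]
  refine ENNReal.ofReal_le_of_le_toReal (matNorm_le_of_forall _ ENNReal.toReal_nonneg fun v => ?_)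
  have := ENNReal.toReal_mono (ENNReal.mul_ne_top hC enorm_ne_top) (h v)
  simpa [ENNReal.toReal_mul] using this

namespace IsApWeight

variable {d n : ℕ} {p q c₁ c₂ : ℝ} {M : (Fin d → ℝ) → Matrix (Fin n) (Fin n) ℂ}
  {V : DCube d → Matrix (Fin n) (Fin n) ℂ} (h : IsApWeight p q c₁ c₂ M V)
include h

lemma exists_lintegral_enm_inv_le (J : DCube d) : ∃ C : ℝ≥0∞, C ≠ ⊤ ∧
    ∀ K : DCube d, J.set ⊆ K.set →
      (∫⁻ t in K.set, enm (M t)⁻¹ ^ q) ^ (1 / q) ≤ C * volume K.set := by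
  have hp0 := h.hpq.pos
  have hq0 := h.hpq.symm.pos
  have hpq' : 0 ≤ p / q := by positivity
  have hm := h.measurable_enm_inv
  have hpos : ∀ x, enm (M x)⁻¹ ≠ 0 := fun x => enm_pos h.hn (h.pd x).inv.isUnit_det'
  set κ := ∫⁻ x in J.set, enm (M x)⁻¹ ^ (-p) with hκ
  have hκ0 : κ ≠ 0 := by
    refine ne_of_gt ?_
    rw [hκ, setLIntegral_pos_iff (hm.pow_const _)]
    refine J.volume_set_pos.trans_le (measure_mono fun x hx => ⟨?_, hx⟩)
    rw [Function.mem_support]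
    simp [ENNReal.rpow_eq_zero_iff, hpos, enm_ne_top]
  refine ⟨(apNorm p M / κ) ^ (1 / p), ?_, fun K hK => ?_⟩
  · exact ENNReal.rpow_ne_top_of_nonneg h.hpq.one_div_nonneg (ENNReal.div_ne_top h.ap.ne hκ0)
  set s := ∫⁻ t in K.set, enm (M t)⁻¹ ^ q
  have key : ∀ x, enm (M x)⁻¹ ^ (-p) * s ^ (p / q) ≤
      (∫⁻ t in K.set, enm (M x * (M t)⁻¹) ^ q) ^ (p / q) := by
    intro x
    have h1 : s ≤ enm (M x)⁻¹ ^ q * ∫⁻ t in K.set, enm (M x * (M t)⁻¹) ^ q := by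
      rw [← lintegral_const_mul _ ((measurable_enm (h.meas.inv.const_mul _)).pow_const _)]
      refine lintegral_mono fun t => ?_
      rw [← ENNReal.mul_rpow_of_nonneg _ _ hq0.le]
      refine ENNReal.rpow_le_rpow ?_ hq0.le
      calc enm (M t)⁻¹ = enm ((M x)⁻¹ * (M x * (M t)⁻¹)) := by
            rw [← Matrix.mul_assoc, (h.pd x).inv_mul', Matrix.one_mul]
        _ ≤ _ := enm_mul_le _ _
    have h2 := ENNReal.rpow_le_rpow h1 hpq'
    rw [ENNReal.mul_rpow_of_nonneg _ _ hpq', ← ENNReal.rpow_mul, mul_div_cancel₀ _ hq0.ne'] at h2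
    calc _ ≤ enm (M x)⁻¹ ^ (-p) * (enm (M x)⁻¹ ^ p *
          (∫⁻ t in K.set, enm (M x * (M t)⁻¹) ^ q) ^ (p / q)) := by gcongr
      _ = _ := by
        rw [← mul_assoc, ← ENNReal.rpow_add _ _ (hpos x) (enm_ne_top _), neg_add_cancel,
          ENNReal.rpow_zero, one_mul]
  have h1 : κ * s ^ (p / q) ≤ volume K.set ^ p * apNorm p M := by
    calc κ * s ^ (p / q) = ∫⁻ x in J.set, enm (M x)⁻¹ ^ (-p) * s ^ (p / q) :=
          (lintegral_mul_const _ (hm.pow_const _)).symm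
      _ ≤ ∫⁻ x in K.set, (∫⁻ t in K.set, enm (M x * (M t)⁻¹) ^ q) ^ (p / q) :=
          (lintegral_mono key).trans (lintegral_mono_set hK)
      _ ≤ _ := h.lintegral_lintegral_le K
  have hR : volume K.set ^ p * apNorm p M ≠ ⊤ :=
    ENNReal.mul_ne_top (ENNReal.rpow_ne_top_of_nonneg hp0.le K.volume_set_ne_top) h.ap.ne
  have h2 : s ^ (p / q) ≤ volume K.set ^ p * apNorm p M / κ :=
    (ENNReal.le_div_iff_mul_le (Or.inl hκ0) (Or.inr hR)).2 (by rwa [mul_comm])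
  have h3 := ENNReal.rpow_le_rpow h2 h.hpq.one_div_nonneg
  rw [← ENNReal.rpow_mul, mul_div_assoc, ENNReal.mul_rpow_of_nonneg _ _ h.hpq.one_div_nonneg,
    ← ENNReal.rpow_mul, mul_one_div_cancel hp0.ne', ENNReal.rpow_one] at h3
  calc s ^ (1 / q) = s ^ (p / q * (1 / p)) := by congr 1; field_simp
    _ ≤ _ := h3
    _ = _ := mul_comm _ _

lemma lintegral_enm_inv_ne_top (K : DCube d) : ∫⁻ t in K.set, enm (M t)⁻¹ ^ q ≠ ⊤ := by
  obtain ⟨C, hC, hK⟩ := h.exists_lintegral_enm_inv_le K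
  have := ne_top_of_le_ne_top (ENNReal.mul_ne_top hC K.volume_set_ne_top) (hK K subset_rfl)
  intro ht
  rw [ht, ENNReal.top_rpow_of_pos (by have := h.hpq.symm.pos; positivity)] at this
  exact this rfl

lemma lintegral_enorm_le (E : Set (Fin d → ℝ)) {f : (Fin d → ℝ) → EuclideanSpace ℂ (Fin n)}
    (hf : Measurable f) :
    ∫⁻ x in E, ‖f x‖ₑ ≤ (∫⁻ t in E, enm (M t)⁻¹ ^ q) ^ (1 / q) *
      (∫⁻ x in E, ‖mApp (M x) (f x)‖ₑ ^ p) ^ (1 / p) := by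
  calc ∫⁻ x in E, ‖f x‖ₑ
      ≤ ∫⁻ x in E, ((fun x => enm (M x)⁻¹) * fun x => ‖mApp (M x) (f x)‖ₑ) x := by
        refine lintegral_mono fun x => ?_
        have := enorm_mApp_le (M x)⁻¹ (mApp (M x) (f x))
        rwa [(h.pd x).mApp_inv_mApp] at this
    _ ≤ _ := ENNReal.lintegral_mul_le_Lp_mul_Lq _ h.hpq.symm
          h.measurable_enm_inv.aemeasurable (h.meas.mApp hf).enorm.aemeasurable

lemma enorm_mul_inv_le (K I : DCube d) :
    enm (V K * (V I)⁻¹) ≤ ENNReal.ofReal c₁⁻¹ *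
      ((volume I.set)⁻¹ * ∫⁻ t in I.set, enm ((M t)⁻¹ * V K) ^ q) ^ (1 / q) := by
  have hv0 := I.volume_set_ne_zero
  have hvt := I.volume_set_ne_top
  have hp0 := h.hpq.pos
  refine enm_le_of_forall fun v => ?_
  set e := mApp (V I)⁻¹ v with he
  have hVe : mApp (V I) e = v := (h.posDef I).mApp_mApp_inv v
  rw [mApp_mul, ← he, ← hVe]
  set S := ∫⁻ t in I.set, enm ((M t)⁻¹ * V K) ^ q
  have h1 : volume I.set * ‖mApp (V K) e‖ₑ ≤
      S ^ (1 / q) * (∫⁻ t in I.set, ‖mApp (M t) e‖ₑ ^ p) ^ (1 / p) := by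
    calc _ = ∫⁻ t in I.set, ‖mApp (V K) e‖ₑ := by rw [setLIntegral_const, mul_comm]
      _ ≤ ∫⁻ t in I.set, ((fun t => enm ((M t)⁻¹ * V K)) * fun t => ‖mApp (M t) e‖ₑ) t := by
          refine lintegral_mono fun t => ?_
          simp only [Pi.mul_apply]
          rw [(h.pd t).inv.enm_mul_comm (h.posDef K)]
          have := enorm_mApp_le (V K * (M t)⁻¹) (mApp (M t) e)
          rwa [mApp_mul, (h.pd t).mApp_inv_mApp] at this
      _ ≤ _ := ENNReal.lintegral_mul_le_Lp_mul_Lq _ h.hpq.symm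
          (measurable_enm (h.meas.inv.mul_const _)).aemeasurable
          (h.meas.mApp measurable_const).enorm.aemeasurable
  have h2 : (∫⁻ t in I.set, ‖mApp (M t) e‖ₑ ^ p) ^ (1 / p) ≤
      ENNReal.ofReal c₁⁻¹ * ‖mApp (V I) e‖ₑ * volume I.set ^ (1 / p) := by
    refine (ENNReal.rpow_le_rpow (h.lintegral_mApp_le I e) h.hpq.one_div_nonneg).trans_eq ?_
    rw [← ENNReal.mul_rpow_of_nonneg _ _ hp0.le,
      ENNReal.mul_rpow_of_nonneg _ _ h.hpq.one_div_nonneg, ← ENNReal.rpow_mul,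
      mul_one_div_cancel hp0.ne', ENNReal.rpow_one]
  have h3 : (volume I.set)⁻¹ * volume I.set ^ (1 / p) = (volume I.set)⁻¹ ^ (1 / q) := by
    rw [← ENNReal.rpow_neg_one, ← ENNReal.rpow_add _ _ hv0 hvt, ← ENNReal.rpow_mul]
    congr 1
    have := h.hpq.inv_add_inv_eq_one
    rw [one_div, one_div]
    linarith
  calc ‖mApp (V K) e‖ₑ = (volume I.set)⁻¹ * (volume I.set * ‖mApp (V K) e‖ₑ) := by
        rw [← mul_assoc, ENNReal.inv_mul_cancel hv0 hvt, one_mul]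
    _ ≤ (volume I.set)⁻¹ * (S ^ (1 / q) *
          (ENNReal.ofReal c₁⁻¹ * ‖mApp (V I) e‖ₑ * volume I.set ^ (1 / p))) := by
        exact mul_le_mul' le_rfl (h1.trans (mul_le_mul' le_rfl h2))
    _ = ENNReal.ofReal c₁⁻¹ * (((volume I.set)⁻¹ * volume I.set ^ (1 / p)) * S ^ (1 / q)) *
          ‖mApp (V I) e‖ₑ := by ring
    _ = _ := by
        rw [h3, ← ENNReal.mul_rpow_of_nonneg _ _ h.hpq.symm.one_div_nonneg]

lemma lintegral_enorm_mApp_inv_le (K : DCube d) (e : EuclideanSpace ℂ (Fin n)) (he : ‖e‖ = 1) :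
    ∫⁻ t in K.set, ‖mApp (M t)⁻¹ (mApp (V K) e)‖ₑ ^ q ≤
      ENNReal.ofReal c₂ ^ q * apNorm p M ^ (q / p) * volume K.set := by
  have hv0 := K.volume_set_ne_zero
  have hvt := K.volume_set_ne_top
  have hp0 := h.hpq.pos
  have hq0 := h.hpq.symm.pos
  have hq1 := h.hpq.symm.sub_one_pos
  set u := mApp (V K) e with hu
  set m : (Fin d → ℝ) → EuclideanSpace ℂ (Fin n) := fun t => mApp (M t)⁻¹ u with hm
  have hmm : Measurable m := h.meas.inv.mApp measurable_const
  set Q := ∫⁻ t in K.set, ‖m t‖ₑ ^ q with hQ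
  have hQt : Q ≠ ⊤ := by
    have h1 : Q ≤ (∫⁻ t in K.set, enm (M t)⁻¹ ^ q) * ‖u‖ₑ ^ q := by
      rw [← lintegral_mul_const _ (h.measurable_enm_inv.pow_const _)]
      refine lintegral_mono fun t => ?_
      rw [← ENNReal.mul_rpow_of_nonneg _ _ hq0.le]
      exact ENNReal.rpow_le_rpow (enorm_mApp_le _ _) hq0.le
    exact ne_top_of_le_ne_top (ENNReal.mul_ne_top (h.lintegral_enm_inv_ne_top K)
      (ENNReal.rpow_ne_top_of_nonneg hq0.le enorm_ne_top)) h1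
  set ψ : (Fin d → ℝ) → EuclideanSpace ℂ (Fin n) := fun t => (‖m t‖ ^ (q - 2)) • m t with hψ
  have hψm : Measurable ψ := (hmm.norm.pow_const _).smul hmm
  have hψn : ∀ t, ‖ψ t‖ₑ ^ p ≤ ‖m t‖ₑ ^ q := by
    intro t
    have h1 : ‖ψ t‖ ≤ ‖m t‖ ^ (q - 1) := by
      rw [hψ]
      simp only
      rw [norm_smul, Real.norm_of_nonneg (by positivity)]
      rcases (norm_nonneg (m t)).eq_or_lt with h0 | h0
      · rw [← h0, mul_zero]; positivity
      · nth_rewrite 2 [← Real.rpow_one ‖m t‖]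
        rw [← Real.rpow_add h0]
        exact le_of_eq (by ring_nf)
    have h2 : ‖ψ t‖ₑ ≤ ‖m t‖ₑ ^ (q - 1) := by
      rw [← ofReal_norm, ← ofReal_norm, ENNReal.ofReal_rpow_of_nonneg (norm_nonneg _) hq1.le]
      exact ENNReal.ofReal_le_ofReal h1
    refine (ENNReal.rpow_le_rpow h2 hp0.le).trans_eq ?_
    rw [← ENNReal.rpow_mul, h.hpq.symm.sub_one_mul_conj]
  have hψQ : ∫⁻ t in K.set, ‖ψ t‖ₑ ^ p ≤ Q := lintegral_mono hψn
  set φ : (Fin d → ℝ) → EuclideanSpace ℂ (Fin n) := fun t => mApp (M t)⁻¹ (ψ t) with hφ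
  have hφm : Measurable φ := h.meas.inv.mApp hψm
  have hbound : ∀ B : Matrix (Fin n) (Fin n) ℂ, ∫⁻ t in K.set, ‖mApp B (φ t)‖ₑ ≤
      (∫⁻ t in K.set, enm (B * (M t)⁻¹) ^ q) ^ (1 / q) * Q ^ (1 / p) := by
    intro B
    calc _ ≤ ∫⁻ t in K.set, ((fun t => enm (B * (M t)⁻¹)) * fun t => ‖ψ t‖ₑ) t := by
          refine lintegral_mono fun t => ?_
          simp only [Pi.mul_apply]
          rw [hφ, ← mApp_mul]
          exact enorm_mApp_le _ _
      _ ≤ (∫⁻ t in K.set, enm (B * (M t)⁻¹) ^ q) ^ (1 / q) *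
            (∫⁻ t in K.set, ‖ψ t‖ₑ ^ p) ^ (1 / p) :=
          ENNReal.lintegral_mul_le_Lp_mul_Lq _ h.hpq.symm
            (measurable_enm (h.meas.inv.const_mul _)).aemeasurable hψm.enorm.aemeasurable
      _ ≤ _ := by
          gcongr
  have hφi : IntegrableOn φ K.set := by
    refine ⟨hφm.aestronglyMeasurable, ?_⟩
    have h1 := hbound 1
    simp only [mApp_one, Matrix.one_mul] at h1
    exact lt_of_le_of_lt h1 (ENNReal.mul_ne_top
      (ENNReal.rpow_ne_top_of_nonneg h.hpq.symm.one_div_nonneg (h.lintegral_enm_inv_ne_top K))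
      (ENNReal.rpow_ne_top_of_nonneg h.hpq.one_div_nonneg hQt)).lt_top
  set z := ∫ t in K.set, φ t with hz
  have hzM : ∀ x, ‖mApp (M x) z‖ₑ ^ p ≤
      (∫⁻ t in K.set, enm (M x * (M t)⁻¹) ^ q) ^ (p / q) * Q := by
    intro x
    have h1 : ‖mApp (M x) z‖ₑ ≤
        (∫⁻ t in K.set, enm (M x * (M t)⁻¹) ^ q) ^ (1 / q) * Q ^ (1 / p) := by
      refine le_trans ?_ (hbound (M x))
      have : mApp (M x) z = ∫ t in K.set, mApp (M x) (φ t) :=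
        ((Matrix.toEuclideanCLM (𝕜 := ℂ) (n := Fin n) (M x)).integral_comp_comm hφi).symm
      rw [this]
      exact enorm_integral_le_lintegral_enorm _
    refine (ENNReal.rpow_le_rpow h1 hp0.le).trans_eq ?_
    rw [ENNReal.mul_rpow_of_nonneg _ _ hp0.le, ← ENNReal.rpow_mul, ← ENNReal.rpow_mul,
      one_div_mul_cancel hp0.ne', ENNReal.rpow_one, one_div_mul_eq_div]
  have hVz : ‖mApp (V K) z‖ₑ ≤ ENNReal.ofReal c₂ * volume K.set ^ (1 / q) *
      apNorm p M ^ (1 / p) * Q ^ (1 / p) := by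
    refine (h.enorm_mApp_V_le K z).trans ?_
    have h1 : ∫⁻ x in K.set, ‖mApp (M x) z‖ₑ ^ p ≤ volume K.set ^ p * apNorm p M * Q := by
      refine (lintegral_mono hzM).trans ?_
      rw [lintegral_mul_const' _ _ hQt]
      gcongr
      exact h.lintegral_lintegral_le K
    have h2 : (volume K.set)⁻¹ * volume K.set ^ p = volume K.set ^ (p / q) := by
      rw [← ENNReal.rpow_neg_one, ← ENNReal.rpow_add _ _ hv0 hvt, h.hpq.div_conj_eq_sub_one]
      ring_nf
    calc _ ≤ ENNReal.ofReal c₂ * ((volume K.set)⁻¹ *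
          (volume K.set ^ p * apNorm p M * Q)) ^ (1 / p) := by
          gcongr
      _ = ENNReal.ofReal c₂ * (volume K.set ^ (p / q) * apNorm p M * Q) ^ (1 / p) := by
          rw [← h2]; congr 2; ring
      _ = _ := by
          rw [ENNReal.mul_rpow_of_nonneg _ _ h.hpq.one_div_nonneg,
            ENNReal.mul_rpow_of_nonneg _ _ h.hpq.one_div_nonneg, ← ENNReal.rpow_mul]
          have : p / q * (1 / p) = 1 / q := by field_simp
          rw [this]; ring
  have hQz : Q ≤ ‖mApp (V K) z‖ₑ := by
    have h1 : inner ℂ u z = ((Q.toReal : ℝ) : ℂ) := by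
      have e1 : inner ℂ u z = ∫ t in K.set, inner ℂ u (φ t) :=
        ((innerSL ℂ u).integral_comp_comm hφi).symm
      have e2 : ∀ t, inner ℂ u (φ t) = ((‖m t‖ ^ q : ℝ) : ℂ) := by
        intro t
        have e3 : φ t = ((‖m t‖ ^ (q - 2) : ℝ) : ℂ) • mApp (M t)⁻¹ (m t) := by
          rw [hφ, hψ]
          simp only [mApp_real_smul, Complex.coe_smul]
        rw [e3, inner_smul_right, ← (h.pd t).inv.inner_mApp]
        change _ * inner ℂ (m t) (m t) = _
        rw [inner_self_eq_norm_sq_to_K]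
        rcases (norm_nonneg (m t)).eq_or_lt with h0 | h0
        · rw [← h0, Real.zero_rpow hq0.ne']; simp
        · have : ‖m t‖ ^ q = ‖m t‖ ^ (q - 2) * ‖m t‖ ^ 2 := by
            rw [← Real.rpow_natCast, ← Real.rpow_add h0]; congr 1; push_cast; ring
          rw [this]; push_cast; rfl
      rw [e1]
      simp only [e2]
      rw [integral_complex_ofReal, integral_eq_lintegral_of_nonneg_ae
        (Filter.Eventually.of_forall fun t => by positivity)
        (hmm.norm.pow_const _).aestronglyMeasurable]
      congr 3
      funext t
      rw [← ofReal_norm, ENNReal.ofReal_rpow_of_nonneg (norm_nonneg _) hq0.le]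
    have h2 : Q.toReal ≤ ‖mApp (V K) z‖ := by
      have e1 : ‖inner ℂ u z‖ ≤ ‖mApp (V K) z‖ := by
        rw [hu, (h.posDef K).inner_mApp]
        refine (norm_inner_le_norm _ _).trans_eq ?_
        rw [he, one_mul]
      rw [h1, Complex.norm_real, Real.norm_of_nonneg ENNReal.toReal_nonneg] at e1
      exact e1
    rw [← ofReal_norm]
    exact (ENNReal.le_ofReal_iff_toReal_le hQt (norm_nonneg _)).2 h2
  have hfin := ENNReal.le_rpow_of_le_mul_rpow h.hpq hQt (hQz.trans hVz)
  refine hfin.trans_eq ?_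
  rw [ENNReal.mul_rpow_of_nonneg _ _ hq0.le, ENNReal.mul_rpow_of_nonneg _ _ hq0.le,
    ← ENNReal.rpow_mul, ← ENNReal.rpow_mul, one_div_mul_cancel hq0.ne', ENNReal.rpow_one,
    one_div_mul_eq_div]
  ring

lemma lintegral_enm_inv_mul_le (K : DCube d) :
    ∫⁻ t in K.set, enm ((M t)⁻¹ * V K) ^ q ≤
      (n : ℝ≥0∞) ^ q * ENNReal.ofReal c₂ ^ q * apNorm p M ^ (q / p) * volume K.set := by
  have hn0 : (n : ℝ≥0∞) ≠ 0 := by exact_mod_cast h.hn.ne'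
  have hB : MatMeasurable fun x => (M x)⁻¹ * V K := h.meas.inv.mul_const _
  have hm : ∀ i : Fin n, Measurable fun x =>
      ‖mApp ((M x)⁻¹ * V K) (EuclideanSpace.single i 1)‖ₑ ^ q := fun i =>
    (hB.mApp measurable_const).enorm.pow_const _
  calc _ ≤ ∫⁻ x in K.set, (n : ℝ≥0∞) ^ (q - 1) *
        ∑ i, ‖mApp ((M x)⁻¹ * V K) (EuclideanSpace.single i 1)‖ₑ ^ q :=
        lintegral_mono fun x => enm_rpow_le_sum _ h.hpq.symm.lt.le
    _ = (n : ℝ≥0∞) ^ (q - 1) *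
        ∑ i, ∫⁻ x in K.set, ‖mApp ((M x)⁻¹ * V K) (EuclideanSpace.single i 1)‖ₑ ^ q := by
        rw [lintegral_const_mul _ (Finset.measurable_fun_sum _ fun i _ => hm i),
          lintegral_finsetSum _ fun i _ => hm i]
    _ ≤ (n : ℝ≥0∞) ^ (q - 1) *
        ∑ i : Fin n, ENNReal.ofReal c₂ ^ q * apNorm p M ^ (q / p) * volume K.set := by
        gcongr with i
        simp only [mApp_mul]
        exact h.lintegral_enorm_mApp_inv_le K _ (by simp)
    _ = (n : ℝ≥0∞) ^ (q - 1) * n ^ (1 : ℝ) *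
          (ENNReal.ofReal c₂ ^ q * apNorm p M ^ (q / p) * volume K.set) := by
        simp only [Finset.sum_const, Finset.card_univ, Fintype.card_fin, nsmul_eq_mul,
          ENNReal.rpow_one]
        ring
    _ = _ := by
        rw [← ENNReal.rpow_add _ _ hn0 (by simp), sub_add_cancel]; ring

end IsApWeight

/-! ## Estimates inside one stopping tree -/

lemma le_of_forall_mul_add_div_le {X L a b : ℝ} (hL : 0 ≤ L) (ha : 0 ≤ a) (hb : 0 ≤ b)
    (h : ∀ τ : ℝ, 0 < τ → X ≤ L / 2 * (τ * a ^ 2 + b ^ 2 / τ)) : X ≤ L * (a * b) := by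
  have h1 : ∀ δ : ℝ, 0 < δ → X ≤ L * ((a + δ) * (b + δ)) := by
    intro δ hδ
    refine (h ((b + δ) / (a + δ)) (by positivity)).trans ?_
    have e1 : (b + δ) / (a + δ) * a ^ 2 ≤ (a + δ) * (b + δ) := by
      rw [div_mul_eq_mul_div, div_le_iff₀ (by positivity)]
      have : a ^ 2 ≤ (a + δ) ^ 2 := by gcongr; linarith
      nlinarith [mul_le_mul_of_nonneg_left this (by positivity : 0 ≤ b + δ)]
    have e2 : b ^ 2 / ((b + δ) / (a + δ)) ≤ (a + δ) * (b + δ) := by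
      rw [div_div_eq_mul_div, div_le_iff₀ (by positivity)]
      have : b ^ 2 ≤ (b + δ) ^ 2 := by gcongr; linarith
      nlinarith [mul_le_mul_of_nonneg_right this (by positivity : 0 ≤ a + δ)]
    calc _ ≤ L / 2 * ((a + δ) * (b + δ) + (a + δ) * (b + δ)) := by gcongr
      _ = _ := by ring
  have hc : Filter.Tendsto (fun δ : ℝ => L * ((a + δ) * (b + δ))) (nhdsWithin 0 (Set.Ioi 0))
      (nhds (L * ((a + 0) * (b + 0)))) := by
    refine Filter.Tendsto.mono_left (Continuous.tendsto ?_ 0) nhdsWithin_le_nhds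
    fun_prop
  rw [add_zero, add_zero] at hc
  exact ge_of_tendsto hc (by filter_upwards [self_mem_nhdsWithin] with δ hδ using h1 δ hδ)

namespace DCube

variable {d n : ℕ}

lemma integrableOn_child {G : (Fin d → ℝ) → EuclideanSpace ℂ (Fin n)} {I : DCube d}
    (hG : IntegrableOn G I.set) (c : Fin d → Bool) : IntegrableOn G (I.child c).set :=
  hG.mono_set (I.child_subset c)

lemma sum_norm_haarCoef_sq (G : (Fin d → ℝ) → EuclideanSpace ℂ (Fin n)) (I : DCube d)
    (hG : IntegrableOn G I.set) :
    ∑ ε ∈ Sfin d, ‖haarCoef G I ε‖ ^ 2 =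
      ∑ c, (I.child c).vol⁻¹ * ‖∫ x in (I.child c).set, G x‖ ^ 2 -
        I.vol⁻¹ * ‖∫ x in I.set, G x‖ ^ 2 := by
  have h := sum_inner_haarCoef G G I hG hG
  simp only [avgForm, inner_self_eq_norm_sq_to_K] at h
  apply Complex.ofReal_injective
  push_cast
  exact h

lemma treeSum_haarCoef_sq_le (bad : DCube d → Prop)
    (G : (Fin d → ℝ) → EuclideanSpace ℂ (Fin n)) (hG : ∀ I : DCube d, IntegrableOn G I.set)
    (m : ℝ) (hm : ∀ I, ¬ bad I → ∫ x in I.set, ‖G x‖ ≤ m * I.vol) (N : ℕ) (K : DCube d)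
    (hK : ¬ bad K) :
    treeSum bad (fun I => ∑ ε ∈ Sfin d, ‖haarCoef G I ε‖ ^ 2) N K ≤ (2 ^ d * m) ^ 2 * K.vol := by
  classical
  set e : DCube d → ℝ := fun I => I.vol⁻¹ * ‖∫ x in I.set, G x‖ ^ 2 with he
  have he0 : ∀ I, 0 ≤ e I := fun I => by have := I.vol_pos; simp only [he]; positivity
  have hbase : ∀ I B, ∫ x in I.set, ‖G x‖ ≤ B * I.vol → e I ≤ B ^ 2 * I.vol := by
    intro I B h
    have hv := I.vol_pos
    have h1 : ‖∫ x in I.set, G x‖ ≤ B * I.vol := (norm_integral_le_integral_norm _).trans h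
    calc e I ≤ I.vol⁻¹ * (B * I.vol) ^ 2 := by simp only [he]; gcongr
      _ = _ := by field_simp
  have hchild : ∀ I c, ¬ bad I → e (I.child c) ≤ (2 ^ d * m) ^ 2 * (I.child c).vol := by
    intro I c hI
    refine hbase _ _ ?_
    calc ∫ x in (I.child c).set, ‖G x‖ ≤ ∫ x in I.set, ‖G x‖ :=
          setIntegral_mono_set (hG I).norm (Filter.Eventually.of_forall fun _ => norm_nonneg _)
            (I.child_subset c).eventuallyLE
      _ ≤ m * I.vol := hm I hI
      _ = _ := by rw [← I.vol_child c]; ring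
  have hgood : ∀ I, ¬ bad I → e I ≤ (2 ^ d * m) ^ 2 * I.vol := by
    intro I hI
    have hv := I.vol_pos
    have hm0 : 0 ≤ m := by
      have := (integral_nonneg (μ := volume.restrict I.set)
        (f := fun x => ‖G x‖) fun _ => norm_nonneg _).trans (hm I hI)
      exact nonneg_of_mul_nonneg_left this hv
    refine (hbase I m (hm I hI)).trans ?_
    gcongr
    exact le_mul_of_one_le_left hm0 (one_le_pow₀ (by norm_num))
  refine (treeSum_le bad _ (fun I => (2 ^ d * m) ^ 2 * I.vol - e I)
    (fun I hI => sub_nonneg.2 (hgood I hI)) ?_ N K hK).trans (sub_le_self _ (he0 K))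
  intro I hI
  rw [sum_norm_haarCoef_sq G I (hG I)]
  have h1 : ∑ c, (e (I.child c) + if bad (I.child c) then 0 else
      (2 ^ d * m) ^ 2 * (I.child c).vol - e (I.child c)) ≤ (2 ^ d * m) ^ 2 * I.vol := by
    rw [← sum_vol_child, Finset.mul_sum]
    refine Finset.sum_le_sum fun c _ => ?_
    split_ifs
    · rw [add_zero]; exact hchild I c hI
    · linarith
  rw [Finset.sum_add_distrib] at h1
  simp only [he] at h1 ⊢
  linarith

lemma treeSum_le_of_potential (bad : DCube d → Prop) (s U : DCube d → ℝ) (hs : ∀ I, 0 ≤ s I)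
    (hU0 : ∀ I, 0 ≤ U I) (A : ℝ) (hA : ∀ I, ¬ bad I → U I + s I / I.vol ≤ A)
    (hU : ∀ I c, ¬ bad I → ¬ bad (I.child c) → U I + s I / I.vol ≤ U (I.child c))
    (N : ℕ) (K : DCube d) (hK : ¬ bad K) : treeSum bad s N K ≤ A * K.vol := by
  classical
  have hA' : ∀ I, ¬ bad I → U I ≤ A := fun I hI =>
    (le_add_of_nonneg_right (div_nonneg (hs I) I.vol_pos.le)).trans (hA I hI)
  refine (treeSum_le bad s (fun I => (A - U I) * I.vol)
    (fun I hI => mul_nonneg (sub_nonneg.2 (hA' I hI)) I.vol_pos.le) ?_ N K hK).trans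
      (mul_le_mul_of_nonneg_right (sub_le_self _ (hU0 K)) K.vol_pos.le)
  intro I hI
  have h1 : ∑ c, (if bad (I.child c) then 0 else (A - U (I.child c)) * (I.child c).vol) ≤
      (A - (U I + s I / I.vol)) * I.vol := by
    rw [← sum_vol_child I, Finset.mul_sum, sum_vol_child I]
    refine Finset.sum_le_sum fun c _ => ?_
    have hv := (I.child c).vol_pos
    split_ifs with hc
    · exact mul_nonneg (sub_nonneg.2 (hA I hI)) hv.le
    · gcongr
      exact hU I c hI hc
  have hv := I.vol_pos
  have h2 : (A - (U I + s I / I.vol)) * I.vol = (A - U I) * I.vol - s I := by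
    field_simp
    ring
  linarith

/-- The average of a nonnegative function over a dyadic cube. -/
def lavg (I : DCube d) (φ : (Fin d → ℝ) → ℝ≥0∞) : ℝ≥0∞ :=
  (volume I.set)⁻¹ * ∫⁻ x in I.set, φ x

lemma volume_mul_lavg (I : DCube d) (φ : (Fin d → ℝ) → ℝ≥0∞) :
    volume I.set * I.lavg φ = ∫⁻ x in I.set, φ x := by
  rw [lavg, ← mul_assoc, ENNReal.mul_inv_cancel I.volume_set_ne_zero I.volume_set_ne_top, one_mul]

/-- The stopping rule: one of the averages of `φ K i` over `I` is much larger than over `K`. -/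
def avgBad (φ : DCube d → Fin 3 → (Fin d → ℝ) → ℝ≥0∞) (K I : DCube d) : Prop :=
  ∃ i, 6 * K.lavg (φ K i) < I.lavg (φ K i)

lemma not_avgBad_self (φ : DCube d → Fin 3 → (Fin d → ℝ) → ℝ≥0∞) (K : DCube d) :
    ¬ avgBad φ K K := by
  rintro ⟨i, hi⟩
  refine absurd hi (not_lt.2 ?_)
  exact le_mul_of_one_le_left' (by norm_num)

lemma volume_stops_avgBad_le (φ : DCube d → Fin 3 → (Fin d → ℝ) → ℝ≥0∞) (N : ℕ)
    (K : DCube d) :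
    volume (⋃ L ∈ stops (avgBad φ) N K K, L.set) ≤ 2⁻¹ * volume K.set := by
  set ψ : DCube d → ℝ≥0∞ := fun I =>
    ∑ i, (∫⁻ x in I.set, φ K i x) / (6 * K.lavg (φ K i)) with hψ
  have h1 : volume (⋃ L ∈ stops (avgBad φ) N K K, L.set) ≤ ψ K := by
    refine volume_stops_le _ K ψ (fun I => le_of_eq ?_) ?_ N K
    · simp only [hψ]
      rw [Finset.sum_comm]
      refine Finset.sum_congr rfl fun i _ => ?_
      rw [I.lintegral_eq_sum_child]
      simp only [div_eq_mul_inv, Finset.sum_mul]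
    · rintro I ⟨i, hi⟩
      refine le_trans ?_ (Finset.single_le_sum (f := fun i =>
        (∫⁻ x in I.set, φ K i x) / (6 * K.lavg (φ K i))) (fun _ _ => zero_le) (Finset.mem_univ i))
      have hne : I.lavg (φ K i) ≠ 0 := (pos_of_gt hi).ne'
      rw [ENNReal.le_div_iff_mul_le, ← volume_mul_lavg]
      · gcongr
      · right
        rw [← volume_mul_lavg]
        exact mul_ne_zero I.volume_set_ne_zero hne
      · left
        exact (lt_of_lt_of_le hi le_top).ne
  refine h1.trans ?_
  have h2 : ∀ i, (∫⁻ x in K.set, φ K i x) / (6 * K.lavg (φ K i)) ≤ 6⁻¹ * volume K.set := by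
    intro i
    rw [← volume_mul_lavg]
    set a := K.lavg (φ K i)
    refine ENNReal.div_le_of_le_mul (le_of_eq ?_)
    calc volume K.set * a = (6⁻¹ * 6) * (volume K.set * a) := by
          rw [ENNReal.inv_mul_cancel (by norm_num) (by norm_num), one_mul]
      _ = _ := by ring
  calc ψ K ≤ ∑ _i : Fin 3, 6⁻¹ * volume K.set := Finset.sum_le_sum fun i _ => h2 i
    _ = 3 * 6⁻¹ * volume K.set := by simp [mul_assoc]
    _ = 2⁻¹ * volume K.set := by
        congr 1
        rw [show (6 : ℝ≥0∞) = 3 * 2 by norm_num,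
          ENNReal.mul_inv (Or.inl (by norm_num)) (Or.inl (by norm_num)), ← mul_assoc,
          ENNReal.mul_inv_cancel (by norm_num) (by norm_num), one_mul]

end DCube

/-! ## The cost of one stopping cube -/

namespace DCube

variable {d n : ℕ}

open Classical in
/-- The sum of `w` over the strict dyadic ancestors of `I`. -/
def ancestorSum (w : DCube d → ℝ≥0∞) (I : DCube d) : ℝ≥0∞ := ∑' J, if I.Lt J then w J else 0

lemma ancestorSum_add_le {w v : DCube d → ℝ≥0∞} {I : DCube d}
    (h : ∀ J, I.Lt J ∨ J = I → w J ≤ v J) : ancestorSum w I + w I ≤ ∑' J, v J := by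
  classical
  have h1 : w I = ∑' J, if J = I then w J else 0 := by
    rw [tsum_eq_single I fun J hJ => if_neg hJ, if_pos rfl]
  rw [h1, ancestorSum, ← ENNReal.tsum_add]
  refine ENNReal.tsum_le_tsum fun J => ?_
  by_cases hJ : J = I
  · subst hJ
    rw [if_neg (Lt.irrefl J), if_pos rfl, zero_add]
    exact h _ (Or.inr rfl)
  · rw [if_neg hJ, add_zero]
    split_ifs with hl
    · exact h _ (Or.inl hl)
    · exact zero_le

lemma ancestorSum_add_le_child (w : DCube d → ℝ≥0∞) (I : DCube d) (c : Fin d → Bool) :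
    ancestorSum w I + w I ≤ ancestorSum w (I.child c) := by
  refine ancestorSum_add_le fun J hJ => ?_
  rw [if_pos]
  rcases hJ with hJ | rfl
  · exact (child_lt I c).trans hJ
  · exact child_lt _ c

lemma haarCoef_mApp (B : Matrix (Fin n) (Fin n) ℂ) (g : (Fin d → ℝ) → EuclideanSpace ℂ (Fin n))
    (I : DCube d) (hg : IntegrableOn g I.set) (ε : Fin d → Bool) :
    haarCoef (fun x => mApp B (g x)) I ε = mApp B (haarCoef g I ε) := by
  have hi : ∀ J : DCube d, IntegrableOn g J.set →
      ∫ x in J.set, mApp B (g x) = mApp B (∫ x in J.set, g x) := fun J hJ =>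
    (Matrix.toEuclideanCLM (𝕜 := ℂ) (n := Fin n) B).integral_comp_comm hJ
  have hBg : IntegrableOn (fun x => mApp B (g x)) I.set :=
    (Matrix.toEuclideanCLM (𝕜 := ℂ) (n := Fin n) B).integrable_comp hg
  rw [haarCoef_eq_sum _ I hBg, haarCoef_eq_sum _ I hg, mApp_real_smul, mApp_sum]
  simp only [mApp_real_smul, hi _ (integrableOn_child hg _)]

lemma le_lavg (I : DCube d) {φ : (Fin d → ℝ) → ℝ≥0∞} {c : ℝ≥0∞}
    (h : ∀ x ∈ I.set, c ≤ φ x) : c ≤ I.lavg φ := by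
  calc c = (volume I.set)⁻¹ * ∫⁻ x in I.set, c := by
        rw [setLIntegral_const, mul_comm c, ← mul_assoc,
          ENNReal.inv_mul_cancel I.volume_set_ne_zero I.volume_set_ne_top, one_mul]
    _ ≤ _ := by
        rw [lavg]
        gcongr 1
        exact setLIntegral_mono' I.measurableSet_set h

lemma integral_norm_eq_lavg (I : DCube d) {G : (Fin d → ℝ) → EuclideanSpace ℂ (Fin n)}
    (hG : IntegrableOn G I.set) :
    ∫ x in I.set, ‖G x‖ = (I.lavg fun x => ‖G x‖ₑ).toReal * I.vol := by
  rw [integral_norm_eq_lintegral_enorm hG.aestronglyMeasurable, ← volume_mul_lavg,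
    ENNReal.toReal_mul, volume_set, ENNReal.toReal_ofReal I.vol_pos.le, mul_comm]

end DCube

/-- The square function. -/
def sqRoot {d n : ℕ} (V : DCube d → Matrix (Fin n) (Fin n) ℂ)
    (f : (Fin d → ℝ) → EuclideanSpace ℂ (Fin n)) (x : Fin d → ℝ) : ℝ≥0∞ := sqFn V f x ^ (2⁻¹ : ℝ)

/-- The Haar coefficients of `f` on `I`, measured by `V I`. -/
def haarSq {d n : ℕ} (V : DCube d → Matrix (Fin n) (Fin n) ℂ)
    (f : (Fin d → ℝ) → EuclideanSpace ℂ (Fin n)) (I : DCube d) : ℝ :=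
  ∑ ε ∈ Sfin d, ‖mApp (V I) (haarCoef f I ε)‖ ^ 2

/-- The pairing of the Haar coefficients of `f` and `g` on `I`, in absolute value. -/
def haarPair {d n : ℕ} (V : DCube d → Matrix (Fin n) (Fin n) ℂ)
    (f g : (Fin d → ℝ) → EuclideanSpace ℂ (Fin n)) (I : DCube d) : ℝ :=
  ∑ ε ∈ Sfin d, ‖mApp (V I) (haarCoef f I ε)‖ * ‖mApp (V I)⁻¹ (haarCoef g I ε)‖

/-- The functions whose averages are controlled by the stopping rule. -/
def stopFns {d n : ℕ} (q : ℝ) (M : (Fin d → ℝ) → Matrix (Fin n) (Fin n) ℂ)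
    (V : DCube d → Matrix (Fin n) (Fin n) ℂ) (f g : (Fin d → ℝ) → EuclideanSpace ℂ (Fin n))
    (K : DCube d) : Fin 3 → (Fin d → ℝ) → ℝ≥0∞ :=
  ![fun x => ‖mApp (V K)⁻¹ (g x)‖ₑ, fun x => enm ((M x)⁻¹ * V K) ^ q, sqRoot V f]

lemma ancestorSum_haarSq_add_le {d n : ℕ} (V : DCube d → Matrix (Fin n) (Fin n) ℂ)
    (f : (Fin d → ℝ) → EuclideanSpace ℂ (Fin n)) (I : DCube d) {x : Fin d → ℝ} (hx : x ∈ I.set) :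
    DCube.ancestorSum (fun J => ENNReal.ofReal (haarSq V f J) / ENNReal.ofReal J.vol) I +
      ENNReal.ofReal (haarSq V f I) / ENNReal.ofReal I.vol ≤ sqFn V f x := by
  refine DCube.ancestorSum_add_le
    (w := fun J => ENNReal.ofReal (haarSq V f J) / ENNReal.ofReal J.vol) fun J hJ => ?_
  have hxJ : x ∈ J.set := by
    rcases hJ with hJ | rfl
    · exact hJ.2 hx
    · exact hx
  simp only [Set.indicator_of_mem hxJ]
  rw [haarSq, ENNReal.ofReal_sum_of_nonneg fun _ _ => by positivity, div_eq_mul_inv,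
    Finset.sum_mul]
  rfl

namespace IsApWeight

open DCube

variable {d n : ℕ} {p q c₁ c₂ : ℝ} {M : (Fin d → ℝ) → Matrix (Fin n) (Fin n) ℂ}
  {V : DCube d → Matrix (Fin n) (Fin n) ℂ} (h : IsApWeight p q c₁ c₂ M V)
include h

lemma enm_mul_inv_le_of_not_bad {f g : (Fin d → ℝ) → EuclideanSpace ℂ (Fin n)} {K I : DCube d}
    (hI : ¬ avgBad (stopFns q M V f g) K I) :
    enm (V K * (V I)⁻¹) ≤
      ENNReal.ofReal c₁⁻¹ * 6 ^ (1 / q) * n * ENNReal.ofReal c₂ * apNorm p M ^ (1 / p) := by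
  have hq0 := h.hpq.symm.pos
  have h1 : I.lavg (fun x => enm ((M x)⁻¹ * V K) ^ q) ≤
      6 * K.lavg (fun x => enm ((M x)⁻¹ * V K) ^ q) := not_lt.1 fun hc => hI ⟨1, hc⟩
  have h2 : K.lavg (fun x => enm ((M x)⁻¹ * V K) ^ q) ≤
      (n : ℝ≥0∞) ^ q * ENNReal.ofReal c₂ ^ q * apNorm p M ^ (q / p) := by
    rw [lavg, mul_comm, ← div_eq_mul_inv]
    exact ENNReal.div_le_of_le_mul (h.lintegral_enm_inv_mul_le K)
  refine (h.enorm_mul_inv_le K I).trans ?_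
  calc _ ≤ ENNReal.ofReal c₁⁻¹ * (6 * ((n : ℝ≥0∞) ^ q * ENNReal.ofReal c₂ ^ q *
        apNorm p M ^ (q / p))) ^ (1 / q) :=
        mul_le_mul' le_rfl (ENNReal.rpow_le_rpow (h1.trans (mul_le_mul' le_rfl h2))
          h.hpq.symm.one_div_nonneg)
    _ = _ := by
        have hq := h.hpq.symm.one_div_nonneg
        rw [ENNReal.mul_rpow_of_nonneg _ _ hq, ENNReal.mul_rpow_of_nonneg _ _ hq,
          ENNReal.mul_rpow_of_nonneg _ _ hq, ← ENNReal.rpow_mul, ← ENNReal.rpow_mul,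
          ← ENNReal.rpow_mul, mul_one_div_cancel hq0.ne', ENNReal.rpow_one, ENNReal.rpow_one]
        have : q / p * (1 / q) = 1 / p := by field_simp
        rw [this]; ring

lemma treeSum_haarPair_le {f g : (Fin d → ℝ) → EuclideanSpace ℂ (Fin n)}
    (hg : ∀ I : DCube d, IntegrableOn g I.set) (K : DCube d)
    (hF : K.lavg (sqRoot V f) ≠ ⊤) (lam : ℝ)
    (hlam : ENNReal.ofReal c₁⁻¹ * 6 ^ (1 / q) * n * ENNReal.ofReal c₂ * apNorm p M ^ (1 / p) ≤
      ENNReal.ofReal lam) (hlam0 : 0 ≤ lam) (N : ℕ) :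
    treeSum (avgBad (stopFns q M V f g) K) (haarPair V f g) N K ≤
      lam * K.vol * ((6 * (K.lavg (sqRoot V f)).toReal) *
        (2 ^ d * (6 * (K.lavg fun x => ‖mApp (V K)⁻¹ (g x)‖ₑ).toReal))) := by
  set bad := avgBad (stopFns q M V f g) K with hbad
  have hK : ¬ bad K := not_avgBad_self _ K
  set G : (Fin d → ℝ) → EuclideanSpace ℂ (Fin n) := fun x => mApp (V K)⁻¹ (g x) with hGdef
  have hG : ∀ I : DCube d, IntegrableOn G I.set := fun I =>
    (Matrix.toEuclideanCLM (𝕜 := ℂ) (n := Fin n) (V K)⁻¹).integrable_comp (hg I)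
  have hGt : ∀ I : DCube d, I.lavg (fun x => ‖G x‖ₑ) ≠ ⊤ := fun I =>
    ENNReal.mul_ne_top (ENNReal.inv_ne_top.2 I.volume_set_ne_zero) (hG I).2.ne
  set a := 6 * (K.lavg (sqRoot V f)).toReal with ha
  set b := 2 ^ d * (6 * (K.lavg fun x => ‖G x‖ₑ).toReal) with hb
  have hB : treeSum bad (fun I => ∑ ε ∈ Sfin d, ‖haarCoef G I ε‖ ^ 2) N K ≤ b ^ 2 * K.vol := by
    refine treeSum_haarCoef_sq_le bad G hG _ (fun I hI => ?_) N K hK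
    rw [integral_norm_eq_lavg I (hG I)]
    refine mul_le_mul_of_nonneg_right ?_ I.vol_pos.le
    have h1 : I.lavg (fun x => ‖G x‖ₑ) ≤ 6 * K.lavg (fun x => ‖G x‖ₑ) :=
      not_lt.1 fun hc => hI ⟨0, hc⟩
    have h2 := ENNReal.toReal_mono (ENNReal.mul_ne_top (by norm_num) (hGt K)) h1
    simpa [ENNReal.toReal_mul] using h2
  set w : DCube d → ℝ≥0∞ := fun J => ENNReal.ofReal (haarSq V f J) / ENNReal.ofReal J.vol with hw
  have hs0 : ∀ I, 0 ≤ haarSq V f I := fun I => Finset.sum_nonneg fun _ _ => by positivity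
  have hwr : ∀ I, w I = ENNReal.ofReal (haarSq V f I / I.vol) := fun I =>
    (ENNReal.ofReal_div_of_pos I.vol_pos).symm
  have hwT : ∀ I, (w I).toReal = haarSq V f I / I.vol := fun I => by
    rw [hwr, ENNReal.toReal_ofReal (div_nonneg (hs0 I) I.vol_pos.le)]
  have hwt : ∀ I, w I ≠ ⊤ := fun I => by rw [hwr]; exact ENNReal.ofReal_ne_top
  have hUA : ∀ I, ¬ bad I → ancestorSum w I + w I ≤ ENNReal.ofReal (a ^ 2) := by
    intro I hI
    have h1 : I.lavg (sqRoot V f) ≤ 6 * K.lavg (sqRoot V f) := not_lt.1 fun hc => hI ⟨2, hc⟩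
    have h2 : (ancestorSum w I + w I) ^ (2⁻¹ : ℝ) ≤ 6 * K.lavg (sqRoot V f) :=
      (I.le_lavg fun x hx => ENNReal.rpow_le_rpow (ancestorSum_haarSq_add_le V f I hx)
        (by norm_num)).trans h1
    have h3 : 6 * K.lavg (sqRoot V f) = ENNReal.ofReal a := by
      rw [ha, ENNReal.ofReal_mul (by norm_num), ENNReal.ofReal_toReal hF]
      norm_num
    rw [h3] at h2
    have h4 := ENNReal.rpow_le_rpow h2 (by norm_num : (0 : ℝ) ≤ 2)
    rw [← ENNReal.rpow_mul, inv_mul_cancel₀ (by norm_num), ENNReal.rpow_one] at h4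
    rw [ENNReal.ofReal_pow (by positivity)]
    exact_mod_cast h4
  have hUt : ∀ I, ¬ bad I → ancestorSum w I ≠ ⊤ := fun I hI =>
    ne_top_of_le_ne_top ENNReal.ofReal_ne_top (le_self_add.trans (hUA I hI))
  have hA : treeSum bad (haarSq V f) N K ≤ a ^ 2 * K.vol := by
    refine treeSum_le_of_potential bad _ (fun I => (ancestorSum w I).toReal) hs0
      (fun _ => ENNReal.toReal_nonneg) _ (fun I hI => ?_) (fun I c hI hc => ?_) N K hK
    · rw [← hwT, ← ENNReal.toReal_add (hUt I hI) (hwt I)]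
      exact ENNReal.toReal_le_of_le_ofReal (by positivity) (hUA I hI)
    · rw [← hwT, ← ENNReal.toReal_add (hUt I hI) (hwt I)]
      exact ENNReal.toReal_mono (hUt _ hc) (ancestorSum_add_le_child w I c)
  refine le_of_forall_mul_add_div_le (mul_nonneg hlam0 K.vol_pos.le) (by positivity)
    (by positivity) fun τ hτ => ?_
  have hP : ∀ I, ¬ bad I → haarPair V f g I ≤ (lam / 2 * τ) * haarSq V f I +
      (lam / 2 / τ) * ∑ ε ∈ Sfin d, ‖haarCoef G I ε‖ ^ 2 := by
    intro I hI
    have hVI := h.posDef I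
    have hVK := h.posDef K
    have h1 : matNorm ((V I)⁻¹ * V K) ≤ lam := by
      have := (h.enm_mul_inv_le_of_not_bad hI).trans hlam
      rw [hVK.enm_mul_comm hVI.inv] at this
      exact (ENNReal.ofReal_le_ofReal_iff hlam0).1 this
    rw [haarPair, haarSq, Finset.mul_sum, Finset.mul_sum, ← Finset.sum_add_distrib]
    refine Finset.sum_le_sum fun ε _ => ?_
    have h2 : ‖mApp (V I)⁻¹ (haarCoef g I ε)‖ ≤ lam * ‖haarCoef G I ε‖ := by
      have e1 : mApp (V I)⁻¹ (haarCoef g I ε) = mApp ((V I)⁻¹ * V K) (haarCoef G I ε) := by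
        rw [hGdef, haarCoef_mApp _ g I (hg I), mApp_mul, hVK.mApp_mApp_inv]
      rw [e1]
      exact (norm_mApp_le _ _).trans (by gcongr)
    set x := ‖mApp (V I) (haarCoef f I ε)‖
    set y := ‖haarCoef G I ε‖
    have h3 : x * y ≤ (τ * x ^ 2 + y ^ 2 / τ) / 2 := by
      have e1 : 0 ≤ (τ * x - y) ^ 2 / τ := by positivity
      have e2 : (τ * x - y) ^ 2 / τ = τ * x ^ 2 + y ^ 2 / τ - 2 * (x * y) := by
        field_simp; ring
      linarith
    calc _ ≤ x * (lam * y) := by gcongr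
      _ = lam * (x * y) := by ring
      _ ≤ lam * ((τ * x ^ 2 + y ^ 2 / τ) / 2) := by gcongr
      _ = _ := by field_simp
  refine (treeSum_mono bad hP N K hK).trans ?_
  rw [treeSum_linear]
  calc _ ≤ lam / 2 * τ * (a ^ 2 * K.vol) + lam / 2 / τ * (b ^ 2 * K.vol) := by gcongr
    _ = _ := by field_simp

end IsApWeight

/-! ## Summation over the stopping cubes -/

lemma Real.one_sub_rpow_le {x r : ℝ} (hx0 : 0 ≤ x) (hx1 : x ≤ 1) (hr : 0 ≤ r) :
    (1 - x) ^ r ≤ 1 - min 1 r * x := by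
  rcases le_total r 1 with h | h
  · have := rpow_one_add_le_one_add_mul_self (s := -x) (by linarith) hr h
    rw [min_eq_right h]
    calc (1 - x) ^ r = (1 + -x) ^ r := by ring_nf
      _ ≤ _ := by linarith
  · rw [min_eq_left h, one_mul]
    calc (1 - x) ^ r ≤ (1 - x) ^ (1 : ℝ) :=
          Real.rpow_le_rpow_of_exponent_ge' (by linarith) (by linarith) (by norm_num) h
      _ = _ := Real.rpow_one _

lemma carleson_factor_le {x r : ℝ} (hx0 : 0 < x) (hx1 : x < 1) (hr : 0 < r) :
    (1 - ENNReal.ofReal (1 - x)⁻¹ ^ (-r))⁻¹ ≤ ENNReal.ofReal (min 1 r * x)⁻¹ := by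
  have hκ : 0 < min 1 r := lt_min one_pos hr
  rw [ENNReal.ofReal_rpow_of_pos (by have : 0 < 1 - x := by linarith
                                     positivity),
    Real.inv_rpow (by linarith), Real.rpow_neg (by linarith), inv_inv,
    ← ENNReal.ofReal_one, ← ENNReal.ofReal_sub _ (Real.rpow_nonneg (by linarith) _),
    ENNReal.ofReal_inv_of_pos (by positivity), ENNReal.inv_le_inv]
  refine ENNReal.ofReal_le_ofReal ?_
  linarith [Real.one_sub_rpow_le hx0.le hx1.le hr.le]

namespace DCube

variable {d : ℕ}

/-- A finite family in which the cubes strictly below a given one cover at most half of it. -/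
def Sparse (S : Finset (DCube d)) : Prop :=
  ∀ M ∈ S, volume (⋃ L ∈ {L | L ∈ S ∧ L.Lt M}, L.set) ≤ 2⁻¹ * volume M.set

lemma sparse_stopFam_avgBad (φ : DCube d → Fin 3 → (Fin d → ℝ) → ℝ≥0∞) (N : ℕ) (K : DCube d) :
    Sparse (stopFam (avgBad φ) N K) := fun M hM =>
  volume_below_stopFam_le _ _ (fun N K => volume_stops_avgBad_le φ N K) N K M hM

/-- The constant in the unweighted Carleson embedding theorem. -/
def maxConst (p q : ℝ) : ℝ≥0∞ := 4 ^ (p / q) * ENNReal.ofReal (min 1 (p / q) * 3⁻¹)⁻¹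

lemma sum_lavg_rpow_le {p q : ℝ} (hpq : p.HolderConjugate q) {S : Finset (DCube d)}
    (hS : Sparse S) {F : (Fin d → ℝ) → ℝ≥0∞} (hF : Measurable F) :
    ∑ K ∈ S, volume K.set * K.lavg F ^ p ≤ maxConst p q * ∫⁻ x, F x ^ p := by
  have h := carleson_embedding hpq.symm S 2⁻¹ (ENNReal.ofReal (1 - 3⁻¹)⁻¹) 4 1
    (by rw [ENNReal.one_le_ofReal]; norm_num) ENNReal.ofReal_ne_top
    (by
      have : (2⁻¹ : ℝ≥0∞) = ENNReal.ofReal 2⁻¹ := by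
        rw [ENNReal.ofReal_inv_of_pos (by norm_num)]; norm_num
      have h4 : (4 : ℝ≥0∞) = ENNReal.ofReal 4 := by norm_num
      rw [this, h4, ← ENNReal.ofReal_mul (by norm_num), ← ENNReal.ofReal_mul (by norm_num),
        ← ENNReal.ofReal_one, ← ENNReal.ofReal_add (by norm_num) (by norm_num)]
      exact ENNReal.ofReal_le_ofReal (by norm_num))
    (fun _ _ => 1) (fun _ => measurable_const)
    (fun K _ M hM => by simpa using hS M hM) (fun K _ => by simp) F hF
  simp only [one_mul, mul_one] at h
  refine h.trans ?_
  rw [maxConst]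
  gcongr
  exact carleson_factor_le (by norm_num) (by norm_num) (div_pos hpq.pos hpq.symm.pos)

end DCube

lemma measurable_sqRoot {d n : ℕ} (V : DCube d → Matrix (Fin n) (Fin n) ℂ)
    (f : (Fin d → ℝ) → EuclideanSpace ℂ (Fin n)) : Measurable (sqRoot V f) := by
  have : Countable (DCube d) :=
    Function.Injective.countable (f := fun I : DCube d => (I.k, I.m)) fun I J h => by
      cases I; cases J; simpa using h
  refine Measurable.pow_const (Measurable.tsum fun I => ?_) _
  exact Finset.measurable_fun_sum _ fun ε _ => measurable_const.indicator I.measurableSet_set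

/-- The constant in the weighted Carleson embedding theorem. -/
def carlesonConst (n : ℕ) (p q c₁ : ℝ) : ℝ≥0∞ :=
  (ENNReal.ofReal (2 ^ (p + 1)) * ((n : ℝ≥0∞) ^ p * ENNReal.ofReal c₁⁻¹ ^ p)) ^ (q / p) *
    ENNReal.ofReal ((min 1 (q / p))⁻¹ * 2 ^ (p + 1))

/-- The constant in the final estimate. -/
def pairConst (d n : ℕ) (p q c₁ c₂ : ℝ) : ℝ≥0∞ :=
  36 * 2 ^ d * (ENNReal.ofReal c₁⁻¹ * 6 ^ (1 / q) * n * ENNReal.ofReal c₂) *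
    DCube.maxConst p q ^ (1 / p) * carlesonConst n p q c₁ ^ (1 / q)

namespace IsApWeight

open DCube

variable {d n : ℕ} {p q c₁ c₂ : ℝ} {M : (Fin d → ℝ) → Matrix (Fin n) (Fin n) ℂ}
  {V : DCube d → Matrix (Fin n) (Fin n) ℂ} (h : IsApWeight p q c₁ c₂ M V)
include h

lemma sum_weighted_avg_rpow_le {S : Finset (DCube d)} (hS : Sparse S)
    {H : (Fin d → ℝ) → ℝ≥0∞} (hH : Measurable H) :
    ∑ K ∈ S, volume K.set * K.lavg (fun x => enm (M x * (V K)⁻¹) * H x) ^ q ≤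
      carlesonConst n p q c₁ * apNorm p M ^ q * ∫⁻ x, H x ^ q := by
  rcases S.eq_empty_or_nonempty with rfl | ⟨L, -⟩
  · simp
  have hp0 := h.hpq.pos
  have hq0 := h.hpq.symm.pos
  set a := (apNorm p M).toReal with ha
  have hAa : apNorm p M = ENNReal.ofReal a := (ENNReal.ofReal_toReal h.ap.ne).symm
  have ha1 : 1 ≤ a := by
    have := h.one_le_apNorm L
    rwa [hAa, ENNReal.one_le_ofReal] at this
  set x := (2 ^ (p + 1) * a)⁻¹ with hx
  have h2p : (2 : ℝ) ^ (1 : ℝ) < 2 ^ (p + 1) :=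
    Real.rpow_lt_rpow_of_exponent_lt (by norm_num) (by linarith)
  rw [Real.rpow_one] at h2p
  have hx0 : 0 < x := by positivity
  have hx1 : x ≤ 1 / 2 := by
    rw [hx, one_div]
    gcongr
    nlinarith
  have hρ : 1 - 2⁻¹ ^ p * (apNorm p M)⁻¹ = ENNReal.ofReal (1 - 2 * x) := by
    have e1 : (2⁻¹ : ℝ≥0∞) ^ p * (apNorm p M)⁻¹ = ENNReal.ofReal (2 * x) := by
      have : 2 * x = (2 ^ p * a)⁻¹ := by
        rw [hx, Real.rpow_add (by norm_num), Real.rpow_one]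
        field_simp
      rw [this, ENNReal.ofReal_inv_of_pos (by positivity), ENNReal.ofReal_mul (by positivity),
        ← ENNReal.ofReal_rpow_of_pos (by norm_num), hAa, ENNReal.inv_rpow,
        ENNReal.mul_inv (Or.inr ENNReal.ofReal_ne_top)
          (Or.inr (by rw [ne_eq, ENNReal.ofReal_eq_zero]; linarith))]
      norm_num
    rw [e1, ENNReal.ofReal_sub _ (by positivity), ENNReal.ofReal_one]
  have hCE := carleson_embedding h.hpq S (1 - 2⁻¹ ^ p * (apNorm p M)⁻¹)
    (ENNReal.ofReal (1 - x)⁻¹) (ENNReal.ofReal x⁻¹) ((n : ℝ≥0∞) ^ p * ENNReal.ofReal c₁⁻¹ ^ p)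
    (by
      rw [ENNReal.one_le_ofReal]
      exact (one_le_inv₀ (by linarith)).2 (by linarith)) ENNReal.ofReal_ne_top
    (by
      have h1x : 0 < 1 - x := by linarith
      have h2x : 0 ≤ 1 - 2 * x := by linarith
      rw [hρ, ← ENNReal.ofReal_mul (by positivity), ← ENNReal.ofReal_mul (by positivity),
        ← ENNReal.ofReal_one, ← ENNReal.ofReal_add (by norm_num) (by positivity)]
      refine ENNReal.ofReal_le_ofReal ?_
      have : x⁻¹ - (1 + (1 - x)⁻¹ * (1 - 2 * x) * x⁻¹) = x / (1 - x) := by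
        field_simp
        ring
      have : 0 ≤ x / (1 - x) := by positivity
      linarith)
    (fun K x => enm (M x * (V K)⁻¹)) (fun K => measurable_enm (h.meas.mul_const _))
    (fun K _ L hL => h.lintegral_le_of_half L _
      (MeasurableSet.biUnion ((S.finite_toSet.subset fun L hL => hL.1).countable)
        fun L _ => L.measurableSet_set)
      (Set.iUnion₂_subset fun I hI => hI.2.2) (hS L hL))
    (fun K _ => h.lintegral_enm_mul_inv_le K) H hH
  refine hCE.trans ?_
  have hfac := carleson_factor_le hx0 (by linarith : x < 1) (div_pos hq0 hp0)
  refine mul_le_mul' (le_trans (mul_le_mul' le_rfl hfac) (le_of_eq ?_)) le_rfl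
  have hr : 0 ≤ q / p := by positivity
  have e1 : ENNReal.ofReal x⁻¹ = ENNReal.ofReal (2 ^ (p + 1)) * apNorm p M := by
    rw [hx, inv_inv, ENNReal.ofReal_mul (by positivity), hAa]
  have e2 : ENNReal.ofReal (min 1 (q / p) * x)⁻¹ =
      ENNReal.ofReal ((min 1 (q / p))⁻¹ * 2 ^ (p + 1)) * apNorm p M := by
    rw [mul_inv, hx, inv_inv, ← mul_assoc, ENNReal.ofReal_mul, hAa]
    have : 0 ≤ min 1 (q / p) := le_min zero_le_one hr
    positivity
  have hA0 : apNorm p M ≠ 0 := (zero_lt_one.trans_le (h.one_le_apNorm L)).ne'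
  have e3 : apNorm p M ^ q = apNorm p M ^ (q / p) * apNorm p M := by
    nth_rewrite 3 [← ENNReal.rpow_one (apNorm p M)]
    rw [← ENNReal.rpow_add _ _ hA0 h.ap.ne, h.hpq.symm.div_conj_eq_sub_one, sub_add_cancel]
  rw [e1, e2, e3, carlesonConst, mul_right_comm (ENNReal.ofReal (2 ^ (p + 1))),
    ENNReal.mul_rpow_of_nonneg _ (apNorm p M) hr]
  ring

lemma lavg_sqRoot_ne_top {f : (Fin d → ℝ) → EuclideanSpace ℂ (Fin n)}
    (hf : ∫⁻ x, sqRoot V f x ^ p ≠ ⊤) (K : DCube d) : K.lavg (sqRoot V f) ≠ ⊤ := by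
  refine ENNReal.mul_ne_top (ENNReal.inv_ne_top.2 K.volume_set_ne_zero) ?_
  have h1 : ∫⁻ x in K.set, sqRoot V f x ≤
      (∫⁻ x in K.set, sqRoot V f x ^ p) ^ (1 / p) * (∫⁻ x in K.set, 1 ^ q) ^ (1 / q) := by
    have := ENNReal.lintegral_mul_le_Lp_mul_Lq (volume.restrict K.set) h.hpq
      (measurable_sqRoot V f).aemeasurable (g := fun _ => 1) aemeasurable_const
    simpa using this
  refine ne_top_of_le_ne_top (ENNReal.mul_ne_top ?_ ?_) h1
  · exact ENNReal.rpow_ne_top_of_nonneg h.hpq.one_div_nonneg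
      (ne_top_of_le_ne_top hf (setLIntegral_le_lintegral _ _))
  · refine ENNReal.rpow_ne_top_of_nonneg h.hpq.symm.one_div_nonneg ?_
    simpa using K.volume_set_ne_top

lemma allSum_haarPair_le {f g hh : (Fin d → ℝ) → EuclideanSpace ℂ (Fin n)}
    (hhm : Measurable hh) (hgh : ∀ x, g x = mApp (M x) (hh x))
    (hg : ∀ I : DCube d, IntegrableOn g I.set) (hf : ∫⁻ x, sqRoot V f x ^ p ≠ ⊤) (N : ℕ)
    (K : DCube d) :
    ENNReal.ofReal (allSum (haarPair V f g) N K) ≤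
      pairConst d n p q c₁ c₂ * (apNorm p M ^ (1 / p) * apNorm p M) *
        (∫⁻ x, sqRoot V f x ^ p) ^ (1 / p) * (∫⁻ x, ‖hh x‖ₑ ^ q) ^ (1 / q) := by
  have hp0 := h.hpq.pos
  have hq0 := h.hpq.symm.pos
  have hpi := h.hpq.one_div_nonneg
  have hqi := h.hpq.symm.one_div_nonneg
  set Λ : ℝ≥0∞ := ENNReal.ofReal c₁⁻¹ * 6 ^ (1 / q) * n * ENNReal.ofReal c₂ *
    apNorm p M ^ (1 / p) with hΛ
  have hΛt : Λ ≠ ⊤ := by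
    refine ENNReal.mul_ne_top (ENNReal.mul_ne_top (ENNReal.mul_ne_top (ENNReal.mul_ne_top
      ENNReal.ofReal_ne_top ?_) (by simp)) ENNReal.ofReal_ne_top) ?_
    · exact ENNReal.rpow_ne_top_of_nonneg hqi (by norm_num)
    · exact ENNReal.rpow_ne_top_of_nonneg hpi h.ap.ne
  set S := stopFam (avgBad (stopFns q M V f g)) N K
  have hS : Sparse S := sparse_stopFam_avgBad _ N K
  have h1 := allSum_le_stopFam (avgBad (stopFns q M V f g)) (haarPair V f g) _
    (fun N L => h.treeSum_haarPair_le (f := f) hg L (h.lavg_sqRoot_ne_top hf L) Λ.toReal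
      (by rw [ENNReal.ofReal_toReal hΛt]) ENNReal.toReal_nonneg N) N K
  have hcost : ∀ L : DCube d, ENNReal.ofReal (Λ.toReal * L.vol *
      ((6 * (L.lavg (sqRoot V f)).toReal) *
        (2 ^ d * (6 * (L.lavg fun x => ‖mApp (V L)⁻¹ (g x)‖ₑ).toReal)))) ≤
      36 * 2 ^ d * Λ * ((volume L.set ^ (1 / p) * L.lavg (sqRoot V f)) *
        (volume L.set ^ (1 / q) * L.lavg fun x => enm (M x * (V L)⁻¹) * ‖hh x‖ₑ)) := by
    intro L
    have e1 : (L.lavg fun x => ‖mApp (V L)⁻¹ (g x)‖ₑ) ≤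
        L.lavg fun x => enm (M x * (V L)⁻¹) * ‖hh x‖ₑ := by
      refine mul_le_mul' le_rfl (lintegral_mono fun x => ?_)
      rw [hgh, ← mApp_mul, (h.pd x).enm_mul_comm (h.posDef L).inv]
      exact enorm_mApp_le _ _
    have e2 : volume L.set = volume L.set ^ (1 / p) * volume L.set ^ (1 / q) := by
      rw [← ENNReal.rpow_add _ _ L.volume_set_ne_zero L.volume_set_ne_top, one_div, one_div,
        h.hpq.inv_add_inv_eq_one, ENNReal.rpow_one]
    have e3 : Λ.toReal * L.vol * ((6 * (L.lavg (sqRoot V f)).toReal) *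
        (2 ^ d * (6 * (L.lavg fun x => ‖mApp (V L)⁻¹ (g x)‖ₑ).toReal))) =
        (36 * 2 ^ d * Λ * (volume L.set * (L.lavg (sqRoot V f) *
          L.lavg fun x => ‖mApp (V L)⁻¹ (g x)‖ₑ))).toReal := by
      simp only [ENNReal.toReal_mul, volume_set, ENNReal.toReal_ofReal L.vol_pos.le,
        ENNReal.toReal_pow, ENNReal.toReal_ofNat]
      ring
    rw [e3]
    refine ENNReal.ofReal_toReal_le.trans (mul_le_mul' le_rfl ?_)
    calc volume L.set * (L.lavg (sqRoot V f) * L.lavg fun x => ‖mApp (V L)⁻¹ (g x)‖ₑ)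
        ≤ volume L.set * (L.lavg (sqRoot V f) *
          L.lavg fun x => enm (M x * (V L)⁻¹) * ‖hh x‖ₑ) := by gcongr
      _ = _ := by
        conv_lhs => rw [e2]
        ring
  have h2 : ∑ L ∈ S, (volume L.set ^ (1 / p) * L.lavg (sqRoot V f)) *
        (volume L.set ^ (1 / q) * L.lavg fun x => enm (M x * (V L)⁻¹) * ‖hh x‖ₑ) ≤
      (maxConst p q * ∫⁻ x, sqRoot V f x ^ p) ^ (1 / p) *
        (carlesonConst n p q c₁ * apNorm p M ^ q * ∫⁻ x, ‖hh x‖ₑ ^ q) ^ (1 / q) := by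
    refine (ENNReal.inner_le_Lp_mul_Lq S _ _ h.hpq).trans ?_
    have e : ∀ r : ℝ, 0 < r → ∀ a b : ℝ≥0∞, (a ^ (1 / r) * b) ^ r = a * b ^ r := by
      intro r hr a b
      rw [ENNReal.mul_rpow_of_nonneg _ _ hr.le, ← ENNReal.rpow_mul, one_div_mul_cancel hr.ne',
        ENNReal.rpow_one]
    simp only [e p hp0, e q hq0]
    exact mul_le_mul'
      (ENNReal.rpow_le_rpow (sum_lavg_rpow_le h.hpq hS (measurable_sqRoot V f)) hpi)
      (ENNReal.rpow_le_rpow (h.sum_weighted_avg_rpow_le hS hhm.enorm) hqi)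
  calc _ ≤ ENNReal.ofReal (∑ L ∈ S, Λ.toReal * L.vol * ((6 * (L.lavg (sqRoot V f)).toReal) *
          (2 ^ d * (6 * (L.lavg fun x => ‖mApp (V L)⁻¹ (g x)‖ₑ).toReal)))) :=
        ENNReal.ofReal_le_ofReal h1
    _ = ∑ L ∈ S, ENNReal.ofReal (Λ.toReal * L.vol * ((6 * (L.lavg (sqRoot V f)).toReal) *
          (2 ^ d * (6 * (L.lavg fun x => ‖mApp (V L)⁻¹ (g x)‖ₑ).toReal)))) :=
        ENNReal.ofReal_sum_of_nonneg fun L _ => by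
          have := L.vol_pos
          positivity
    _ ≤ 36 * 2 ^ d * Λ * ((maxConst p q * ∫⁻ x, sqRoot V f x ^ p) ^ (1 / p) *
          (carlesonConst n p q c₁ * apNorm p M ^ q * ∫⁻ x, ‖hh x‖ₑ ^ q) ^ (1 / q)) := by
        refine (Finset.sum_le_sum fun L _ => hcost L).trans ?_
        rw [← Finset.mul_sum]
        exact mul_le_mul' le_rfl h2
    _ = _ := by
        rw [ENNReal.mul_rpow_of_nonneg _ _ hpi, ENNReal.mul_rpow_of_nonneg _ _ hqi,
          ENNReal.mul_rpow_of_nonneg _ _ hqi, ← ENNReal.rpow_mul, mul_one_div_cancel hq0.ne',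
          ENNReal.rpow_one, pairConst, hΛ]
        ring

end IsApWeight

namespace DCube

variable {d n : ℕ}

/-- The average of `g` over the dyadic cube of generation `k` containing `x`. -/
def dyAvg (g : (Fin d → ℝ) → EuclideanSpace ℂ (Fin n)) (k : ℤ) (x : Fin d → ℝ) :
    EuclideanSpace ℂ (Fin n) :=
  (cubeAt k x).vol⁻¹ • ∫ y in (cubeAt k x).set, g y

lemma leafSum_avgForm {f g : (Fin d → ℝ) → EuclideanSpace ℂ (Fin n)} (N : ℕ) (K : DCube d)
    (hf : IntegrableOn f K.set) :
    IntegrableOn (fun x => inner ℂ (f x) (dyAvg g (K.k - N) x)) K.set ∧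
      leafSum (avgForm f g) N K = ∫ x in K.set, inner ℂ (f x) (dyAvg g (K.k - N) x) := by
  induction N generalizing K with
  | zero =>
    have hc : ∀ x ∈ K.set, inner ℂ (f x) (K.vol⁻¹ • ∫ y in K.set, g y) =
        inner ℂ (f x) (dyAvg g (K.k - (0 : ℕ)) x) := fun x hx => by
      have : cubeAt (K.k - (0 : ℕ)) x = K := by simpa using mem_set_iff.1 hx
      rw [dyAvg, this]
    refine ⟨IntegrableOn.congr_fun (hf.inner_const _) hc K.measurableSet_set, ?_⟩
    rw [← setIntegral_congr_fun K.measurableSet_set hc, leafSum, avgForm]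
    have : ∀ v : EuclideanSpace ℂ (Fin n), ∫ x in K.set, inner ℂ (f x) v =
        inner ℂ (∫ x in K.set, f x) v := fun v => by
      rw [← inner_conj_symm, ← integral_inner hf, ← integral_conj]
      simp only [inner_conj_symm]
    rw [this, inner_smul_right_eq_smul, Complex.real_smul]
    push_cast
    rfl
  | succ N ih =>
    have hi : ∀ c, IntegrableOn (fun x => inner ℂ (f x) (dyAvg g (K.k - (N + 1 : ℕ)) x))
        (K.child c).set ∧ leafSum (avgForm f g) N (K.child c) =
          ∫ x in (K.child c).set, inner ℂ (f x) (dyAvg g (K.k - (N + 1 : ℕ)) x) := fun c => by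
      have e : (K.child c).k - (N : ℤ) = K.k - (N + 1 : ℕ) := by
        rw [child_k]; push_cast; ring
      have := ih (K.child c) (integrableOn_child hf c)
      rwa [e] at this
    have hint : IntegrableOn (fun x => inner ℂ (f x) (dyAvg g (K.k - (N + 1 : ℕ)) x)) K.set := by
      rw [set_eq_iUnion_child]
      exact integrableOn_finite_iUnion.2 fun c => (hi c).1
    refine ⟨hint, ?_⟩
    rw [integral_eq_sum_child K hint, leafSum]
    exact Finset.sum_congr rfl fun c _ => (hi c).2

lemma norm_dyAvg_le {g : (Fin d → ℝ) → EuclideanSpace ℂ (Fin n)} {B : ℝ} (hB : ∀ x, ‖g x‖ ≤ B)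
    (k : ℤ) (x : Fin d → ℝ) : ‖dyAvg g k x‖ ≤ B := by
  have hv := (cubeAt k x).vol_pos
  have h1 := norm_setIntegral_le_of_norm_le_const (μ := volume) (s := (cubeAt k x).set) (f := g)
    (cubeAt k x).volume_set_ne_top.lt_top (fun y _ => hB y)
  rw [volume_real_set] at h1
  rw [dyAvg, norm_smul, Real.norm_of_nonneg (by positivity)]
  calc _ ≤ (cubeAt k x).vol⁻¹ * (B * (cubeAt k x).vol) := by gcongr
    _ = B := by field_simp

lemma ae_tendsto_dyAvg {g : (Fin d → ℝ) → EuclideanSpace ℂ (Fin n)}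
    (hg : LocallyIntegrable g) (k : ℤ) :
    ∀ᵐ x, Filter.Tendsto (fun N : ℕ => dyAvg g (k - N) x) Filter.atTop (nhds (g x)) := by
  filter_upwards [IsUnifLocDoublingMeasure.ae_tendsto_average volume hg 1] with x hx
  have h := hx (l := Filter.atTop)
    (fun N : ℕ => fun i => (cubeAt (k - N) x).corner i + (2 : ℝ) ^ (k - (N : ℤ)) / 2)
    (fun N : ℕ => (2 : ℝ) ^ (k - (N : ℤ)) / 2) ?_ ?_
  · refine h.congr fun N => ?_
    rw [← cubeSet_eq_closedBall _ (by positivity), dyAvg]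
    have e : (cubeAt (k - (N : ℤ)) x).set =ᵐ[volume]
        cubeSet (cubeAt (k - (N : ℤ)) x).corner (2 ^ (k - (N : ℤ))) := set_eq_cubeSet_ae _
    rw [setAverage_eq, ← setIntegral_congr_set e, ← measureReal_congr e, volume_real_set]
  · rw [tendsto_nhdsWithin_iff]
    refine ⟨?_, Filter.Eventually.of_forall fun N => by
      simp only [Set.mem_Ioi]; positivity⟩
    have e : (fun N : ℕ => (2 : ℝ) ^ (k - (N : ℤ)) / 2) =
        fun N : ℕ => (2 : ℝ) ^ k / 2 * (2⁻¹ : ℝ) ^ N := by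
      funext N
      rw [zpow_sub₀ two_ne_zero, zpow_natCast, inv_pow]
      ring
    rw [e, ← mul_zero ((2 : ℝ) ^ k / 2)]
    exact (_root_.tendsto_pow_atTop_nhds_zero_of_lt_one (by norm_num) (by norm_num)).const_mul _
  · refine Filter.Eventually.of_forall fun N => ?_
    rw [one_mul, ← cubeSet_eq_closedBall _ (by positivity)]
    have := mem_cubeAt (k - (N : ℤ)) x
    intro i
    obtain ⟨h1, h2⟩ := this i
    refine ⟨h1, ?_⟩
    simp only [corner]
    rw [add_mul, one_mul] at h2
    exact h2.le

lemma tendsto_leafSum {f g : (Fin d → ℝ) → EuclideanSpace ℂ (Fin n)} (K : DCube d)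
    (hf : IntegrableOn f K.set) (hg : LocallyIntegrable g) {B : ℝ} (hB : ∀ x, ‖g x‖ ≤ B) :
    Filter.Tendsto (fun N => leafSum (avgForm f g) N K) Filter.atTop
      (nhds (∫ x in K.set, inner ℂ (f x) (g x))) := by
  simp only [(leafSum_avgForm _ K hf).2]
  refine tendsto_integral_of_dominated_convergence (fun x => ‖f x‖ * B)
    (fun N => (leafSum_avgForm N K hf).1.aestronglyMeasurable) (hf.norm.mul_const B) ?_ ?_
  · intro N
    refine Filter.Eventually.of_forall fun x => (norm_inner_le_norm _ _).trans ?_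
    gcongr
    exact norm_dyAvg_le hB _ x
  · filter_upwards [ae_restrict_of_ae (ae_tendsto_dyAvg hg K.k)] with x hx
    exact tendsto_const_nhds.inner hx

end DCube

namespace IsApWeight

open DCube

variable {d n : ℕ} {p q c₁ c₂ : ℝ} {M : (Fin d → ℝ) → Matrix (Fin n) (Fin n) ℂ}
  {V : DCube d → Matrix (Fin n) (Fin n) ℂ} (h : IsApWeight p q c₁ c₂ M V)
include h

lemma norm_sum_avgForm_sub_le {f g : (Fin d → ℝ) → EuclideanSpace ℂ (Fin n)} (I : DCube d)
    (hf : IntegrableOn f I.set) (hg : IntegrableOn g I.set) :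
    ‖∑ c, avgForm f g (I.child c) - avgForm f g I‖ ≤ haarPair V f g I := by
  rw [← sum_inner_haarCoef f g I hf hg]
  refine (norm_sum_le _ _).trans (Finset.sum_le_sum fun ε _ => ?_)
  rw [(h.posDef I).inner_eq]
  exact norm_inner_le_norm _ _

lemma integrableOn_of_lintegral_ne_top {f : (Fin d → ℝ) → EuclideanSpace ℂ (Fin n)}
    (hf : Measurable f) (hfin : ∫⁻ x, ‖mApp (M x) (f x)‖ₑ ^ p ≠ ⊤) (K : DCube d) :
    IntegrableOn f K.set := by
  refine ⟨hf.aestronglyMeasurable, ?_⟩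
  refine lt_of_le_of_lt (h.lintegral_enorm_le K.set hf) (ENNReal.mul_lt_top ?_ ?_)
  · exact (ENNReal.rpow_ne_top_of_nonneg h.hpq.symm.one_div_nonneg
      (h.lintegral_enm_inv_ne_top K)).lt_top
  · exact (ENNReal.rpow_ne_top_of_nonneg h.hpq.one_div_nonneg
      (ne_top_of_le_ne_top hfin (setLIntegral_le_lintegral _ _))).lt_top

end IsApWeight

lemma enorm_avgForm_le {d n : ℕ} (f g : (Fin d → ℝ) → EuclideanSpace ℂ (Fin n)) (K : DCube d) :
    ‖avgForm f g K‖ₑ ≤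
      (volume K.set)⁻¹ * (∫⁻ x in K.set, ‖f x‖ₑ) * ∫⁻ x, ‖g x‖ₑ := by
  have h1 : ‖((K.vol : ℂ))⁻¹‖ₑ = (volume K.set)⁻¹ := by
    rw [← ofReal_norm, norm_inv, Complex.norm_real, Real.norm_of_nonneg K.vol_pos.le,
      ENNReal.ofReal_inv_of_pos K.vol_pos, K.volume_set]
  have h2 : ‖(inner ℂ (∫ x in K.set, f x) (∫ x in K.set, g x) : ℂ)‖ₑ ≤
      ‖∫ x in K.set, f x‖ₑ * ‖∫ x in K.set, g x‖ₑ := by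
    rw [← ofReal_norm, ← ofReal_norm, ← ofReal_norm, ← ENNReal.ofReal_mul (norm_nonneg _)]
    exact ENNReal.ofReal_le_ofReal (norm_inner_le_norm _ _)
  rw [avgForm, enorm_mul, h1, mul_assoc]
  gcongr
  refine h2.trans (mul_le_mul' (enorm_integral_le_lintegral_enorm _) ?_)
  exact (enorm_integral_le_lintegral_enorm _).trans (setLIntegral_le_lintegral _ _)

namespace DCube

lemma tendsto_inv_volume_cubeAt {d : ℕ} (hd : 0 < d) (k : ℤ) (x : Fin d → ℝ) :
    Filter.Tendsto (fun j : ℕ => (volume (cubeAt (k + j) x).set)⁻¹) Filter.atTop (nhds 0) := by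
  have e : (fun j : ℕ => (volume (cubeAt (k + j) x).set)⁻¹) =
      fun j : ℕ => ENNReal.ofReal ((((2 : ℝ) ^ k)⁻¹) ^ d * ((2⁻¹ : ℝ) ^ d) ^ j) := by
    funext j
    rw [volume_set, ← ENNReal.ofReal_inv_of_pos (vol_pos _), vol, cubeAt_k,
      zpow_add₀ two_ne_zero, zpow_natCast, mul_pow, mul_inv, ← inv_pow, ← inv_pow, ← inv_pow,
      pow_right_comm]
  have h := (_root_.tendsto_pow_atTop_nhds_zero_of_lt_one (r := (2⁻¹ : ℝ) ^ d) (by positivity)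
    (pow_lt_one₀ (by norm_num) (by norm_num) hd.ne')).const_mul ((((2 : ℝ) ^ k)⁻¹) ^ d)
  rw [mul_zero] at h
  rw [e, ← ENNReal.ofReal_zero]
  exact ENNReal.tendsto_ofReal h

end DCube

namespace IsApWeight

open DCube

variable {d n : ℕ} {p q c₁ c₂ : ℝ} {M : (Fin d → ℝ) → Matrix (Fin n) (Fin n) ℂ}
  {V : DCube d → Matrix (Fin n) (Fin n) ℂ} (h : IsApWeight p q c₁ c₂ M V)
include h

lemma enorm_integral_sub_avgForm_le {f g hh : (Fin d → ℝ) → EuclideanSpace ℂ (Fin n)}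
    (hhm : Measurable hh) (hgh : ∀ x, g x = mApp (M x) (hh x))
    (hf : ∀ I : DCube d, IntegrableOn f I.set) (hg : Integrable g) {B : ℝ}
    (hB : ∀ x, ‖g x‖ ≤ B) (hsq : ∫⁻ x, sqRoot V f x ^ p ≠ ⊤) (K : DCube d) :
    ‖(∫ x in K.set, inner ℂ (f x) (g x)) - avgForm f g K‖ₑ ≤
      pairConst d n p q c₁ c₂ * (apNorm p M ^ (1 / p) * apNorm p M) *
        (∫⁻ x, sqRoot V f x ^ p) ^ (1 / p) * (∫⁻ x, ‖hh x‖ₑ ^ q) ^ (1 / q) := by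
  refine le_of_tendsto (((tendsto_leafSum K (hf K) hg.locallyIntegrable hB).sub_const
    (avgForm f g K)).enorm) (Filter.Eventually.of_forall fun N => ?_)
  refine le_trans ?_ (h.allSum_haarPair_le hhm hgh (fun I => hg.integrableOn) hsq N K)
  rw [← ofReal_norm]
  exact ENNReal.ofReal_le_ofReal (norm_leafSum_sub_le _ _
    (fun I => h.norm_sum_avgForm_sub_le I (hf I) hg.integrableOn) N K)

lemma enorm_le_of_forall_avgForm {f g : (Fin d → ℝ) → EuclideanSpace ℂ (Fin n)} (hd : 0 < d)
    (hf : Measurable f) (hfin : ∫⁻ x, ‖mApp (M x) (f x)‖ₑ ^ p ≠ ⊤) (hg : Integrable g)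
    (J : DCube d) {z : ℂ} {R : ℝ≥0∞}
    (hz : ∀ K : DCube d, J.set ⊆ K.set → ‖z - avgForm f g K‖ₑ ≤ R) : ‖z‖ₑ ≤ R := by
  have hp0 := h.hpq.pos
  set K : ℕ → DCube d := fun j => cubeAt (J.k + j) J.corner with hK
  have hmono : ∀ i j, i ≤ j → (K i).set ⊆ (K j).set := fun i j hij =>
    subset_of_mem (mem_cubeAt _ _) (mem_cubeAt _ _) (by simp only [hK, cubeAt_k]; omega)
  have hJK : ∀ j, J.set ⊆ (K j).set := fun j =>
    subset_of_mem J.corner_mem (mem_cubeAt _ _) (by simp only [hK, cubeAt_k]; omega)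
  obtain ⟨C, hC, hCJ⟩ := h.exists_lintegral_enm_inv_le J
  have hm : Measurable fun x => ‖mApp (M x) (f x)‖ₑ ^ p := (h.meas.mApp hf).enorm.pow_const _
  set S : ℕ → Set (Fin d → ℝ) := fun m => (⋃ j, (K j).set) \ (K m).set
  have hSm : ∀ m, MeasurableSet (S m) := fun m =>
    (MeasurableSet.iUnion fun j => (K j).measurableSet_set).diff (K m).measurableSet_set
  set T : ℕ → ℝ≥0∞ := fun m => ∫⁻ x in S m, ‖mApp (M x) (f x)‖ₑ ^ p with hT
  have hT0 : Filter.Tendsto T Filter.atTop (nhds 0) := by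
    have h1 := tendsto_measure_iInter_atTop
      (μ := volume.withDensity fun x => ‖mApp (M x) (f x)‖ₑ ^ p) (s := S)
      (fun m => (hSm m).nullMeasurableSet)
      (fun i j hij => Set.sdiff_subset_sdiff_right (hmono i j hij))
      ⟨0, by
        rw [withDensity_apply _ (hSm 0)]
        exact ne_top_of_le_ne_top hfin (setLIntegral_le_lintegral _ _)⟩
    have h2 : ⋂ m, S m = ∅ := by
      refine Set.eq_empty_of_forall_notMem fun x hx => ?_
      rw [Set.mem_iInter] at hx
      obtain ⟨j, hj⟩ := Set.mem_iUnion.1 (hx 0).1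
      exact (hx j).2 hj
    rw [h2, measure_empty] at h1
    refine h1.congr fun m => ?_
    simp only [Function.comp, withDensity_apply _ (hSm m), hT]
  set G := ∫⁻ x, ‖g x‖ₑ
  have hG : G ≠ ⊤ := hg.2.ne
  have key : ∀ m j, m ≤ j → ‖z‖ₑ ≤ R + ((volume (K j).set)⁻¹ * (∫⁻ x in (K m).set, ‖f x‖ₑ) +
      C * T m ^ (1 / p)) * G := by
    intro m j hmj
    have hv0 := (K j).volume_set_ne_zero
    have hvt := (K j).volume_set_ne_top
    calc ‖z‖ₑ ≤ ‖z - avgForm f g (K j)‖ₑ + ‖avgForm f g (K j)‖ₑ := by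
          simpa using enorm_add_le (z - avgForm f g (K j)) (avgForm f g (K j))
      _ ≤ R + (volume (K j).set)⁻¹ * (∫⁻ x in (K j).set, ‖f x‖ₑ) * G :=
          add_le_add (hz _ (hJK j)) (enorm_avgForm_le _ _ _)
      _ ≤ _ := by
          refine add_le_add le_rfl (mul_le_mul' ?_ le_rfl)
          have hsplit : ∫⁻ x in (K j).set, ‖f x‖ₑ = (∫⁻ x in (K m).set, ‖f x‖ₑ) +
              ∫⁻ x in (K j).set \ (K m).set, ‖f x‖ₑ := by
            rw [← lintegral_inter_add_sdiff _ (K j).set (K m).measurableSet_set,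
              Set.inter_eq_right.2 (hmono m j hmj)]
          rw [hsplit, mul_add]
          refine add_le_add le_rfl ?_
          calc _ ≤ (volume (K j).set)⁻¹ * ((C * volume (K j).set) * T m ^ (1 / p)) := by
                refine mul_le_mul' le_rfl ?_
                refine (h.lintegral_enorm_le _ hf).trans (mul_le_mul' ?_ ?_)
                · refine le_trans ?_ (hCJ (K j) (hJK j))
                  exact ENNReal.rpow_le_rpow (lintegral_mono_set Set.sdiff_subset)
                    h.hpq.symm.one_div_nonneg
                · refine ENNReal.rpow_le_rpow (lintegral_mono_set ?_) h.hpq.one_div_nonneg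
                  exact Set.sdiff_subset_sdiff_left (Set.subset_iUnion (fun j => (K j).set) j)
            _ = (volume (K j).set)⁻¹ * volume (K j).set * (C * T m ^ (1 / p)) := by ring
            _ = _ := by rw [ENNReal.inv_mul_cancel hv0 hvt, one_mul]
  have key2 : ∀ m, ‖z‖ₑ ≤ R + (C * T m ^ (1 / p)) * G := by
    intro m
    have hfm : ∫⁻ x in (K m).set, ‖f x‖ₑ ≠ ⊤ :=
      (h.integrableOn_of_lintegral_ne_top hf hfin (K m)).2.ne
    refine ge_of_tendsto ?_ ((Filter.eventually_ge_atTop m).mono (key m))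
    have h1 := ENNReal.Tendsto.mul_const (tendsto_inv_volume_cubeAt hd J.k J.corner)
      (b := ∫⁻ x in (K m).set, ‖f x‖ₑ) (Or.inr hfm)
    rw [zero_mul] at h1
    have h2 := ENNReal.Tendsto.mul_const (h1.add_const (C * T m ^ (1 / p))) (b := G) (Or.inr hG)
    rw [zero_add] at h2
    exact h2.const_add R
  have h1 := (ENNReal.continuous_rpow_const (y := 1 / p)).tendsto 0 |>.comp hT0
  rw [ENNReal.zero_rpow_of_pos (by positivity)] at h1
  have h2 := ENNReal.Tendsto.mul_const (ENNReal.Tendsto.const_mul h1 (a := C) (Or.inr hC))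
    (b := G) (Or.inr hG)
  rw [mul_zero, zero_mul] at h2
  have h3 := h2.const_add R
  rw [add_zero] at h3
  exact ge_of_tendsto' h3 key2

end IsApWeight

/-- The bound on the `L^p(W)` norm of `f` over a single dyadic cube. -/
def squareBound {d n : ℕ} (p q c₁ c₂ : ℝ) (M : (Fin d → ℝ) → Matrix (Fin n) (Fin n) ℂ)
    (V : DCube d → Matrix (Fin n) (Fin n) ℂ) (f : (Fin d → ℝ) → EuclideanSpace ℂ (Fin n)) :
    ℝ≥0∞ :=
  pairConst d n p q c₁ c₂ * (apNorm p M ^ (1 / p) * apNorm p M) *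
    (∫⁻ x, sqRoot V f x ^ p) ^ (1 / p)

lemma norm_rpow_sub_two_smul {E : Type*} [NormedAddCommGroup E] [NormedSpace ℝ E] {p : ℝ}
    (hp : 1 < p) (u : E) : ‖‖u‖ ^ (p - 2) • u‖ = ‖u‖ ^ (p - 1) := by
  rcases eq_or_ne u 0 with rfl | hu
  · simp [Real.zero_rpow (by linarith : p - 1 ≠ 0)]
  · have hu0 := norm_pos_iff.2 hu
    rw [norm_smul, Real.norm_of_nonneg (by positivity)]
    nth_rewrite 2 [← Real.rpow_one ‖u‖]
    rw [← Real.rpow_add hu0]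
    ring_nf

lemma inner_rpow_sub_two_smul {n : ℕ} {p : ℝ} (hp : 1 < p) (u : EuclideanSpace ℂ (Fin n)) :
    inner ℂ u (‖u‖ ^ (p - 2) • u) = ((‖u‖ ^ p : ℝ) : ℂ) := by
  rcases eq_or_ne u 0 with rfl | hu
  · simp [Real.zero_rpow (by linarith : p ≠ 0)]
  · have hu0 := norm_pos_iff.2 hu
    rw [inner_smul_right_eq_smul, inner_self_eq_norm_sq_to_K, Complex.real_smul]
    have : ‖u‖ ^ p = ‖u‖ ^ (p - 2) * ‖u‖ ^ 2 := by
      rw [← Real.rpow_natCast, ← Real.rpow_add hu0]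
      norm_num
    rw [this]
    push_cast
    rfl

namespace IsApWeight

open DCube

variable {d n : ℕ} {p q c₁ c₂ : ℝ} {M : (Fin d → ℝ) → Matrix (Fin n) (Fin n) ℂ}
  {V : DCube d → Matrix (Fin n) (Fin n) ℂ} (h : IsApWeight p q c₁ c₂ M V)
include h

lemma lintegral_le_of_bounded {f : (Fin d → ℝ) → EuclideanSpace ℂ (Fin n)} (hd : 0 < d)
    (hf : Measurable f) (hfin : ∫⁻ x, ‖mApp (M x) (f x)‖ₑ ^ p ≠ ⊤)
    (hsq : ∫⁻ x, sqRoot V f x ^ p ≠ ⊤) (J : DCube d) {E : Set (Fin d → ℝ)}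
    (hE : MeasurableSet E) (hEJ : E ⊆ J.set) {k : ℝ} (hk : 0 ≤ k)
    (hE1 : ∀ x ∈ E, ‖mApp (M x) (f x)‖ ≤ k) (hE2 : ∀ x ∈ E, matNorm (M x) ≤ k) :
    ∫⁻ x in E, ‖mApp (M x) (f x)‖ₑ ^ p ≤ squareBound p q c₁ c₂ M V f ^ p := by
  have hp := h.hpq.lt
  have hq0 := h.hpq.symm.pos
  set u := fun x => mApp (M x) (f x) with hu
  have hum : Measurable u := h.meas.mApp hf
  set hh := E.indicator fun x => ‖u x‖ ^ (p - 2) • u x with hhh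
  have hhm : Measurable hh := ((hum.norm.pow_const _).smul hum).indicator hE
  set g := fun x => mApp (M x) (hh x) with hg
  have hgm : Measurable g := h.meas.mApp hhm
  have hnot : ∀ x, x ∉ E → g x = 0 := fun x hx => by
    rw [hg, hhh]
    simp only [Set.indicator_of_notMem hx]
    exact map_zero (Matrix.toEuclideanCLM (𝕜 := ℂ) (n := Fin n) (M x))
  have hB : ∀ x, ‖g x‖ ≤ k * k ^ (p - 1) := fun x => by
    by_cases hx : x ∈ E
    · refine (norm_mApp_le _ _).trans ?_
      rw [hhh, Set.indicator_of_mem hx, norm_rpow_sub_two_smul hp]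
      exact mul_le_mul (hE2 x hx) (Real.rpow_le_rpow (norm_nonneg _) (hE1 x hx)
        h.hpq.sub_one_pos.le) (by positivity) hk
    · rw [hnot x hx, norm_zero]
      positivity
  have hEv : volume E ≠ ⊤ := ne_top_of_le_ne_top J.volume_set_ne_top (measure_mono hEJ)
  have hgi : Integrable g := by
    rw [← integrableOn_iff_integrable_of_support_subset (s := E)
      (fun x hx => by_contra fun hxE => hx (hnot x hxE))]
    exact Measure.integrableOn_of_bounded hEv hgm.aestronglyMeasurable
      (Filter.Eventually.of_forall hB)
  set X := ∫⁻ x in E, ‖u x‖ₑ ^ p with hX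
  have hXt : X ≠ ⊤ := ne_top_of_le_ne_top hfin (setLIntegral_le_lintegral _ _)
  have hhX : ∫⁻ x, ‖hh x‖ₑ ^ q = X := by
    rw [hX, ← lintegral_indicator hE]
    refine lintegral_congr fun x => ?_
    by_cases hx : x ∈ E
    · rw [hhh, Set.indicator_of_mem hx, Set.indicator_of_mem hx, ← ofReal_norm,
        norm_rpow_sub_two_smul hp,
        ENNReal.ofReal_rpow_of_nonneg (by positivity) hq0.le, ← Real.rpow_mul (norm_nonneg _),
        h.hpq.sub_one_mul_conj, ← ofReal_norm,
        ENNReal.ofReal_rpow_of_nonneg (norm_nonneg _) h.hpq.nonneg]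
    · rw [hhh, Set.indicator_of_notMem hx, Set.indicator_of_notMem hx, enorm_zero,
        ENNReal.zero_rpow_of_pos hq0]
  have hint : ∀ K : DCube d, J.set ⊆ K.set →
      ∫ x in K.set, inner ℂ (f x) (g x) = (X.toReal : ℂ) := by
    intro K hK
    have e1 : (fun x => inner ℂ (f x) (g x)) =
        E.indicator fun x => ((‖u x‖ ^ p : ℝ) : ℂ) := by
      funext x
      by_cases hx : x ∈ E
      · rw [hg, ← (h.pd x).inner_mApp, hhh, Set.indicator_of_mem hx, Set.indicator_of_mem hx]
        exact inner_rpow_sub_two_smul hp _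
      · rw [hnot x hx, inner_zero_right, Set.indicator_of_notMem hx]
    rw [e1, setIntegral_indicator hE, Set.inter_eq_right.2 (hEJ.trans hK),
      integral_complex_ofReal, integral_eq_lintegral_of_nonneg_ae
        (Filter.Eventually.of_forall fun x => by positivity)
        (hum.norm.pow_const _).aestronglyMeasurable, hX]
    congr 3
    funext x
    rw [← ofReal_norm, ENNReal.ofReal_rpow_of_nonneg (norm_nonneg _) h.hpq.nonneg]
  have hfi := h.integrableOn_of_lintegral_ne_top hf hfin
  have hXe : ‖(X.toReal : ℂ)‖ₑ = X := by
    rw [← ofReal_norm, Complex.norm_real, Real.norm_of_nonneg ENNReal.toReal_nonneg,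
      ENNReal.ofReal_toReal hXt]
  have hfinal := h.enorm_le_of_forall_avgForm hd hf hfin hgi J (z := (X.toReal : ℂ))
    (R := squareBound p q c₁ c₂ M V f * X ^ (1 / q)) fun K hK => by
      rw [← hint K hK, ← hhX]
      exact h.enorm_integral_sub_avgForm_le hhm (fun x => rfl) hfi hgi hB hsq K
  rw [hXe] at hfinal
  exact ENNReal.le_rpow_of_le_mul_rpow h.hpq.symm hXt hfinal

lemma setLIntegral_cube_le {f : (Fin d → ℝ) → EuclideanSpace ℂ (Fin n)} (hd : 0 < d)
    (hf : Measurable f) (hfin : ∫⁻ x, ‖mApp (M x) (f x)‖ₑ ^ p ≠ ⊤)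
    (hsq : ∫⁻ x, sqRoot V f x ^ p ≠ ⊤) (J : DCube d) :
    ∫⁻ x in J.set, ‖mApp (M x) (f x)‖ₑ ^ p ≤ squareBound p q c₁ c₂ M V f ^ p := by
  set E : ℕ → Set (Fin d → ℝ) := fun k =>
    J.set ∩ ({x | ‖mApp (M x) (f x)‖ ≤ k} ∩ {x | matNorm (M x) ≤ k})
  have hEm : ∀ k, MeasurableSet (E k) := fun k => J.measurableSet_set.inter
    ((measurableSet_le (h.meas.mApp hf).norm measurable_const).inter
      (measurableSet_le h.meas.matNorm measurable_const))
  have hmono : Monotone E := fun i j hij x hx => by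
    have : (i : ℝ) ≤ j := by exact_mod_cast hij
    exact ⟨hx.1, hx.2.1.trans this, hx.2.2.trans this⟩
  have hU : J.set = ⋃ k, E k := by
    refine Set.Subset.antisymm (fun x hx => ?_) (Set.iUnion_subset fun k x hx => hx.1)
    obtain ⟨k, hk⟩ := exists_nat_ge (max ‖mApp (M x) (f x)‖ (matNorm (M x)))
    exact Set.mem_iUnion.2 ⟨k, hx, (le_max_left _ _).trans hk, (le_max_right _ _).trans hk⟩
  rw [hU, setLIntegral_iUnion_of_directed _ hmono.directed_le]
  exact iSup_le fun k => h.lintegral_le_of_bounded hd hf hfin hsq J (hEm k)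
    (fun x hx => hx.1) k.cast_nonneg (fun x hx => hx.2.1) fun x hx => hx.2.2

lemma lintegral_mApp_rpow_le {f : (Fin d → ℝ) → EuclideanSpace ℂ (Fin n)} (hd : 0 < d)
    (hf : Measurable f) (hfin : ∫⁻ x, ‖mApp (M x) (f x)‖ₑ ^ p ≠ ⊤)
    (hsq : ∫⁻ x, sqRoot V f x ^ p ≠ ⊤) :
    ∫⁻ x, ‖mApp (M x) (f x)‖ₑ ^ p ≤ 2 ^ d * squareBound p q c₁ c₂ M V f ^ p := by
  set J : (Fin d → Bool) → ℕ → DCube d := fun v k => ⟨k, fun i => if v i then 0 else -1⟩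
  have hmono : ∀ v, Monotone fun k => (J v k).set := fun v i j hij x hx l => by
    have h2 : (2 : ℝ) ^ i ≤ 2 ^ j := pow_le_pow_right₀ one_le_two hij
    have := hx l
    simp only [J, zpow_natCast] at this ⊢
    split_ifs at this ⊢
    all_goals
      push_cast at this ⊢
      constructor <;> linarith [this.1, this.2]
  have hU : Set.univ ⊆ ⋃ v, ⋃ k, (J v k).set := fun x _ => by
    obtain ⟨k, hk⟩ := pow_unbounded_of_one_lt (∑ i, |x i|) (one_lt_two (α := ℝ))
    refine Set.mem_iUnion.2 ⟨fun i => decide (0 ≤ x i), Set.mem_iUnion.2 ⟨k, fun i => ?_⟩⟩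
    have hi : |x i| < 2 ^ k :=
      (Finset.single_le_sum (f := fun i => |x i|) (fun i _ => abs_nonneg _)
        (Finset.mem_univ i)).trans_lt hk
    have := abs_lt.1 hi
    simp only [J, zpow_natCast, decide_eq_true_eq]
    split_ifs with h0
    all_goals
      push_cast
      constructor <;> linarith [this.1, this.2]
  calc ∫⁻ x, ‖mApp (M x) (f x)‖ₑ ^ p
      = ∫⁻ x in Set.univ, ‖mApp (M x) (f x)‖ₑ ^ p := by rw [setLIntegral_univ]
    _ ≤ ∫⁻ x in ⋃ v, ⋃ k, (J v k).set, ‖mApp (M x) (f x)‖ₑ ^ p := lintegral_mono_set hU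
    _ ≤ ∑' v, ∫⁻ x in ⋃ k, (J v k).set, ‖mApp (M x) (f x)‖ₑ ^ p := lintegral_iUnion_le _ _
    _ ≤ ∑' _ : Fin d → Bool, squareBound p q c₁ c₂ M V f ^ p := by
        refine ENNReal.tsum_le_tsum fun v => ?_
        rw [setLIntegral_iUnion_of_directed _ (hmono v).directed_le]
        exact iSup_le fun k => h.setLIntegral_cube_le hd hf hfin hsq _
    _ = _ := by
        rw [tsum_fintype, Finset.sum_const, nsmul_eq_mul]
        simp

end IsApWeight

lemma pairConst_ne_top (d n : ℕ) {p q c₁ c₂ : ℝ} (hpq : p.HolderConjugate q) :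
    pairConst d n p q c₁ c₂ ≠ ⊤ := by
  have hp0 := hpq.nonneg
  have hq0 := hpq.symm.nonneg
  have hpi := hpq.one_div_nonneg
  have hqi := hpq.symm.one_div_nonneg
  have h1 : DCube.maxConst p q ≠ ⊤ := ENNReal.mul_ne_top
    (ENNReal.rpow_ne_top_of_nonneg (by positivity) (by norm_num)) ENNReal.ofReal_ne_top
  have h2 : carlesonConst n p q c₁ ≠ ⊤ := by
    refine ENNReal.mul_ne_top (ENNReal.rpow_ne_top_of_nonneg (by positivity)
      (ENNReal.mul_ne_top ENNReal.ofReal_ne_top (ENNReal.mul_ne_top ?_ ?_)))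
      ENNReal.ofReal_ne_top
    · exact ENNReal.rpow_ne_top_of_nonneg hp0 (by simp)
    · exact ENNReal.rpow_ne_top_of_nonneg hp0 ENNReal.ofReal_ne_top
  refine ENNReal.mul_ne_top (ENNReal.mul_ne_top (ENNReal.mul_ne_top ?_ ?_)
    (ENNReal.rpow_ne_top_of_nonneg hpi h1)) (ENNReal.rpow_ne_top_of_nonneg hqi h2)
  · exact ENNReal.mul_ne_top (by norm_num) (by simp)
  · refine ENNReal.mul_ne_top (ENNReal.mul_ne_top (ENNReal.mul_ne_top ENNReal.ofReal_ne_top ?_)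
      (by simp)) ENNReal.ofReal_ne_top
    exact ENNReal.rpow_ne_top_of_nonneg hqi (by norm_num)

namespace IsApWeight

variable {d n : ℕ} {p q c₁ c₂ : ℝ} {M : (Fin d → ℝ) → Matrix (Fin n) (Fin n) ℂ}
  {V : DCube d → Matrix (Fin n) (Fin n) ℂ} (h : IsApWeight p q c₁ c₂ M V)
include h

lemma wNorm_le {f : (Fin d → ℝ) → EuclideanSpace ℂ (Fin n)} (hd : 0 < d)
    (hf : Measurable f) (hfin : wNorm p M f < ⊤) :
    wNorm p M f ≤ ((2 ^ d) ^ (1 / p) * pairConst d n p q c₁ c₂ + 1) *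
      apNorm p M ^ ((1 + (⌈p⌉₊ : ℝ)) / p) * (∫⁻ x, sqFn V f x ^ (p / 2)) ^ (1 / p) := by
  have hp0 := h.hpq.pos
  have hpi := h.hpq.one_div_nonneg
  have hA1 := h.one_le_apNorm ⟨0, 0⟩
  have hA0 : apNorm p M ≠ 0 := (zero_lt_one.trans_le hA1).ne'
  have hsq : ∫⁻ x, sqFn V f x ^ (p / 2) = ∫⁻ x, sqRoot V f x ^ p := by
    refine lintegral_congr fun x => ?_
    rw [sqRoot, ← ENNReal.rpow_mul]
    congr 1
    ring
  rw [hsq]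
  rcases eq_or_ne (∫⁻ x, sqRoot V f x ^ p) ⊤ with htop | htop
  · rw [htop, ENNReal.top_rpow_of_pos (by positivity), ENNReal.mul_top]
    · exact le_top
    · refine mul_ne_zero (by simp) ?_
      simp [ENNReal.rpow_eq_zero_iff, hA0, h.ap.ne]
  have hfin' : ∫⁻ x, ‖mApp (M x) (f x)‖ₑ ^ p ≠ ⊤ := fun htop' => by
    rw [wNorm] at hfin
    simp only [ofReal_norm] at hfin
    rw [htop', ENNReal.top_rpow_of_pos (by positivity)] at hfin
    exact lt_irrefl _ hfin
  have hAA : apNorm p M ^ (1 / p) * apNorm p M ≤ apNorm p M ^ ((1 + (⌈p⌉₊ : ℝ)) / p) := by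
    nth_rewrite 2 [← ENNReal.rpow_one (apNorm p M)]
    rw [← ENNReal.rpow_add _ _ hA0 h.ap.ne]
    refine ENNReal.rpow_le_rpow_of_exponent_le hA1 ?_
    rw [add_div]
    gcongr
    rw [le_div_iff₀ hp0, one_mul]
    exact Nat.le_ceil p
  rw [wNorm]
  simp only [ofReal_norm]
  calc _ ≤ (2 ^ d * squareBound p q c₁ c₂ M V f ^ p) ^ (1 / p) :=
        ENNReal.rpow_le_rpow (h.lintegral_mApp_rpow_le hd hf hfin' htop) hpi
    _ = (2 ^ d) ^ (1 / p) * pairConst d n p q c₁ c₂ * (apNorm p M ^ (1 / p) * apNorm p M) *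
          (∫⁻ x, sqRoot V f x ^ p) ^ (1 / p) := by
        rw [ENNReal.mul_rpow_of_nonneg _ _ hpi, ← ENNReal.rpow_mul, mul_one_div_cancel hp0.ne',
          ENNReal.rpow_one, squareBound]
        ring
    _ ≤ _ := mul_le_mul' (mul_le_mul' le_self_add hAA) le_rfl

end IsApWeight

lemma exists_posDef_ae_eq {d n : ℕ} {W : (Fin d → ℝ) → Matrix (Fin n) (Fin n) ℂ}
    (hW : MatMeasurable W) (hpd : ∀ᵐ x ∂(volume : Measure (Fin d → ℝ)), (W x).PosDef) :
    ∃ M, MatMeasurable M ∧ (∀ x, (M x).PosDef) ∧ M =ᵐ[volume] W := by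
  classical
  set N := toMeasurable volume {x | ¬ (W x).PosDef} with hN
  have hNm : MeasurableSet N := measurableSet_toMeasurable _ _
  have hN0 : volume N = 0 := (measure_toMeasurable _).trans hpd
  refine ⟨fun x => if x ∈ N then 1 else W x, fun i j => ?_, fun x => ?_, ?_⟩
  · have e : (fun x => (if x ∈ N then (1 : Matrix (Fin n) (Fin n) ℂ) else W x) i j) =
        fun x => if x ∈ N then (1 : Matrix (Fin n) (Fin n) ℂ) i j else W x i j := by
      funext x
      split_ifs <;> rfl
    rw [e]
    exact Measurable.ite hNm measurable_const (hW i j)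
  · beta_reduce
    split_ifs with hx
    · exact Matrix.PosDef.one
    · exact by_contra fun hc => hx (subset_toMeasurable _ _ hc)
  · filter_upwards [compl_mem_ae_iff.2 hN0] with x hx
    rw [if_neg hx]

lemma apNorm_congr_ae {d n : ℕ} (p : ℝ) {M W : (Fin d → ℝ) → Matrix (Fin n) (Fin n) ℂ}
    (h : M =ᵐ[volume] W) : apNorm p M = apNorm p W := by
  have h1 : ∀ (s : Set (Fin d → ℝ)) (φ : Matrix (Fin n) (Fin n) ℂ → ℝ≥0∞),
      ∫⁻ x in s, φ (M x) = ∫⁻ x in s, φ (W x) := fun s φ =>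
    lintegral_congr_ae ((ae_restrict_of_ae h).mono fun x hx => congrArg φ hx)
  unfold apNorm
  refine iSup_congr fun c => iSup_congr fun r => iSup_congr fun _ => ?_
  rw [h1 _ fun A => ((ENNReal.ofReal (r ^ d))⁻¹ * ∫⁻ t in cubeSet c r,
    ENNReal.ofReal (matNorm (A * (M t)⁻¹)) ^ (p / (p - 1))) ^ (p - 1)]
  have h2 : ∀ x, ∫⁻ t in cubeSet c r, ENNReal.ofReal (matNorm (W x * (M t)⁻¹)) ^ (p / (p - 1)) =
      ∫⁻ t in cubeSet c r, ENNReal.ofReal (matNorm (W x * (W t)⁻¹)) ^ (p / (p - 1)) := fun x =>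
    h1 _ fun A => ENNReal.ofReal (matNorm (W x * A⁻¹)) ^ (p / (p - 1))
  simp only [h2]

lemma redAvgD_congr_ae {d n : ℕ} (p : ℝ) {M W : (Fin d → ℝ) → Matrix (Fin n) (Fin n) ℂ}
    (h : M =ᵐ[volume] W) : redAvgD p M = redAvgD p W := by
  funext I e
  rw [redAvgD, redAvgD]
  congr 2
  exact lintegral_congr_ae ((ae_restrict_of_ae h).mono fun t ht => by simp only [ht])

lemma wNorm_congr_ae {d n : ℕ} (p : ℝ) {M W : (Fin d → ℝ) → Matrix (Fin n) (Fin n) ℂ}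
    (h : M =ᵐ[volume] W) (f : (Fin d → ℝ) → EuclideanSpace ℂ (Fin n)) :
    wNorm p M f = wNorm p W f := by
  rw [wNorm, wNorm]
  congr 1
  exact lintegral_congr_ae (h.mono fun t ht => by simp only [ht])

/-- If `1 < p < ∞` and `W` is a matrix `A_p` weight on `ℝ^d` with reducing
operators `V_I`, then there is a constant `C = C(p, n, d)` (and depending on the fixed
comparability constants `c₁, c₂` of the reducing operators) such that for every
`f ∈ L^p(W)`:
`‖f‖_{L^p(W)} ≤ C ‖W‖_{A_p}^{1/p + ⌈p⌉/p}
   (∫_{ℝ^d} (∑_{I ∈ 𝒟} ∑_{ε ∈ 𝒮} |V_I f_I^ε|² |I|^{-1} χ_I(x))^{p/2} dx)^{1/p}`. -/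
theorem statement0 (d n : ℕ) (hd : 0 < d) (hn : 0 < n) (p c₁ c₂ : ℝ)
    (hp : 1 < p) (hc₁ : 0 < c₁) (hc₂ : 0 < c₂) :
    ∃ C : ℝ≥0∞, 0 < C ∧ C < ⊤ ∧
      ∀ (W1p : (Fin d → ℝ) → Matrix (Fin n) (Fin n) ℂ)
        (V : DCube d → Matrix (Fin n) (Fin n) ℂ)
        (f : (Fin d → ℝ) → EuclideanSpace ℂ (Fin n)),
        MatMeasurable W1p →
        (∀ᵐ x ∂(volume : Measure (Fin d → ℝ)), (W1p x).PosDef) →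
        apNorm p W1p < ⊤ →
        IsReducing p c₁ c₂ W1p V →
        StronglyMeasurable f →
        wNorm p W1p f < ⊤ →
        wNorm p W1p f ≤
          C * apNorm p W1p ^ ((1 + (⌈p⌉₊ : ℝ)) / p) *
            (∫⁻ x, sqFn V f x ^ (p / 2)) ^ (1 / p) := by
  have hpq : p.HolderConjugate (p / (p - 1)) := Real.HolderConjugate.conjExponent hp
  have hC : (2 ^ d) ^ (1 / p) * pairConst d n p (p / (p - 1)) c₁ c₂ ≠ ⊤ :=
    ENNReal.mul_ne_top (ENNReal.rpow_ne_top_of_nonneg hpq.one_div_nonneg (by simp))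
      (pairConst_ne_top d n hpq)
  refine ⟨(2 ^ d) ^ (1 / p) * pairConst d n p (p / (p - 1)) c₁ c₂ + 1,
    zero_lt_one.trans_le le_add_self, ENNReal.add_lt_top.2 ⟨hC.lt_top, one_lt_top⟩, ?_⟩
  intro W1p V f hmeas hpd hap hred hf hfin
  obtain ⟨M, hM, hMpd, hMW⟩ := exists_posDef_ae_eq hmeas hpd
  rw [← apNorm_congr_ae p hMW] at hap ⊢
  rw [← wNorm_congr_ae p hMW] at hfin ⊢
  have h : IsApWeight p (p / (p - 1)) c₁ c₂ M V := ⟨hn, hpq, hc₁, hc₂, hM, hMpd, hap, by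
    rw [IsReducing, redAvgD_congr_ae p hMW]
    exact hred⟩
  exact h.wNorm_le hd hf.measurable hfin

end
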